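/- arXiv:1404.4771 — 2 statements merged into one kernel-verified Lean document; each statement's English description precedes it below -/
import Mathlib

section
/- Let (G, G⁺) be a countable simple dimension group with order unit u such that the rational subgroup ℚ(G,u) is not cyclic, and let t be a real number with 0 ≤ t < ∞. Then there exist a finite alphabet Λ, a nonperiodic Toeplitz sequence η : ℤ → Λ with associated Toeplitz flow (X, T), and a surjective group homomorphism φ : C(X,ℤ) → G such that: (i) the kernel of φ equals the coboundary subgroup B_T, φ maps {f ∈ C(X,ℤ) : f ≥ 0} onto G⁺, and φ(1) = u (so (K⁰(X,T), K⁰(X,T)⁺, 𝟙) is order isomorphic to (G, G⁺, u) by an isomorphism preserving order units); (ii) the topological entropy of T equals t; (iii) for every integer p ≥ 2 there exists a continuous function f : X → ℂ, not identically zero, with f(T x) = e^{2πi/p}·f(x) for all x ∈ X if and only if there exists g ∈ G with p·g = u, and moreover every λ ∈ ℂ admitting a nonzero continuous eigenfunction f with f∘T = λ·f is a root of unity. -/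
/-- A Toeplitz sequence: every position is periodic for some period `p ≥ 1`. -/
def IsToeplitz {Λ : Type*} (η : ℤ → Λ) : Prop :=
  ∀ n : ℤ, ∃ p : ℤ, 1 ≤ p ∧ ∀ m : ℤ, η (n + m * p) = η n

/-- A sequence is nonperiodic if it has no global period `p ≥ 1`. -/
def IsNonperiodic {Λ : Type*} (η : ℤ → Λ) : Prop :=
  ¬ ∃ p : ℤ, 1 ≤ p ∧ ∀ n : ℤ, η (n + p) = η n

/-- The two-sided shift orbit of `η` in `Λ^ℤ`. -/
def shiftOrbit {Λ : Type*} (η : ℤ → Λ) : Set (ℤ → Λ) :=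
  {x | ∃ n : ℤ, x = fun k => η (k + n)}

/-- The shift homeomorphism on `Λ^ℤ`. -/
def shiftHomeo (Λ : Type*) [TopologicalSpace Λ] : (ℤ → Λ) ≃ₜ (ℤ → Λ) where
  toFun x := fun k => x (k + 1)
  invFun x := fun k => x (k - 1)
  left_inv x := by funext k; simp
  right_inv x := by funext k; simp
  continuous_toFun := continuous_pi fun k => continuous_apply (k + 1)
  continuous_invFun := continuous_pi fun k => continuous_apply (k - 1)

/-- The phase space of the Toeplitz flow of `η`: the orbit closure of `η`. -/
def toeplitzX {Λ : Type*} [TopologicalSpace Λ] (η : ℤ → Λ) : Set (ℤ → Λ) :=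
  closure (shiftOrbit η)

lemma shiftHomeo_image_orbit {Λ : Type*} [TopologicalSpace Λ] (η : ℤ → Λ) :
    shiftHomeo Λ '' shiftOrbit η = shiftOrbit η := by
  ext x
  constructor
  · rintro ⟨y, ⟨n, rfl⟩, rfl⟩
    exact ⟨n + 1, by funext k; show η (k + 1 + n) = η (k + (n + 1)); ring_nf⟩
  · rintro ⟨n, rfl⟩
    refine ⟨fun k => η (k + (n - 1)), ⟨n - 1, rfl⟩, ?_⟩
    funext k; show η (k + 1 + (n - 1)) = η (k + n); ring_nf

lemma shiftHomeo_image_toeplitzX {Λ : Type*} [TopologicalSpace Λ] (η : ℤ → Λ) :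
    shiftHomeo Λ '' toeplitzX η = toeplitzX η := by
  rw [toeplitzX, Homeomorph.image_closure, shiftHomeo_image_orbit]

/-- The Toeplitz flow transformation: the shift restricted to the orbit
closure of `η`. -/
def toeplitzT {Λ : Type*} [TopologicalSpace Λ] (η : ℤ → Λ) :
    ↥(toeplitzX η) ≃ₜ ↥(toeplitzX η) :=
  ((shiftHomeo Λ).image (toeplitzX η)).trans
    (Homeomorph.setCongr (shiftHomeo_image_toeplitzX η))

/-- A Toeplitz flow: a nonperiodic Toeplitz sequence over a finite nonempty
alphabet (with the discrete uniformity/topology), together with the orbit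
closure dynamics. -/
structure ToeplitzFlow : Type 1 where
  Λ : Type
  [fin : Fintype Λ]
  [nonempty : Nonempty Λ]
  η : ℤ → Λ
  toeplitz : IsToeplitz η
  nonperiodic : IsNonperiodic η

attribute [instance] ToeplitzFlow.fin ToeplitzFlow.nonempty

noncomputable instance (F : ToeplitzFlow) : UniformSpace F.Λ := ⊥

instance (F : ToeplitzFlow) : DiscreteTopology F.Λ := by
  constructor
  change UniformSpace.toTopologicalSpace = ⊥
  exact UniformSpace.toTopologicalSpace_bot

/-- The phase space of a Toeplitz flow. -/
abbrev ToeplitzFlow.X (F : ToeplitzFlow) : Type := ↥(toeplitzX F.η)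

/-- The transformation of a Toeplitz flow (the restricted shift). -/
noncomputable def ToeplitzFlow.T (F : ToeplitzFlow) : F.X ≃ₜ F.X := toeplitzT F.η

/-- The topological entropy (Bowen–Dinaburg cover entropy, with respect to the
canonical uniformity of the compact metrizable space `F.X`) of a Toeplitz flow. -/
noncomputable def ToeplitzFlow.entropy (F : ToeplitzFlow) : EReal :=
  Dynamics.coverEntropy (F.T : F.X → F.X) Set.univ

/-- `u` is an order unit for the cone `P`. -/
def IsOrderUnitFor {G : Type*} [AddCommGroup G] (P : Set G) (u : G) : Prop :=
  u ∈ P ∧ ∀ a : G, ∃ n : ℤ, 1 ≤ n ∧ n • u - a ∈ P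

/-- `(G, P)` is a (countable, noncyclic) simple dimension group. -/
structure IsSimpleDimensionGroup (G : Type*) [AddCommGroup G] (P : Set G) : Prop where
  countable : Countable G
  zero_mem : (0 : G) ∈ P
  add_mem : ∀ a b : G, a ∈ P → b ∈ P → a + b ∈ P
  pos_neg_eq_zero : ∀ a : G, a ∈ P → -a ∈ P → a = 0
  directed : ∀ g : G, ∃ a ∈ P, ∃ b ∈ P, g = a - b
  unperforated : ∀ (n : ℤ) (a : G), 1 ≤ n → n • a ∈ P → a ∈ P
  riesz : ∀ a₁ a₂ b₁ b₂ : G, b₁ - a₁ ∈ P → b₂ - a₁ ∈ P → b₁ - a₂ ∈ P → b₂ - a₂ ∈ P →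
    ∃ c : G, c - a₁ ∈ P ∧ c - a₂ ∈ P ∧ b₁ - c ∈ P ∧ b₂ - c ∈ P
  simple : ∀ a : G, a ∈ P → a ≠ 0 → IsOrderUnitFor P a
  noncyclic : ¬ ∃ g : G, ∀ x : G, ∃ n : ℤ, x = n • g

/-- The coboundary homomorphism `g ↦ g - g ∘ T⁻¹` on `C(X, ℤ)`. -/
def coboundaryHom {X : Type*} [TopologicalSpace X] (T : X ≃ₜ X) :
    C(X, ℤ) →+ C(X, ℤ) :=
  AddMonoidHom.mk' (fun g => g - g.comp (T.symm : C(X, X))) (by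
    intro a b
    ext x
    simp [ContinuousMap.add_apply]
    ring)

/-- The subgroup `B_T = {g - g ∘ T⁻¹ : g ∈ C(X, ℤ)}` of coboundaries. -/
def coboundaries {X : Type*} [TopologicalSpace X] (T : X ≃ₜ X) :
    AddSubgroup C(X, ℤ) :=
  (coboundaryHom T).range

/-- The rational subgroup `ℚ(G, u) = {g : ∃ n ≥ 1, m, n • g = m • u}`. -/
def rationalSubgroup (G : Type*) [AddCommGroup G] (u : G) : AddSubgroup G where
  carrier := {g : G | ∃ n : ℤ, 1 ≤ n ∧ ∃ m : ℤ, n • g = m • u}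
  zero_mem' := ⟨1, le_refl 1, 0, by simp⟩
  add_mem' := by
    rintro a b ⟨n₁, hn₁, m₁, h₁⟩ ⟨n₂, hn₂, m₂, h₂⟩
    refine ⟨n₁ * n₂, by nlinarith, n₂ * m₁ + n₁ * m₂, ?_⟩
    have : (n₁ * n₂) • (a + b) = n₂ • (n₁ • a) + n₁ • (n₂ • b) := by
      rw [smul_add, smul_smul, smul_smul, mul_comm n₂ n₁]
    rw [this, h₁, h₂, smul_smul, smul_smul, ← add_smul]
  neg_mem' := by
    rintro a ⟨n, hn, m, h⟩
    exact ⟨n, hn, -m, by rw [smul_neg, h, neg_smul]⟩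

/-- The order-theoretic part of being a simple dimension group, for a partially ordered abelian
group: Riesz interpolation, unperforation, and every nonzero positive element is an order unit. -/
structure SimpleRieszGroup (G : Type*) [AddCommGroup G] [PartialOrder G] : Prop where
  riesz : ∀ a₁ a₂ b₁ b₂ : G, a₁ ≤ b₁ → a₁ ≤ b₂ → a₂ ≤ b₁ → a₂ ≤ b₂ →
    ∃ c, a₁ ≤ c ∧ a₂ ≤ c ∧ c ≤ b₁ ∧ c ≤ b₂
  unperforated : ∀ (n : ℕ) (a : G), 0 < n → 0 ≤ n • a → 0 ≤ a
  simple : ∀ a : G, 0 < a → ∀ b : G, ∃ n : ℕ, b ≤ n • a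

namespace SimpleRieszGroup

lemma sum_subtype_of_forall_eq_zero {M J : Type*} [AddCommMonoid M] [Fintype J] (p : J → Prop)
    [DecidablePred p] (F : J → M) (h : ∀ j, ¬ p j → F j = 0) :
    ∑ j : {j // p j}, F j = ∑ j, F j := by
  rw [← Finset.sum_subtype (Finset.univ.filter p) (by simp) F]
  exact Finset.sum_filter_of_ne fun j _ hj => by_contra fun hp => hj (h j hp)

variable {G : Type*} [AddCommGroup G] [PartialOrder G]

/-- A family `g` of positive elements is refined by a family `z` through the matrix `v`. -/
def Refines {ι J : Type*} [Fintype J] (g : ι → G) (z : J → G) (v : J → ι → ℕ) : Prop :=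
  (∀ j, 0 ≤ z j) ∧ ∀ i, g i = ∑ j, v j i • z j

lemma Refines.trans {ι J K : Type*} [Fintype J] [Fintype K] {g : ι → G} {z : J → G}
    {v : J → ι → ℕ} {y : K → G} {w : K → J → ℕ} (h : Refines g z v) (h' : Refines z y w) :
    Refines g y (fun k i => ∑ j, w k j * v j i) := by
  refine ⟨h'.1, fun i => ?_⟩
  simp only [h.2 i, h'.2, Finset.smul_sum, Finset.sum_smul, smul_smul]
  rw [Finset.sum_comm]
  simp only [mul_comm]

lemma Refines.sum_smul {ι J : Type*} [Fintype ι] [Fintype J] {g : ι → G} {z : J → G}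
    {v : J → ι → ℕ} (h : Refines g z v) (c : ι → ℤ) :
    ∑ j, (∑ i, (v j i : ℤ) * c i) • z j = ∑ i, c i • g i := by
  simp only [h.2, Finset.smul_sum, Finset.sum_smul, mul_smul]
  rw [Finset.sum_comm]
  refine Finset.sum_congr rfl fun i _ => Finset.sum_congr rfl fun j _ => ?_
  rw [← natCast_zsmul, smul_smul, smul_smul, mul_comm]

lemma refines_self {ι : Type*} [Fintype ι] [DecidableEq ι] {g : ι → G} (hg : ∀ i, 0 ≤ g i) :
    Refines g g (fun j i => if j = i then 1 else 0) :=
  ⟨hg, fun i => by simp [ite_smul]⟩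

variable [IsOrderedAddMonoid G]

lemma le_of_nsmul_le (hG : SimpleRieszGroup G) {n : ℕ} (hn : 0 < n) {a b : G}
    (h : n • a ≤ n • b) : a ≤ b := by
  rw [← sub_nonneg] at h ⊢
  exact hG.unperforated n _ hn (by rwa [smul_sub])

lemma eq_of_nsmul_eq (hG : SimpleRieszGroup G) {n : ℕ} (hn : 0 < n) {a b : G}
    (h : n • a = n • b) : a = b :=
  le_antisymm (hG.le_of_nsmul_le hn h.le) (hG.le_of_nsmul_le hn h.ge)

/-- Riesz decomposition. -/
lemma exists_decomposition (hG : SimpleRieszGroup G) {ι : Type*} (s : Finset ι) (y : ι → G)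
    (hy : ∀ i ∈ s, 0 ≤ y i) (x : G) (hx : 0 ≤ x) (hxy : x ≤ ∑ i ∈ s, y i) :
    ∃ z : ι → G, (∀ i, 0 ≤ z i) ∧ (∀ i ∈ s, z i ≤ y i) ∧ (∀ i ∉ s, z i = 0) ∧
      x = ∑ i ∈ s, z i := by
  classical
  induction s using Finset.induction_on generalizing x with
  | empty =>
    refine ⟨fun _ => 0, fun _ => le_rfl, by simp, by simp, ?_⟩
    simpa using le_antisymm (by simpa using hxy) hx
  | insert a s ha ih =>
    rw [Finset.sum_insert ha] at hxy
    have hs : 0 ≤ ∑ i ∈ s, y i :=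
      Finset.sum_nonneg fun i hi => hy i (Finset.mem_insert_of_mem hi)
    obtain ⟨c, h0, h1, h2, h3⟩ := hG.riesz 0 (x - ∑ i ∈ s, y i) x (y a) hx
      (hy a (Finset.mem_insert_self _ _)) (sub_le_self _ hs) (sub_le_iff_le_add.2 hxy)
    obtain ⟨z, hz0, hz1, hz2, hz3⟩ := ih (fun i hi => hy i (Finset.mem_insert_of_mem hi)) (x - c)
      (sub_nonneg.2 h2) (sub_le_comm.1 h1)
    refine ⟨Function.update z a c, fun i => ?_, fun i hi => ?_, fun i hi => ?_, ?_⟩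
    · by_cases h : i = a
      · subst h; simpa using h0
      · simpa [h] using hz0 i
    · by_cases h : i = a
      · subst h; simpa using h3
      · simpa [h] using hz1 i (Finset.mem_of_mem_insert_of_ne hi h)
    · simp only [Finset.mem_insert, not_or] at hi
      simpa [hi.1] using hz2 i hi.2
    · rw [Finset.sum_insert ha, Function.update_self,
        Finset.sum_congr rfl fun i hi => Function.update_of_ne (ne_of_mem_of_not_mem hi ha) c z,
        ← hz3]
      abel

lemma exists_kill_step (hG : SimpleRieszGroup G) {ι : Type} [Fintype ι] (g : ι → G)
    (hg : ∀ i, 0 ≤ g i) (c : ι → ℤ) (hc : ∑ i, c i • g i = 0) (m : ℕ)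
    (hm : ∀ i, |c i| ≤ m) (i₀ : ι) (hi₀ : c i₀ = m) (hm0 : 0 < m) :
    ∃ (J : Type) (_ : Fintype J) (z : J → G) (v : J → ι → ℕ), Refines g z v ∧
      (∀ j, |∑ i, (v j i : ℤ) * c i| ≤ m) ∧
      (Finset.univ.filter fun j => |∑ i, (v j i : ℤ) * c i| = m).card <
        (Finset.univ.filter fun i => |c i| = m).card := by
  classical
  let N : Finset ι := Finset.univ.filter fun i => c i < 0
  have hle : g i₀ ≤ ∑ i ∈ N, g i := by
    apply hG.le_of_nsmul_le hm0
    have h1 : (m : ℤ) • g i₀ + ∑ i ∈ N, c i • g i ≤ 0 := by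
      rw [← hc, ← Finset.sum_filter_add_sum_filter_not Finset.univ (fun i => c i < 0), add_comm]
      refine add_le_add le_rfl ?_
      rw [← hi₀]
      refine Finset.single_le_sum (f := fun i => c i • g i) (fun i hi => ?_) ?_
      · exact zsmul_nonneg (hg i) (by simpa using hi)
      · simp [hi₀]
    have h2 : -∑ i ∈ N, c i • g i ≤ m • ∑ i ∈ N, g i := by
      rw [← Finset.sum_neg_distrib, Finset.smul_sum]
      refine Finset.sum_le_sum fun i _ => ?_
      rw [← neg_smul, ← natCast_zsmul]
      exact zsmul_le_zsmul_left (hg i) ((neg_le_abs _).trans (hm i))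
    rw [natCast_zsmul] at h1
    exact (le_neg_iff_add_nonpos_right.2 h1).trans h2
  obtain ⟨x, hx0, hx1, hx2, hx3⟩ := hG.exists_decomposition N g (fun i _ => hg i) _ (hg i₀) hle
  have hi₀N : i₀ ∉ N := by simp [N, hi₀]
  have hxg : ∀ i, x i ≤ g i := fun i => by
    by_cases h : i ∈ N
    · exact hx1 i h
    · rw [hx2 i h]; exact hg i
  let v : ι ⊕ ι → ι → ℕ := Sum.elim
    (fun j i => if c j < 0 then (if i₀ = i then 1 else 0) + (if j = i then 1 else 0) else 0)
    (fun j i => if j = i₀ then 0 else if j = i then 1 else 0)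
  have hvl : ∀ j, ∑ i, (v (Sum.inl j) i : ℤ) * c i = if c j < 0 then m + c j else 0 := by
    intro j
    by_cases h : c j < 0
    · simp [v, h, add_mul, Finset.sum_add_distrib, hi₀]
    · simp [v, h]
  have hvr : ∀ j, ∑ i, (v (Sum.inr j) i : ℤ) * c i = if j = i₀ then 0 else c j := by
    intro j
    by_cases h : j = i₀
    · simp [v, h]
    · simp [v, h]
  have hmz : (0 : ℤ) < m := by exact_mod_cast hm0
  refine ⟨ι ⊕ ι, inferInstance, Sum.elim x fun i => g i - x i, v, ⟨?_, fun k => ?_⟩, ?_, ?_⟩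
  · rintro (j | j)
    · exact hx0 j
    · exact sub_nonneg.2 (hxg j)
  · rw [Fintype.sum_sum_type]
    have hA : ∑ j, v (Sum.inl j) k • x j = (if i₀ = k then g i₀ else 0) + x k := by
      have : ∀ j, v (Sum.inl j) k • x j = (if i₀ = k then x j else 0) + if j = k then x j else 0 := by
        intro j
        by_cases h : c j < 0
        · simp [v, h, add_smul, ite_smul]
        · have : x j = 0 := hx2 j (by simpa [N] using h)
          simp [this]
      rw [Finset.sum_congr rfl fun j _ => this j, Finset.sum_add_distrib]
      congr 1
      · split_ifs
        · rw [hx3]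
          exact (Finset.sum_subset (Finset.subset_univ _) fun i _ hi => hx2 i hi).symm
        · simp
      · simp
    have hB : ∑ j, v (Sum.inr j) k • (g j - x j) = if i₀ = k then 0 else g k - x k := by
      by_cases h : i₀ = k
      · subst h
        rw [if_pos rfl]
        refine Finset.sum_eq_zero fun j _ => ?_
        by_cases h' : j = i₀ <;> simp [v, h']
      · rw [if_neg h, Finset.sum_eq_single k]
        · simp [v, Ne.symm h]
        · intro j _ hj; simp [v, hj]
        · simp
    simp only [Sum.elim_inl, Sum.elim_inr]
    rw [hA, hB]
    by_cases h : i₀ = k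
    · subst h; simp [hx2 i₀ hi₀N]
    · simp [h]
  · rintro (j | j)
    · rw [hvl]
      have := abs_le.1 (hm j)
      split_ifs with h
      · rw [abs_le]; constructor <;> linarith
      · simp
    · rw [hvr]
      split_ifs
      · simp
      · exact hm j
  · have hsub : (Finset.univ.filter fun j => |∑ i, (v j i : ℤ) * c i| = m) ⊆
        ((Finset.univ.filter fun i => |c i| = m).erase i₀).map Function.Embedding.inr := by
      rintro (j | j) hj
      · exfalso
        simp only [Finset.mem_filter, Finset.mem_univ, true_and, hvl] at hj
        have := abs_le.1 (hm j)
        split_ifs at hj with h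
        · rw [abs_of_nonneg (by linarith)] at hj; linarith
        · simp only [abs_zero] at hj; linarith
      · simp only [Finset.mem_filter, Finset.mem_univ, true_and, hvr] at hj
        split_ifs at hj with h
        · simp only [abs_zero] at hj; linarith
        · simp [h, hj]
    refine (Finset.card_le_card hsub).trans_lt ?_
    rw [Finset.card_map]
    exact Finset.card_erase_lt_of_mem (by simp [hi₀])

/-- Shen's lemma: a single integral relation can be made trivial by refining. -/
lemma exists_kill_relation (hG : SimpleRieszGroup G) {ι : Type} [Fintype ι] (g : ι → G)
    (hg : ∀ i, 0 ≤ g i) (c : ι → ℤ) (hc : ∑ i, c i • g i = 0) :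
    ∃ (J : Type) (_ : Fintype J) (z : J → G) (v : J → ι → ℕ), Refines g z v ∧
      ∀ j, ∑ i, (v j i : ℤ) * c i = 0 := by
  classical
  have key : ∀ (m n : ℕ) (ι : Type) [Fintype ι] (g : ι → G) (_ : ∀ i, 0 ≤ g i) (c : ι → ℤ)
      (_ : ∑ i, c i • g i = 0) (_ : ∀ i, |c i| ≤ m)
      (_ : (Finset.univ.filter fun i => |c i| = m).card ≤ n),
      ∃ (J : Type) (_ : Fintype J) (z : J → G) (v : J → ι → ℕ), Refines g z v ∧
      ∀ j, ∑ i, (v j i : ℤ) * c i = 0 := by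
    intro m
    induction m with
    | zero =>
      intro n ι _ g hg c hc hm _
      have h0 : ∀ i, c i = 0 := fun i => abs_nonpos_iff.1 (by simpa using hm i)
      exact ⟨ι, inferInstance, g, _, refines_self hg, fun j => by simp [h0]⟩
    | succ m ihm =>
      intro n
      induction n with
      | zero =>
        intro ι _ g hg c hc hm hn
        refine ihm _ ι g hg c hc (fun i => ?_) le_rfl
        have h1 := hm i
        have h2 : |c i| ≠ (m + 1 : ℕ) := fun h => by
          have : i ∈ (Finset.univ.filter fun i => |c i| = (m + 1 : ℕ)) := by simpa using h
          rw [Finset.card_eq_zero.1 (Nat.le_zero.1 hn)] at this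
          simp at this
        push_cast at h1 h2
        omega
      | succ n ihn =>
        have pos : ∀ (ι : Type) [Fintype ι] (g : ι → G) (_ : ∀ i, 0 ≤ g i) (c : ι → ℤ)
            (_ : ∑ i, c i • g i = 0) (_ : ∀ i, |c i| ≤ (m + 1 : ℕ))
            (_ : (Finset.univ.filter fun i => |c i| = (m + 1 : ℕ)).card ≤ n + 1)
            (i₀ : ι) (_ : c i₀ = (m + 1 : ℕ)),
            ∃ (J : Type) (_ : Fintype J) (z : J → G) (v : J → ι → ℕ), Refines g z v ∧
            ∀ j, ∑ i, (v j i : ℤ) * c i = 0 := by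
          intro ι _ g hg c hc hm hn i₀ hi₀
          obtain ⟨J, _, z, v, hr, h1, h2⟩ := hG.exists_kill_step g hg c hc (m + 1) hm i₀ hi₀
            (Nat.succ_pos _)
          obtain ⟨K, _, y, w, hr', hw⟩ := ihn J z hr.1 (fun j => ∑ i, (v j i : ℤ) * c i)
            ((hr.sum_smul c).trans hc) h1 (by omega)
          refine ⟨K, inferInstance, y, _, hr.trans hr', fun k => ?_⟩
          rw [← hw k]
          push_cast
          simp only [Finset.sum_mul, Finset.mul_sum]
          rw [Finset.sum_comm]
          simp only [mul_assoc]
        intro ι _ g hg c hc hm hn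
        by_cases hex : ∃ i₀, |c i₀| = (m + 1 : ℕ)
        · obtain ⟨i₀, hi₀⟩ := hex
          rcases abs_choice (c i₀) with h | h
          · exact pos ι g hg c hc hm hn i₀ (h ▸ hi₀)
          · obtain ⟨J, i, z, v, hr, hv⟩ := pos ι g hg (fun i => - c i) (by simp [hc])
              (by simpa using hm) (by simpa using hn) i₀ (h ▸ hi₀)
            exact ⟨J, i, z, v, hr, fun j => by simpa using hv j⟩
        · refine ihm _ ι g hg c hc (fun i => ?_) le_rfl
          have h1 := hm i
          have h2 : |c i| ≠ (m + 1 : ℕ) := fun h => hex ⟨i, h⟩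
          push_cast at h1 h2
          omega
  obtain ⟨m, hm⟩ : ∃ m : ℕ, ∀ i, |c i| ≤ m := by
    refine ⟨∑ i, (c i).natAbs, fun i => ?_⟩
    rw [Int.abs_eq_natAbs]
    exact_mod_cast Finset.single_le_sum (f := fun i => (c i).natAbs) (fun _ _ => Nat.zero_le _)
      (Finset.mem_univ i)
  exact key m _ ι g hg c hc hm le_rfl

/-- The Effros–Handelman–Shen refinement: a finite family of positive elements is refined by
strictly positive elements through a matrix that annihilates all integral relations. -/
theorem exists_refinement (hG : SimpleRieszGroup G) {ι : Type} [Fintype ι] (g : ι → G)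
    (hg : ∀ i, 0 ≤ g i) :
    ∃ (J : Type) (_ : Fintype J) (z : J → G) (v : J → ι → ℕ), (∀ j, 0 < z j) ∧
      (∀ i, g i = ∑ j, v j i • z j) ∧
      ∀ c : ι → ℤ, ∑ i, c i • g i = 0 → ∀ j, ∑ i, (v j i : ℤ) * c i = 0 := by
  classical
  let S : Submodule ℤ (ι → ℤ) := LinearMap.ker
    ((Fintype.linearCombination ℤ g : (ι → ℤ) →ₗ[ℤ] G))
  have hS : ∀ c, c ∈ S ↔ ∑ i, c i • g i = 0 := fun c => by
    simp [S, LinearMap.mem_ker, Fintype.linearCombination_apply]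
  obtain ⟨t, ht⟩ : S.FG := IsNoetherian.noetherian S
  have key : ∀ t : Finset (ι → ℤ), (∀ c ∈ t, ∑ i, c i • g i = 0) →
      ∃ (J : Type) (_ : Fintype J) (z : J → G) (v : J → ι → ℕ), Refines g z v ∧
        ∀ c ∈ t, ∀ j, ∑ i, (v j i : ℤ) * c i = 0 := by
    intro t
    induction t using Finset.induction_on with
    | empty => exact fun _ => ⟨ι, inferInstance, g, _, refines_self hg, by simp⟩
    | insert c t _ ih =>
      intro h
      obtain ⟨J, _, z, v, hr, hv⟩ := ih fun c hc => h c (Finset.mem_insert_of_mem hc)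
      obtain ⟨K, _, y, w, hr', hw⟩ := hG.exists_kill_relation z hr.1
        (fun j => ∑ i, (v j i : ℤ) * c i)
        ((hr.sum_smul c).trans (h c (Finset.mem_insert_self _ _)))
      have hcomp : ∀ (d : ι → ℤ) k, ∑ i, ((∑ j, w k j * v j i : ℕ) : ℤ) * d i =
          ∑ j, (w k j : ℤ) * ∑ i, (v j i : ℤ) * d i := by
        intro d k
        push_cast
        simp only [Finset.sum_mul, Finset.mul_sum]
        rw [Finset.sum_comm]
        simp only [mul_assoc]
      refine ⟨K, inferInstance, y, _, hr.trans hr', fun d hd k => ?_⟩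
      rw [hcomp]
      rcases Finset.mem_insert.1 hd with rfl | hd
      · exact hw k
      · simp [hv d hd]
  obtain ⟨J, _, z, v, hr, hv⟩ := key t fun c hc => (hS c).1 (ht ▸ Submodule.subset_span hc)
  refine ⟨{j // z j ≠ 0}, inferInstance, fun j => z j, fun j => v j,
    fun j => lt_of_le_of_ne (hr.1 j) (Ne.symm j.2), fun i => ?_, fun c hc j => ?_⟩
  · rw [hr.2 i]
    exact (sum_subtype_of_forall_eq_zero (fun j => z j ≠ 0) (fun j => v j i • z j)
      fun j hj => by rw [not_not.1 hj, smul_zero]).symm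
  · have : c ∈ Submodule.span ℤ (t : Set (ι → ℤ)) := by rw [ht]; exact (hS c).2 hc
    clear hc
    induction this using Submodule.span_induction with
    | mem x hx => exact hv x hx j
    | zero => simp
    | add x y _ _ hx hy => simp only [Pi.add_apply, mul_add, Finset.sum_add_distrib, hx, hy, add_zero]
    | smul a x _ hx =>
      simp only [Pi.smul_apply, smul_eq_mul, mul_left_comm _ a, ← Finset.mul_sum, hx, mul_zero]

end SimpleRieszGroup

lemma exists_le_sum_eq {E : Type*} (s : Finset E) (B : E → ℕ) (n : ℕ)
    (hn : n ≤ ∑ i ∈ s, B i) : ∃ b : E → ℕ, (∀ i, b i ≤ B i) ∧ ∑ i ∈ s, b i = n := by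
  classical
  induction s using Finset.induction_on generalizing n with
  | empty => exact ⟨fun _ => 0, fun _ => Nat.zero_le _, by simp at hn ⊢; omega⟩
  | insert a s ha ih =>
    rw [Finset.sum_insert ha] at hn
    obtain ⟨b, hb, hs⟩ := ih (n - min n (B a)) (by omega)
    refine ⟨Function.update b a (min n (B a)), fun i => ?_, ?_⟩
    · by_cases h : i = a
      · subst h; simp
      · simpa [h] using hb i
    · rw [Finset.sum_insert ha, Function.update_self,
        Finset.sum_congr rfl fun i hi => Function.update_of_ne (ne_of_mem_of_not_mem hi ha) _ b, hs]
      omega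

/-- A vector of weight `r * c` is a sum of `c` vectors of weight `r`, provided that `r` is a large
multiple of a common multiple `D` of the weights. -/
lemma exists_split_of_dvd {E : Type*} [Fintype E] (τ : E → ℕ) (hτ : ∀ i, 0 < τ i) (D : ℕ)
    (hD : ∀ i, τ i ∣ D) (hD0 : 0 < D) (r : ℕ) (hr : D ∣ r) (hrE : Fintype.card E * D ≤ r)
    (c : ℕ) (N : E → ℕ) (hN : ∑ i, τ i * N i = r * c) :
    ∃ K : Fin c → E → ℕ, (∀ l, ∑ i, τ i * K l i = r) ∧ ∀ i, N i = ∑ l, K l i := by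
  induction c generalizing N with
  | zero =>
    refine ⟨fun _ _ => 0, fun l => l.elim0, fun i => ?_⟩
    have := (Finset.sum_eq_zero_iff.1 (hN.trans (mul_zero r))) i (Finset.mem_univ i)
    simpa [(hτ i).ne'] using this
  | succ c ih =>
    rcases Nat.eq_zero_or_pos c with rfl | hc
    · exact ⟨fun _ => N, fun _ => by simpa using hN, fun i => by simp⟩
    obtain ⟨r', rfl⟩ := hr
    obtain ⟨b, hb, hbs⟩ := exists_le_sum_eq Finset.univ (fun i => N i * τ i / D) r' (by
      have h1 : ∑ i, N i * τ i ≤ ∑ i, (N i * τ i / D + 1) * D :=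
        Finset.sum_le_sum fun i _ => by
          have := Nat.div_add_mod (N i * τ i) D
          have := Nat.mod_lt (N i * τ i) hD0
          nlinarith
      rw [← Finset.sum_mul, Finset.sum_add_distrib] at h1
      simp only [mul_comm (N _)] at h1 ⊢
      rw [hN] at h1
      simp only [Finset.sum_const, Finset.card_univ, smul_eq_mul, mul_one] at h1
      have h2 : r' * (c + 1) ≤ ∑ i, τ i * N i / D + Fintype.card E :=
        Nat.le_of_mul_le_mul_right (by linarith) hD0
      have h3 : Fintype.card E ≤ r' := Nat.le_of_mul_le_mul_right (by linarith) hD0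
      nlinarith)
    have hK : ∀ i, b i * (D / τ i) ≤ N i := fun i => by
      have h1 : b i * D ≤ N i * τ i := (Nat.mul_le_mul_right D (hb i)).trans (Nat.div_mul_le_self _ _)
      have h2 := Nat.div_mul_cancel (hD i)
      refine Nat.le_of_mul_le_mul_right ?_ (hτ i)
      rwa [mul_assoc, h2]
    have hKs : ∑ i, τ i * (b i * (D / τ i)) = D * r' := by
      rw [← hbs, Finset.mul_sum]
      refine Finset.sum_congr rfl fun i _ => ?_
      rw [mul_left_comm, Nat.mul_div_cancel' (hD i), mul_comm]
    obtain ⟨K, hK1, hK2⟩ := ih (fun i => N i - b i * (D / τ i)) (by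
      simp only [Nat.mul_sub]
      rw [Finset.sum_tsub_distrib _ fun i _ => Nat.mul_le_mul_left _ (hK i), hN, hKs]
      rw [Nat.mul_succ, Nat.add_sub_cancel])
    refine ⟨Fin.cons (fun i => b i * (D / τ i)) K, fun l => ?_, fun i => ?_⟩
    · refine Fin.cases ?_ (fun l => ?_) l
      · simpa using hKs
      · simpa using hK1 l
    · rw [Fin.sum_univ_succ]
      simp only [Fin.cons_zero, Fin.cons_succ, ← hK2 i]
      exact (Nat.add_sub_cancel' (hK i)).symm

lemma exists_split {E : Type*} [Fintype E] (τ : E → ℕ) (hτ : ∀ i, 0 < τ i) :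
    ∃ m R : ℕ, ∀ r : ℕ, R ≤ r → (∃ s : E → ℤ, (r : ℤ) = ∑ i, τ i * s i) →
      ∀ (c : ℕ) (N : E → ℕ), (∀ i, m * c ≤ N i) → ∑ i, τ i * N i = r * c →
      ∃ K : Fin c → E → ℕ, (∀ l, ∑ i, τ i * K l i = r) ∧ (∀ l i, 0 < K l i) ∧
        ∀ i, N i = ∑ l, K l i := by
  classical
  set D : ℕ := ∏ i, τ i with hDdef
  have hD0 : 0 < D := Finset.prod_pos fun i _ => hτ i
  have hD : ∀ i, τ i ∣ D := fun i => Finset.dvd_prod_of_mem τ (Finset.mem_univ i)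
  refine ⟨2 * D, ∑ i, τ i * (2 * D) + Fintype.card E * D, fun r hr ⟨s, hs⟩ c N hN hNs => ?_⟩
  have hDz : (0 : ℤ) < D := by exact_mod_cast hD0
  let S : E → ℕ := fun i => (s i % D).toNat + D
  have hSz : ∀ i, (S i : ℤ) = s i % D + D := fun i => by
    simp [S, Int.toNat_of_nonneg (Int.emod_nonneg (s i) hDz.ne')]
  have hS2 : ∀ i, S i ≤ 2 * D := fun i => by
    have := Int.emod_lt_of_pos (s i) hDz
    have := hSz i
    omega
  have hSpos : ∀ i, 0 < S i := fun i => Nat.add_pos_right _ hD0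
  have hSle : ∑ i, τ i * S i ≤ ∑ i, τ i * (2 * D) :=
    Finset.sum_le_sum fun i _ => Nat.mul_le_mul_left _ (hS2 i)
  have hdvd : D ∣ r - ∑ i, τ i * S i := by
    rw [← Int.natCast_dvd_natCast, Nat.cast_sub (by omega), hs]
    push_cast
    rw [← Finset.sum_sub_distrib]
    refine Finset.dvd_sum fun i _ => ?_
    rw [← mul_sub, hSz]
    refine Dvd.dvd.mul_left ⟨s i / D - 1, ?_⟩ _
    have := Int.emod_add_mul_ediv (s i) D
    linarith
  have hcS : ∀ i, c * S i ≤ N i := fun i =>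
    le_trans (by rw [mul_comm]; exact Nat.mul_le_mul_right c (hS2 i)) (hN i)
  obtain ⟨K, hK1, hK2⟩ := exists_split_of_dvd τ hτ D hD hD0 (r - ∑ i, τ i * S i) hdvd (by omega) c
    (fun i => N i - c * S i) (by
      simp only [Nat.mul_sub]
      rw [Finset.sum_tsub_distrib _ fun i _ => Nat.mul_le_mul_left _ (hcS i), hNs, Nat.sub_mul,
        Finset.sum_mul]
      congr 1
      exact Finset.sum_congr rfl fun i _ => by ring)
  refine ⟨fun l i => S i + K l i, fun l => ?_, fun l i => Nat.add_pos_left (hSpos i) _, fun i => ?_⟩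
  · simp only [mul_add, Finset.sum_add_distrib, hK1]
    omega
  · rw [Finset.sum_add_distrib, ← hK2 i]
    have := hcS i
    simp only [Finset.sum_const, Finset.card_univ, Fintype.card_fin, smul_eq_mul]
    omega

namespace SimpleRieszGroup

variable {G : Type*} [AddCommGroup G] [PartialOrder G] [IsOrderedAddMonoid G]

/-- Positive elements `z i` with `∑ τ i • z i = r • w` are simultaneously decomposed along
vectors `κ` of total weight exactly `r`, using polynomially many (in `r`) vectors. -/
lemma exists_weight_decomposition (hG : SimpleRieszGroup G) {E : Type} [Fintype E] (z : E → G)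
    (τ : E → ℕ) (hτ : ∀ i, 0 < τ i) :
    ∃ m R : ℕ, ∀ (r : ℕ) (w : G), R ≤ r → (∃ s : E → ℤ, (r : ℤ) = ∑ i, τ i * s i) → 0 ≤ w →
      (∀ i, m • w ≤ z i) → ∑ i, τ i • z i = r • w →
      ∃ (Y : Type) (_ : Fintype Y) (y : Y → G) (κ : Y → E → ℕ), (∀ l, 0 < y l) ∧
        (∀ l i, 0 < κ l i) ∧ (∀ l, ∑ i, τ i * κ l i = r) ∧ (∀ i, z i = ∑ l, κ l i • y l) ∧
        Fintype.card Y ≤ (r + 1) ^ Fintype.card E := by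
  classical
  obtain ⟨m, R, hmR⟩ := exists_split τ hτ
  refine ⟨m, R, fun r w hr hs hw hmw hz => ?_⟩
  obtain ⟨J, _, h, v, hh, hv, hker⟩ := hG.exists_refinement
    (fun o : Option E => o.elim w fun i => z i - m • w)
    (by rintro (_ | i); exacts [hw, sub_nonneg.2 (hmw i)])
  have hrel : ∀ j, ∑ i, τ i * (v j (some i) + m * v j none) = r * v j none := by
    intro j
    have := hker (fun o => o.elim (m * ∑ i, (τ i : ℤ) - r) fun i => τ i) (by
      rw [Fintype.sum_option]
      simp only [Option.elim, natCast_zsmul, sub_smul, smul_sub, Finset.sum_sub_distrib, hz]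
      rw [mul_smul, Finset.sum_smul, Finset.smul_sum]
      simp only [natCast_zsmul, smul_comm m]
      abel) j
    rw [Fintype.sum_option] at this
    simp only [Option.elim] at this
    zify
    simp only [mul_add, Finset.sum_add_distrib, ← mul_assoc, ← Finset.sum_mul]
    have h2 : ∑ i, (τ i : ℤ) * v j (some i) = ∑ i, (v j (some i) : ℤ) * τ i :=
      Finset.sum_congr rfl fun i _ => mul_comm _ _
    rw [h2]
    linear_combination this
  choose K hK1 hK2 hK3 using fun j => hmR r hr hs (v j none) (fun i => v j (some i) + m * v j none)
    (fun i => Nat.le_add_left _ _) (hrel j)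
  have hKr : ∀ j l i, K j l i < r + 1 := fun j l i => by
    rw [Nat.lt_succ_iff, ← hK1 j l]
    exact (Nat.le_mul_of_pos_left _ (hτ i)).trans
      (Finset.single_le_sum (f := fun i => τ i * K j l i) (fun _ _ => Nat.zero_le _)
        (Finset.mem_univ i))
  let κ' : (Σ j, Fin (v j none)) → E → Fin (r + 1) := fun p i => ⟨K p.1 p.2 i, hKr _ _ _⟩
  let Y := {k : E → Fin (r + 1) // ∃ p, κ' p = k}
  refine ⟨Y, inferInstance, fun k => ∑ p with κ' p = k, h p.1, fun k i => (k.1 i : ℕ), ?_, ?_, ?_,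
    fun i => ?_, ?_⟩
  · rintro ⟨k, p, hp⟩
    exact Finset.sum_pos (fun p _ => hh p.1) ⟨p, by simpa using hp⟩
  · rintro ⟨k, p, rfl⟩ i
    exact hK2 _ _ _
  · rintro ⟨k, p, rfl⟩
    exact hK1 _ _
  · have h1 : z i = ∑ j, (v j (some i) + m * v j none) • h j := by
      have ha := hv (some i)
      have hb := hv none
      simp only [Option.elim] at ha hb
      simp only [add_smul, Finset.sum_add_distrib, ← ha, mul_smul, ← Finset.smul_sum, ← hb]
      abel
    have h2 : z i = ∑ p : (Σ j, Fin (v j none)), K p.1 p.2 i • h p.1 := by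
      rw [h1, Fintype.sum_sigma]
      refine Finset.sum_congr rfl fun j _ => ?_
      rw [hK3 j i, Finset.sum_smul]
    rw [h2, sum_subtype_of_forall_eq_zero (fun k => ∃ p, κ' p = k)
      (fun k => (k i : ℕ) • ∑ p with κ' p = k, h p.1)
      (fun k hk => by rw [Finset.filter_false_of_mem (fun p _ hp => hk ⟨p, hp⟩)]; simp),
      ← Finset.sum_fiberwise (s := Finset.univ) (g := κ')]
    refine Finset.sum_congr rfl fun k _ => ?_
    rw [Finset.smul_sum]
    refine Finset.sum_congr rfl fun p hp => ?_
    rw [← (Finset.mem_filter.1 hp).2]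
  · exact (Fintype.card_subtype_le _).trans (by simp)

/-- Approximate divisibility of positive elements. -/
lemma exists_approx_div (hG : SimpleRieszGroup G)
    (hsmall : ∀ a : G, 0 < a → ∀ m : ℕ, ∃ w, 0 < w ∧ m • w ≤ a) (y : G) (hy : 0 < y)
    (k K : ℕ) (hK : 2 * K ≤ k + 1) :
    ∃ x, 0 < x ∧ (k + 2) • x ≤ y ∧ K • (y - k • x) ≤ y := by
  classical
  set m := K * (k + 1) * (k + 2) + (k + 2) with hm
  obtain ⟨w, hw, hmw⟩ := hsmall y hy m
  obtain ⟨L, hL⟩ := hG.simple w hw y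
  obtain ⟨J, _, h, v, hh, hv, hker⟩ := hG.exists_refinement ![y - m • w, w, L • w - y]
    (by intro i; fin_cases i; exacts [sub_nonneg.2 hmw, hw.le, sub_nonneg.2 hL])
  let N : J → ℕ := fun j => v j 0 + m * v j 1
  have hyN : y = ∑ j, N j • h j := by
    have h0 := hv 0
    have h1 := hv 1
    simp only [Matrix.cons_val_zero, Matrix.cons_val_one] at h0 h1
    simp only [N, add_smul, Finset.sum_add_distrib, mul_smul, ← Finset.smul_sum, ← h0, ← h1]
    abel
  have hN : ∀ j, N j = 0 ∨ m ≤ N j := by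
    intro j
    have := hker ![1, m - L, 1] (by
      simp only [Fin.sum_univ_three, Matrix.cons_val_zero, Matrix.cons_val_one, Matrix.cons_val_two,
        Matrix.tail_cons, Matrix.head_cons, sub_smul, natCast_zsmul, one_smul]
      abel) j
    simp only [Fin.sum_univ_three, Matrix.cons_val_zero, Matrix.cons_val_one, Matrix.cons_val_two,
        Matrix.tail_cons, Matrix.head_cons] at this
    rcases Nat.eq_zero_or_pos (v j 1) with h0 | h0
    · left
      simp only [h0, Nat.cast_zero, zero_mul] at this
      simp only [N, h0]
      omega
    · right
      exact (Nat.le_mul_of_pos_right m h0).trans (Nat.le_add_left _ _)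
  let f : J → ℕ := fun j => N j / (k + 2)
  have hf1 : ∀ j, (k + 2) * f j ≤ N j := fun j => Nat.mul_div_le _ _
  have hf2 : ∀ j, K * (N j - k * f j) ≤ N j := by
    intro j
    rcases hN j with h0 | h0
    · simp [h0]
    · have h1 := Nat.div_add_mod (N j) (k + 2)
      have h2 := Nat.mod_lt (N j) (show 0 < k + 2 by omega)
      have h3 : K * (k + 1) ≤ f j := by
        refine (Nat.le_div_iff_mul_le (by omega)).2 ?_
        omega
      have h4 : N j - k * f j ≤ 2 * f j + (k + 1) := by
        have h5 : (k + 2) * f j + N j % (k + 2) = N j := h1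
        clear h1
        have : (k + 2) * f j = k * f j + 2 * f j := by ring
        omega
      calc K * (N j - k * f j) ≤ K * (2 * f j + (k + 1)) := Nat.mul_le_mul_left _ h4
        _ = 2 * K * f j + K * (k + 1) := by ring
        _ ≤ (k + 1) * f j + f j := by gcongr
        _ = (k + 2) * f j := by ring
        _ ≤ N j := hf1 j
  refine ⟨∑ j, f j • h j, ?_, ?_, ?_⟩
  · obtain ⟨j, hj⟩ : ∃ j, N j ≠ 0 := by
      by_contra hcon
      push Not at hcon
      rw [hyN] at hy
      simp [hcon] at hy
    refine Finset.sum_pos' (fun j _ => nsmul_nonneg (hh j).le _) ⟨j, Finset.mem_univ _, ?_⟩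
    refine nsmul_pos (hh j) (Nat.div_pos ?_ (by omega)).ne'
    rcases hN j with h0 | h0
    · exact absurd h0 hj
    · omega
  · rw [hyN, Finset.smul_sum]
    refine Finset.sum_le_sum fun j _ => ?_
    rw [smul_smul]
    exact nsmul_le_nsmul_left (hh j).le (hf1 j)
  · have : y - k • ∑ j, f j • h j = ∑ j, (N j - k * f j) • h j := by
      rw [hyN, Finset.smul_sum, ← Finset.sum_sub_distrib]
      refine Finset.sum_congr rfl fun j _ => ?_
      rw [smul_smul, sub_nsmul _ (le_trans (Nat.mul_le_mul_right _ (by omega)) (hf1 j)),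
        ← sub_eq_add_neg]
    rw [this, Finset.smul_sum]
    conv_rhs => rw [hyN]
    refine Finset.sum_le_sum fun j _ => ?_
    rw [smul_smul]
    exact nsmul_le_nsmul_left (hh j).le (hf2 j)

end SimpleRieszGroup

/-- Words of length `r` with prescribed letter counts `M`, starting with the marker `s`, ending
with `e`, in which `s` occurs only in the initial run. -/
structure IsMarkedWord {A : Type*} [Fintype A] (s e : A) (M : A → ℕ) (r : ℕ) (w : ℕ → A) :
    Prop where
  first : w 0 = s
  last : w (r - 1) = e
  run : ∀ i, i + 1 < r → w (i + 1) = s → w i = s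
  count : ∀ c : A → ℤ, ∑ i ∈ Finset.range r, c (w i) = ∑ a, (M a : ℤ) * c a
  tail : ∀ i, r ≤ i → w i = e

lemma sum_sigma_fin_sub_ite {A : Type*} [Fintype A] [DecidableEq A] (S : Finset A) (e : A)
    (he : e ∈ S) (M : A → ℕ) (hM : 1 ≤ M e) (c : A → ℤ) :
    ∑ p : (Σ a : S, Fin (M a - if a.1 = e then 1 else 0)), c p.1 =
      ∑ a ∈ S, (M a : ℤ) * c a - c e := by
  rw [Fintype.sum_sigma, Finset.sum_coe_sort S
    (fun a => ∑ _y : Fin (M a - if a = e then 1 else 0), c a)]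
  rw [← Finset.add_sum_erase _ _ he, ← Finset.add_sum_erase S (fun a => (M a : ℤ) * c a) he]
  have h : ∑ a ∈ S.erase e, ∑ _y : Fin (M a - if a = e then 1 else 0), c a =
      ∑ a ∈ S.erase e, (M a : ℤ) * c a :=
    Finset.sum_congr rfl fun a ha => by simp [Finset.ne_of_mem_erase ha]
  rw [h]
  simp only [if_true, Finset.sum_const, Finset.card_univ, Fintype.card_fin, nsmul_eq_mul,
    Nat.cast_sub hM]
  ring

/-- There are at least `(k !) ^ ∑ m` marked words, obtained by permuting the free letters `f`. -/
lemma exists_marked_words {A Y : Type*} [Fintype A] [Fintype Y] {k : ℕ}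
    (f : Y → Fin k → A) (hf : ∀ y i y' i', f y i = f y' i' → y = y' ∧ i = i') (s e : A)
    (hse : s ≠ e) (hs : ∀ y i, f y i ≠ s) (he : ∀ y i, f y i ≠ e) (M : A → ℕ) (hM : ∀ a, 1 ≤ M a)
    (m : Y → ℕ) (hm : ∀ y i, M (f y i) = m y) (r : ℕ) (hr : ∑ a, M a = r) :
    ∃ S : Finset (ℕ → A), S.card = (Nat.factorial k) ^ ∑ y, m y ∧
      ∀ w ∈ S, IsMarkedWord s e M r w := by
  classical
  let free : Finset A := Finset.univ.image fun p : Y × Fin k => f p.1 p.2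
  let rest : Finset A := (Finset.univ \ free).erase s
  have hfree : ∀ c : A → ℤ, ∑ a ∈ free, c a = ∑ y, ∑ i, c (f y i) := fun c => by
    rw [Finset.sum_image, Fintype.sum_prod_type]
    rintro ⟨y, i⟩ - ⟨y', i'⟩ - h
    obtain ⟨rfl, rfl⟩ := hf _ _ _ _ h
    rfl
  have hse' : s ∈ Finset.univ \ free := by
    simp [free, hs]
  have hee : e ∈ rest := by
    simp [rest, free, he, hse.symm]
  have hsum : ∀ c : A → ℤ, ∑ a, c a = c s + (∑ y, ∑ i, c (f y i) + ∑ a ∈ rest, c a) := fun c => by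
    rw [← hfree, ← Finset.sum_sdiff (Finset.subset_univ free), ← Finset.add_sum_erase _ _ hse']
    ring
  let B := Σ y : Y, Fin (m y)
  let R := Σ a : rest, Fin (M a - if a.1 = e then 1 else 0)
  let mid := (B × Fin k) ⊕ R
  let letter : (B → Equiv.Perm (Fin k)) → mid → A := fun π =>
    Sum.elim (fun p => f p.1.1 (π p.1 p.2)) (fun p => p.1)
  have hmid : ∀ π (c : A → ℤ), ∑ p, c (letter π p) =
      ∑ y, ∑ i, (M (f y i) : ℤ) * c (f y i) + (∑ a ∈ rest, (M a : ℤ) * c a - c e) := by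
    intro π c
    rw [← sum_sigma_fin_sub_ite rest e hee M (hM e) c, Fintype.sum_sum_type]
    congr 1
    rw [Fintype.sum_prod_type, Fintype.sum_sigma]
    refine Finset.sum_congr rfl fun y _ => ?_
    have : ∀ l : Fin (m y), ∑ i, c (letter π (Sum.inl (⟨y, l⟩, i))) = ∑ i, c (f y i) := fun l =>
      Equiv.sum_comp (π ⟨y, l⟩) fun i => c (f y i)
    simp only [this, hm, Finset.sum_const, Finset.card_univ, Fintype.card_fin, nsmul_eq_mul,
      Finset.mul_sum]
  let N := Fintype.card mid
  have hN : M s + N + 1 = r := by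
    have h1 := hmid (fun _ => 1) (fun _ => 1)
    have h2 := hsum fun a => (M a : ℤ)
    simp only [Finset.sum_const, Finset.card_univ, nsmul_eq_mul, mul_one] at h1
    have h3 : ((∑ a, M a : ℕ) : ℤ) = r := by rw [hr]
    push_cast at h3
    zify
    change (M s : ℤ) + (Fintype.card mid : ℤ) + 1 = r
    linarith
  let ε : mid ≃ Fin N := Fintype.equivFin mid
  let W : (B → Equiv.Perm (Fin k)) → ℕ → A := fun π i =>
    if i < M s then s else if h : i - M s < N then letter π (ε.symm ⟨i - M s, h⟩) else e
  have hletter : ∀ π p, letter π p ≠ s := by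
    rintro π (p | p)
    · exact hs _ _
    · exact Finset.ne_of_mem_erase p.1.2
  have hMs := hM s
  have hW1 : ∀ π (i : Fin N), W π (M s + i) = letter π (ε.symm i) := fun π i => by
    simp [W]
  have hinj : Function.Injective W := by
    intro π π' h
    funext b
    ext i
    have := congrFun h (M s + ε (Sum.inl (b, i)))
    rw [hW1, hW1, Equiv.symm_apply_apply] at this
    exact congrArg _ (hf _ _ _ _ this).2
  refine ⟨Finset.univ.map ⟨W, hinj⟩, ?_, ?_⟩
  · simp [B, Fintype.card_pi, Fintype.card_perm]
  · simp only [Finset.mem_map, Finset.mem_univ, true_and, Function.Embedding.coeFn_mk,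
      forall_exists_index]
    rintro _ π rfl
    refine ⟨?_, ?_, ?_, ?_, ?_⟩
    · simp only [W]
      rw [if_pos (by omega)]
    · simp only [W]
      rw [if_neg (by omega), dif_neg (by omega)]
    · intro i hi h
      simp only [W] at h ⊢
      by_cases h1 : i + 1 < M s
      · rw [if_pos (by omega)]
      · rw [if_neg h1] at h
        split_ifs at h with h2
        · exact absurd h (hletter _ _)
        · exact absurd h.symm hse
    · intro c
      rw [← hN, Finset.sum_range_succ, Finset.sum_range_add, ← Fin.sum_univ_eq_sum_range
        (fun i => c (W π (M s + i)))]
      simp only [hW1]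
      rw [Equiv.sum_comp ε.symm (fun p => c (letter π p)), hmid, hsum]
      have h1 : ∑ i ∈ Finset.range (M s), c (W π i) = M s * c s := by
        rw [Finset.sum_congr rfl (g := fun _ => c s)]
        · simp
        · intro i hi
          simp only [W]
          rw [if_pos (Finset.mem_range.1 hi)]
      have h2 : W π (M s + N) = e := by simp [W]
      rw [h1, h2]
      ring
    · intro i hi
      simp only [W]
      rw [if_neg (by omega), dif_neg (by omega)]

/-- A family of finite sets, each at least as large as the index type, has an injective choice. -/
lemma exists_injective_choice {ι α : Type*} [Fintype ι] [DecidableEq α] (S : ι → Finset α)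
    (hS : ∀ i, Fintype.card ι ≤ (S i).card) :
    ∃ w : ι → α, Function.Injective w ∧ ∀ i, w i ∈ S i := by
  refine (Finset.all_card_le_biUnion_card_iff_exists_injective S).1 fun s => ?_
  rcases s.eq_empty_or_nonempty with rfl | ⟨i, hi⟩
  · simp
  · exact (Finset.card_le_univ s).trans
      ((hS i).trans (Finset.card_le_card (Finset.subset_biUnion_of_mem S hi)))

/-- The number of free letters of each type at height `q`. -/
noncomputable def freeCount (t : ℝ) (q : ℕ) : ℕ := ⌈Real.exp (t * q + 3)⌉₊

/-- The bound on the inverse proportion of nonfree letters at height `q`. -/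
noncomputable def sparsity (t : ℝ) (q : ℕ) : ℕ := ⌈t * q + 2⌉₊

lemma exp_le_freeCount (t : ℝ) (q : ℕ) : Real.exp (t * q + 3) ≤ freeCount t q := Nat.le_ceil _

lemma freeCount_add_two_le {t : ℝ} (ht : 0 ≤ t) (q : ℕ) :
    (freeCount t q : ℝ) + 2 ≤ Real.exp 4 * Real.exp (t * q) := by
  have h1 : (freeCount t q : ℝ) < Real.exp (t * q + 3) + 1 := Nat.ceil_lt_add_one (Real.exp_pos _).le
  have h2 : 1 ≤ Real.exp (t * q) := Real.one_le_exp (by positivity)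
  have h3 : (4 : ℝ) ≤ Real.exp 3 := by linarith [Real.add_one_le_exp (3 : ℝ)]
  have h4 : (2 : ℝ) ≤ Real.exp 1 := by linarith [Real.add_one_le_exp (1 : ℝ)]
  have h5 : Real.exp 4 = Real.exp 3 * Real.exp 1 := by rw [← Real.exp_add]; norm_num
  rw [Real.exp_add] at h1
  rw [h5]
  nlinarith [mul_le_mul h2 h3 (by norm_num) (by linarith)]

lemma two_mul_sparsity_le {t : ℝ} (ht : 0 ≤ t) (q : ℕ) :
    2 * sparsity t q ≤ freeCount t q + 1 := by
  have h0 : 0 ≤ t * q := by positivity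
  have h1 : (sparsity t q : ℝ) < t * q + 2 + 1 := Nat.ceil_lt_add_one (by linarith)
  have h2 := exp_le_freeCount t q
  have h3 : (4 : ℝ) ≤ Real.exp 2 * Real.exp 1 := by
    nlinarith [Real.add_one_le_exp (2 : ℝ), Real.add_one_le_exp (1 : ℝ)]
  have h4 : Real.exp (t * q + 3) = Real.exp (t * q) * (Real.exp 2 * Real.exp 1) := by
    rw [← Real.exp_add, ← Real.exp_add]; norm_num
  have h5 := Real.add_one_le_exp (t * q)
  have h6 : (6 : ℝ) ≤ Real.exp 2 * Real.exp 1 := by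
    nlinarith [Real.add_one_le_exp (2 : ℝ), Real.add_one_le_exp (1 : ℝ)]
  have : (2 * sparsity t q : ℝ) ≤ freeCount t q + 1 := by nlinarith
  exact_mod_cast this

lemma exp_le_factorial_pow {t : ℝ} (ht : 0 ≤ t) (q r m n : ℕ) (hr : freeCount t q * m + n = r)
    (hn : sparsity t q * n ≤ r) :
    Real.exp (r * (t * q + 1)) ≤ (Nat.factorial (freeCount t q) : ℝ) ^ m := by
  set k := freeCount t q with hk
  have h0 : 0 ≤ t * q := by positivity
  have h1 : Real.exp (t * q + 2) ^ k ≤ Nat.factorial k := by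
    have h2 := Real.pow_div_factorial_le_exp (k : ℝ) (Nat.cast_nonneg k) k
    have h3 := exp_le_freeCount t q
    have h4 : (0 : ℝ) < Nat.factorial k := by exact_mod_cast Nat.factorial_pos k
    rw [div_le_iff₀ h4] at h2
    have h5 : Real.exp (t * q + 2) ^ k * Real.exp k ≤ (k : ℝ) ^ k := by
      have : Real.exp k = Real.exp 1 ^ k := by rw [← Real.exp_nat_mul]; simp
      rw [this, ← mul_pow, ← Real.exp_add]
      refine pow_le_pow_left₀ (Real.exp_pos _).le (le_trans (le_of_eq ?_) h3) k
      congr 1; ring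
    have h6 := h5.trans h2
    rw [mul_comm (Real.exp k)] at h6
    exact le_of_mul_le_mul_right h6 (Real.exp_pos _)
  refine le_trans ?_ (pow_le_pow_left₀ (by positivity) h1 m)
  rw [← pow_mul, ← Real.exp_nat_mul]
  refine Real.exp_le_exp.2 ?_
  have h7 : t * q + 2 ≤ sparsity t q := Nat.le_ceil _
  have h8 : (sparsity t q : ℝ) * n ≤ r := by exact_mod_cast hn
  have h9 : ((k : ℝ) * m + n) = r := by exact_mod_cast hr
  have h10 : (t * q + 2) * n ≤ r := le_trans (by gcongr) h8
  push_cast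
  nlinarith

lemma exists_pow_mul_le_exp (d : ℕ) (C : ℝ) (n : ℕ) :
    ∃ R : ℕ, ∀ r : ℕ, R ≤ r → ((r : ℝ) + 1) ^ d * C ≤ Real.exp (r / (n + 1)) := by
  have h1 := (Real.tendsto_pow_mul_exp_neg_atTop_nhds_zero d).const_mul
    (C * ((n : ℝ) + 1) ^ d * Real.exp (1 / ((n : ℝ) + 1)))
  rw [mul_zero] at h1
  have h2 : Filter.Tendsto (fun r : ℕ => ((r : ℝ) + 1) / (n + 1)) Filter.atTop Filter.atTop :=
    (Filter.tendsto_atTop_add_const_right _ _ tendsto_natCast_atTop_atTop).atTop_div_const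
      (by positivity)
  obtain ⟨R, hR⟩ := Filter.eventually_atTop.1
    ((h1.comp h2).eventually (gt_mem_nhds (zero_lt_one)))
  refine ⟨R, fun r hr => ?_⟩
  have h3 := (hR r hr).le
  simp only [Function.comp] at h3
  have hn : (0 : ℝ) < n + 1 := by positivity
  rw [div_pow, Real.exp_neg, add_div, Real.exp_add] at h3
  have e1 := Real.exp_pos ((r : ℝ) / (n + 1))
  have e2 := Real.exp_pos (1 / ((n : ℝ) + 1))
  field_simp at h3
  rw [mul_comm]
  simpa using h3

lemma exists_bezout_divisor {E : Type*} [Fintype E] (τ : E → ℕ) :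
    ∃ δ : ℕ, (∀ i, δ ∣ τ i) ∧ ∀ r : ℕ, δ ∣ r → ∃ s : E → ℤ, (r : ℤ) = ∑ i, τ i * s i := by
  obtain ⟨d, hd⟩ := (IsPrincipalIdealRing.principal (Ideal.span (Set.range fun i => (τ i : ℤ))))
  refine ⟨d.natAbs, fun i => ?_, fun r hr => ?_⟩
  · have h : (τ i : ℤ) ∈ Ideal.span {d} := by
      rw [Ideal.span, ← hd]; exact Ideal.subset_span ⟨i, rfl⟩
    rw [← Int.natCast_dvd_natCast, Int.natAbs_dvd]
    exact Ideal.mem_span_singleton.1 h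
  · have h : (r : ℤ) ∈ Ideal.span (Set.range fun i => (τ i : ℤ)) := by
      rw [hd]
      exact Ideal.mem_span_singleton.2 (Int.natAbs_dvd.1 (Int.natCast_dvd_natCast.2 hr))
    obtain ⟨c, hc⟩ := Ideal.mem_span_range_iff_exists_fun.1 h
    exact ⟨c, by rw [← hc]; exact Finset.sum_congr rfl fun i _ => mul_comm _ _⟩

lemma exists_lcm_nsmul {G : Type*} [AddCommGroup G] {u : G} {a b : ℕ} (ha : ∃ g, a • g = u)
    (hb : ∃ g, b • g = u) : ∃ g : G, Nat.lcm a b • g = u := by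
  rcases Nat.eq_zero_or_pos (Nat.gcd a b) with h0 | h0
  · rw [Nat.gcd_eq_zero_iff] at h0
    rcases h0 with ⟨rfl, rfl⟩
    simpa using ha
  obtain ⟨x, hx⟩ := ha
  obtain ⟨y, hy⟩ := hb
  obtain ⟨a', b', hd, ha', hb'⟩ := Nat.exists_coprime a b
  set d := Nat.gcd a b
  have hl : Nat.lcm a b = a' * b' * d := by
    have := Nat.gcd_mul_lcm a b
    have h2 : d * Nat.lcm a b = d * (a' * b' * d) := by
      rw [this]; nth_rewrite 1 [ha', hb']; ring
    exact Nat.eq_of_mul_eq_mul_left h0 h2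
  obtain ⟨α, β, hαβ⟩ := Nat.isCoprime_iff_coprime.2 hd
  refine ⟨β • x + α • y, ?_⟩
  have e1 : (a' * b' * d) • (β • x) = (b' * β : ℤ) • u := by
    rw [← hx, ha']
    simp only [← natCast_zsmul, smul_smul]; push_cast; congr 1; ring
  have e2 : (a' * b' * d) • (α • y) = (a' * α : ℤ) • u := by
    rw [← hy, hb']
    simp only [← natCast_zsmul, smul_smul]; push_cast; congr 1; ring
  rw [hl, smul_add, e1, e2, ← add_smul]
  have : (b' * β + a' * α : ℤ) = 1 := by linarith
  rw [this, one_smul]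

namespace SimpleRieszGroup

variable {G : Type*} [AddCommGroup G] [PartialOrder G] [IsOrderedAddMonoid G]

lemma exists_nsmul_le (hG : SimpleRieszGroup G) {u : G} (hu : 0 < u) (a : G) (ha : 0 < a)
    (m : ℕ) : ∃ N : ℕ, ∀ (q : ℕ) (w : G), N ≤ q → q • w = u → m • w ≤ a := by
  obtain ⟨L, hL⟩ := hG.simple a ha u
  refine ⟨m * (L + 1) + 1, fun q w hq hw => ?_⟩
  have hw0 : 0 ≤ w := hG.unperforated q w (by omega) (by rw [hw]; exact hu.le)
  have h : (L + 1) • (m • w) ≤ (L + 1) • a := by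
    calc (L + 1) • (m • w) = (m * (L + 1)) • w := by rw [smul_smul, mul_comm]
      _ ≤ q • w := nsmul_le_nsmul_left hw0 (by omega)
      _ = u := hw
      _ ≤ L • a := hL
      _ ≤ (L + 1) • a := nsmul_le_nsmul_left ha.le (by omega)
  exact hG.le_of_nsmul_le (Nat.succ_pos L) h

lemma exists_small (hG : SimpleRieszGroup G) {u : G} (hu : 0 < u)
    (hQ : ∀ N : ℕ, ∃ q, N ≤ q ∧ ∃ g : G, q • g = u) (a : G) (ha : 0 < a) (m : ℕ) :
    ∃ w, 0 < w ∧ m • w ≤ a := by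
  obtain ⟨N, hN⟩ := hG.exists_nsmul_le hu a ha m
  obtain ⟨q, hq, w, hw⟩ := hQ (N + 1)
  have hw0 : 0 ≤ w := hG.unperforated q w (by omega) (by rw [hw]; exact hu.le)
  refine ⟨w, lt_of_le_of_ne hw0 fun h => ?_, hN q w (by omega) hw⟩
  rw [← h, smul_zero] at hw
  exact hu.ne hw

/-- A positive family with sum `w₀ = u / q` is written along a finer positive family with
sum `u / (q r)`, the incidence matrix being positive with constant row sums `r`, killing all
relations, and of subexponential size. -/
lemma exists_refined_family (hG : SimpleRieszGroup G) {u : G} (hu : 0 < u)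
    (hQ : ∀ N : ℕ, ∃ q, N ≤ q ∧ ∃ g : G, q • g = u) {A : Type} [Fintype A] (g : A → G)
    (hg : ∀ a, 0 < g a) (q : ℕ) (hq : 0 < q) (hgu : q • ∑ a, g a = u) (F : Finset A) (K : ℕ)
    (hF : K • ∑ a ∈ F, g a ≤ ∑ a, g a) (p : G) (hp : 0 ≤ p) (n : ℕ) (C : ℝ) :
    ∃ r, 2 ≤ r ∧ ∃ (Y : Type) (_ : Fintype Y) (y : Y → G) (M : Y → A → ℕ) (N : Y → ℕ),
      (∀ l, 0 < y l) ∧ (q * r) • ∑ l, y l = u ∧ (∀ l a, 1 ≤ M l a) ∧ (∀ l, ∑ a, M l a = r) ∧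
      (∀ l, K * ∑ a ∈ F, M l a ≤ r) ∧ (∀ a, g a = ∑ l, M l a • y l) ∧
      (∀ c : A → ℤ, ∑ a, c a • g a = 0 → ∀ l, ∑ a, (M l a : ℤ) * c a = 0) ∧
      p = ∑ l, N l • y l ∧ ((∃ w : G, (n + 1) • w = u) → n + 1 ∣ q * r) ∧
      (Fintype.card Y : ℝ) * C ≤ Real.exp (r / (n + 1)) := by
  classical
  set w₀ := ∑ a, g a with hw₀
  have hw₀pos : 0 < w₀ := by
    have h0 : 0 ≤ w₀ := Finset.sum_nonneg fun a _ => (hg a).le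
    refine lt_of_le_of_ne h0 fun h => ?_
    rw [← h, smul_zero] at hgu
    exact hu.ne hgu
  obtain ⟨L, hL⟩ := hG.simple w₀ hw₀pos p
  obtain ⟨J, _, z, v, hz, hv, hker⟩ := hG.exists_refinement
    (Sum.elim g ![p, L • w₀ - p, w₀ - K • ∑ a ∈ F, g a]) (by
      rintro (a | i)
      · exact (hg a).le
      · fin_cases i
        exacts [hp, sub_nonneg.2 hL, sub_nonneg.2 hF])
  have hvp : ∀ j, v j (Sum.inr 0) + v j (Sum.inr 1) = L * ∑ a, v j (Sum.inl a) := fun j => by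
    have := hker (Sum.elim (fun _ => -(L : ℤ)) ![1, 1, 0]) (by
      simp only [Fintype.sum_sum_type, Sum.elim_inl, Sum.elim_inr, Fin.sum_univ_three,
        Matrix.cons_val_zero, Matrix.cons_val_one, Matrix.cons_val_two, Matrix.tail_cons,
        Matrix.head_cons, one_smul, zero_smul, neg_smul, natCast_zsmul, Finset.sum_neg_distrib,
        ← Finset.smul_sum, ← hw₀]
      abel) j
    simp only [Fintype.sum_sum_type, Sum.elim_inl, Sum.elim_inr, Fin.sum_univ_three,
        Matrix.cons_val_zero, Matrix.cons_val_one, Matrix.cons_val_two, Matrix.tail_cons,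
        Matrix.head_cons, ← Finset.sum_mul] at this
    zify
    linarith
  have hvF : ∀ j, K * ∑ a ∈ F, v j (Sum.inl a) ≤ ∑ a, v j (Sum.inl a) := fun j => by
    have := hker (Sum.elim (fun a => -1 + K * if a ∈ F then 1 else 0) ![0, 0, 1]) (by
      simp only [Fintype.sum_sum_type, Sum.elim_inl, Sum.elim_inr, Fin.sum_univ_three,
        Matrix.cons_val_zero, Matrix.cons_val_one, Matrix.cons_val_two, Matrix.tail_cons,
        Matrix.head_cons, one_smul, zero_smul, neg_smul, add_smul, mul_smul,
        Finset.sum_add_distrib, Finset.sum_neg_distrib, ← Finset.smul_sum, ite_smul,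
        Finset.sum_ite_mem, Finset.univ_inter, ← hw₀, natCast_zsmul]
      abel) j
    simp only [Fintype.sum_sum_type, Sum.elim_inl, Sum.elim_inr, Fin.sum_univ_three,
        Matrix.cons_val_zero, Matrix.cons_val_one, Matrix.cons_val_two, Matrix.tail_cons,
        Matrix.head_cons, mul_add, Finset.sum_add_distrib, mul_ite, mul_one, mul_zero,
        Finset.sum_ite_mem, Finset.univ_inter, mul_neg, Finset.sum_neg_distrib,
        ← Finset.sum_mul] at this
    zify
    have h0 : (0 : ℤ) ≤ v j (Sum.inr 2) := Nat.cast_nonneg _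
    linarith
  have hvK : ∀ c : A → ℤ, ∑ a, c a • g a = 0 → ∀ j, ∑ a, (v j (Sum.inl a) : ℤ) * c a = 0 :=
    fun c hc j => by
      have := hker (Sum.elim c 0) (by simpa [Fintype.sum_sum_type] using hc) j
      simpa [Fintype.sum_sum_type] using this
  let E := {j : J // 0 < ∑ a, v j (Sum.inl a)}
  let τ : E → ℕ := fun j => ∑ a, v j.1 (Sum.inl a)
  have hzero : ∀ j, ¬ 0 < ∑ a, v j (Sum.inl a) → ∀ a, v j (Sum.inl a) = 0 := fun j hj a => by
    have := Finset.sum_eq_zero_iff.1 (Nat.eq_zero_of_not_pos hj) a (Finset.mem_univ a)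
    exact this
  have hgE : ∀ a, g a = ∑ j : E, v j.1 (Sum.inl a) • z j.1 := fun a => by
    rw [sum_subtype_of_forall_eq_zero (fun j => 0 < ∑ a, v j (Sum.inl a))
      (fun j => v j (Sum.inl a) • z j) fun j hj => by rw [hzero j hj, zero_smul]]
    exact hv (Sum.inl a)
  have hpE : p = ∑ j : E, v j.1 (Sum.inr 0) • z j.1 := by
    rw [sum_subtype_of_forall_eq_zero (fun j => 0 < ∑ a, v j (Sum.inl a))
      (fun j => v j (Sum.inr 0) • z j) fun j hj => by
        have := hvp j
        rw [Nat.eq_zero_of_not_pos hj, mul_zero] at this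
        rw [show v j (Sum.inr 0) = 0 by omega, zero_smul]]
    exact hv (Sum.inr 0)
  have hwE : ∑ j : E, τ j • z j.1 = w₀ := by
    rw [hw₀, Finset.sum_congr rfl fun a _ => hgE a, Finset.sum_comm]
    exact Finset.sum_congr rfl fun j _ => Finset.sum_smul
  obtain ⟨m, R₁, hdec⟩ := hG.exists_weight_decomposition (fun j : E => z j.1) τ fun j => j.2
  obtain ⟨δ, hδ, hbez⟩ := exists_bezout_divisor τ
  obtain ⟨R₂, hR₂⟩ := exists_pow_mul_le_exp (Fintype.card E) (max C 0) n
  choose R₃ hR₃ using fun j : E => hG.exists_nsmul_le hu (z j.1) (hz j.1) m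
  have hδu : ∃ w : G, (q * δ) • w = u := by
    refine ⟨∑ j : E, (τ j / δ) • z j.1, ?_⟩
    rw [mul_smul, Finset.smul_sum, ← hgu, ← hwE]
    congr 1
    exact Finset.sum_congr rfl fun j _ => by rw [smul_smul, Nat.mul_div_cancel' (hδ j)]
  obtain ⟨q₁, hq₁, hq₁u⟩ := hQ (q * (R₁ + R₂ + 2 + ∑ j, R₃ j))
  obtain ⟨b, hb0, hbu, hbn⟩ : ∃ b : ℕ, 0 < b ∧ (∃ w : G, b • w = u) ∧
      ((∃ w : G, (n + 1) • w = u) → n + 1 ∣ b) := by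
    by_cases h : ∃ w : G, (n + 1) • w = u
    · exact ⟨n + 1, n.succ_pos, h, fun _ => dvd_rfl⟩
    · exact ⟨1, one_pos, ⟨u, one_smul _ _⟩, fun h' => absurd h' h⟩
  obtain ⟨w, hw⟩ := exists_lcm_nsmul hδu (exists_lcm_nsmul hq₁u hbu)
  have hδ0 : 0 < q * δ := Nat.pos_of_ne_zero fun h => by
    obtain ⟨w, hw⟩ := hδu
    rw [h, zero_smul] at hw
    exact hu.ne hw
  have hq₁0 : 0 < q₁ := lt_of_lt_of_le (by positivity) hq₁
  obtain ⟨ρ, hρ⟩ := Nat.dvd_lcm_left (q * δ) (Nat.lcm q₁ b)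
  set Q := Nat.lcm (q * δ) (Nat.lcm q₁ b) with hQdef
  set r := δ * ρ with hr
  have hQr : Q = q * r := by rw [hρ, hr, mul_assoc]
  have hQ0 : 0 < Q := Nat.lcm_pos hδ0 (Nat.lcm_pos hq₁0 hb0)
  have hrbig : R₁ + R₂ + 2 + ∑ j, R₃ j ≤ r := by
    have h1 : q₁ ≤ Q := Nat.le_of_dvd hQ0 ((Nat.dvd_lcm_left _ _).trans (Nat.dvd_lcm_right _ _))
    rw [hQr] at h1
    exact Nat.le_of_mul_le_mul_left (hq₁.trans h1) hq
  have hrQ : r ≤ Q := by rw [hQr]; exact Nat.le_mul_of_pos_left _ hq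
  have hw0 : 0 ≤ w := hG.unperforated Q w hQ0 (by rw [hw]; exact hu.le)
  obtain ⟨Y, _, y, κ, hy, hκ, hκr, hzy, hcard⟩ := hdec r w (by omega) (hbez r ⟨ρ, rfl⟩) hw0
    (fun j => hR₃ j Q w (by
      have := Finset.single_le_sum (f := R₃) (fun _ _ => Nat.zero_le _) (Finset.mem_univ j)
      omega) hw) (by
      rw [hwE]
      refine hG.eq_of_nsmul_eq hq ?_
      rw [hgu, smul_smul, ← hQr, hw])
  refine ⟨r, by omega, Y, inferInstance, y, fun l a => ∑ j : E, κ l j * v j.1 (Sum.inl a),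
    fun l => ∑ j : E, κ l j * v j.1 (Sum.inr 0), hy, ?_, ?_, ?_, ?_, ?_, ?_, ?_, ?_, ?_⟩
  · rw [mul_smul, ← hgu]
    congr 1
    rw [← hwE, Finset.smul_sum]
    simp_rw [hzy, Finset.smul_sum]
    rw [Finset.sum_comm]
    refine Finset.sum_congr rfl fun l _ => ?_
    rw [← hκr l, Finset.sum_smul]
    exact Finset.sum_congr rfl fun j _ => by rw [smul_smul]
  · intro l a
    obtain ⟨j, hj⟩ : ∃ j : E, v j.1 (Sum.inl a) ≠ 0 := by
      by_contra hcon
      push Not at hcon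
      have := hg a
      rw [hgE] at this
      simp [hcon] at this
    exact (Nat.succ_le_of_lt (Nat.mul_pos (hκ l j) (Nat.pos_of_ne_zero hj))).trans
      (Finset.single_le_sum (f := fun j : E => κ l j * v j.1 (Sum.inl a))
        (fun _ _ => Nat.zero_le _) (Finset.mem_univ j))
  · intro l
    rw [Finset.sum_comm, ← hκr l]
    exact Finset.sum_congr rfl fun j _ => by rw [← Finset.mul_sum, mul_comm]
  · intro l
    rw [Finset.sum_comm, ← hκr l, Finset.mul_sum]
    refine Finset.sum_le_sum fun j _ => ?_
    rw [← Finset.mul_sum, mul_left_comm, mul_comm (τ j)]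
    exact Nat.mul_le_mul_left _ (hvF j.1)
  · intro a
    rw [hgE a]
    simp_rw [hzy, Finset.smul_sum, Finset.sum_smul]
    rw [Finset.sum_comm]
    exact Finset.sum_congr rfl fun l _ => Finset.sum_congr rfl fun j _ => by
      rw [smul_smul, mul_comm]
  · intro c hc l
    push_cast
    simp_rw [Finset.sum_mul]
    rw [Finset.sum_comm]
    refine Finset.sum_eq_zero fun j _ => ?_
    simp_rw [mul_assoc]
    rw [← Finset.mul_sum, hvK c hc j.1, mul_zero]
  · conv_lhs => rw [hpE]
    simp_rw [hzy, Finset.smul_sum, Finset.sum_smul]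
    rw [Finset.sum_comm]
    exact Finset.sum_congr rfl fun l _ => Finset.sum_congr rfl fun j _ => by
      rw [smul_smul, mul_comm]
  · intro h
    rw [← hQr]
    exact (hbn h).trans ((Nat.dvd_lcm_right _ _).trans (Nat.dvd_lcm_right _ _))
  · refine le_trans ?_ (hR₂ r (by omega))
    have h1 : (Fintype.card Y : ℝ) ≤ ((r : ℝ) + 1) ^ Fintype.card E := by exact_mod_cast hcard
    calc (Fintype.card Y : ℝ) * C ≤ Fintype.card Y * max C 0 := by gcongr; exact le_max_left _ _
      _ ≤ _ := by gcongr

end SimpleRieszGroup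

/-- A sequence of substitutions `σ n` from `A (n + 1)` to words of length `r n` over `A n`, with
recognizable beginnings and common first and last letters. -/
structure WordSystem where
  A : ℕ → Type
  [fin : ∀ n, Fintype (A n)]
  r : ℕ → ℕ
  two_le : ∀ n, 2 ≤ r n
  σ : ∀ n, A (n + 1) → ℕ → A n
  s : ∀ n, A n
  e : ∀ n, A n
  s_ne_e : ∀ n, s n ≠ e n
  σ_first : ∀ n b, σ n b 0 = s n
  σ_last : ∀ n b, σ n b (r n - 1) = e n
  σ_run : ∀ n b i, i + 1 < r n → σ n b (i + 1) = s n → σ n b i = s n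
  σ_inj : ∀ n b b', (∀ i < r n, σ n b i = σ n b' i) → b = b'
  σ_surj : ∀ n b a, ∃ i < r n, σ n b i = a

attribute [instance] WordSystem.fin

/-- The length of the words of level `n` over the alphabet of level `0`. -/
def WordSystem.q (W : WordSystem) (n : ℕ) : ℕ := ∏ i ∈ Finset.range n, W.r i

/-- The weights `g` on the letters of a word system describe its dimension group as `(G, u)`. -/
structure WordSystem.IsDimensionData (W : WordSystem) {G : Type*} [AddCommGroup G]
    [PartialOrder G] (u : G) (g : ∀ n, W.A n → G) : Prop where
  nonneg : ∀ n a, 0 ≤ g n a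
  unit : ∑ a, g 0 a = u
  compat : ∀ n (c : W.A n → ℤ), ∑ a, c a • g n a =
    ∑ b, (∑ i ∈ Finset.range (W.r n), c (W.σ n b i)) • g (n + 1) b
  kill : ∀ n (c : W.A n → ℤ), ∑ a, c a • g n a = 0 →
    ∀ b, ∑ i ∈ Finset.range (W.r n), c (W.σ n b i) = 0
  exists_combination : ∀ p : G, 0 ≤ p → ∃ n, ∃ N : W.A n → ℕ, p = ∑ a, N a • g n a
  dvd : ∀ p : ℕ, 0 < p → (∃ w : G, p • w = u) → ∃ n, p ∣ W.q n

section Stage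

variable {G : Type*} [AddCommGroup G] [PartialOrder G]

/-- A stage of the construction at height `q`: towers indexed by `Y` with measure `y`, each of
which is to be cut into columns of which all but a small proportion have the same measure. -/
structure Stage (u : G) (t : ℝ) (q : ℕ) where
  Y : Type
  [fin : Fintype Y]
  y₀ : Y
  y : Y → G
  x : Y → G
  x_pos : ∀ l, 0 < x l
  x_le : ∀ l, (freeCount t q + 2) • x l ≤ y l
  sparse : ∀ l, sparsity t q • (y l - freeCount t q • x l) ≤ y l
  sum_eq : q • ∑ l, y l = u

attribute [instance] Stage.fin

namespace Stage

variable {u : G} {t : ℝ} {q : ℕ} (S : Stage u t q)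

/-- The letters of a stage. -/
abbrev A : Type := S.Y × Fin (freeCount t q + 2)

/-- The measures of the letters of a stage. -/
noncomputable def g (a : S.A) : G :=
  Fin.lastCases (motive := fun _ => G) (S.y a.1 - (freeCount t q + 1) • S.x a.1)
    (fun _ => S.x a.1) a.2

/-- The first letter of all words. -/
noncomputable def s : S.A := (S.y₀, Fin.last _)

/-- The last letter of all words. -/
noncomputable def e : S.A := (S.y₀, (Fin.last _).castSucc)

/-- The freely permutable letters. -/
noncomputable def free (l : S.Y) (i : Fin (freeCount t q)) : S.A := (l, i.castSucc.castSucc)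

lemma g_last (l : S.Y) : S.g (l, Fin.last _) = S.y l - (freeCount t q + 1) • S.x l := by
  simp [g]

lemma g_castSucc (l : S.Y) (i) : S.g (l, Fin.castSucc i) = S.x l := by
  simp [g]

lemma sum_g (l : S.Y) : ∑ i, S.g (l, i) = S.y l := by
  simp [Fin.sum_univ_castSucc, g_last, g_castSucc]

lemma card_A : Fintype.card S.A = Fintype.card S.Y * (freeCount t q + 2) := by
  simp

/-- The letters that are not freely permutable. -/
noncomputable def nonfree : Finset S.A :=
  Finset.univ ×ˢ {(Fin.last _).castSucc, Fin.last _}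

lemma sum_nonfree {M : Type*} [AddCommMonoid M] (c : S.A → M) :
    ∑ a ∈ S.nonfree, c a = ∑ l, (c (l, (Fin.last _).castSucc) + c (l, Fin.last _)) := by
  rw [nonfree, Finset.sum_product]
  refine Finset.sum_congr rfl fun l _ => Finset.sum_pair ?_
  exact (Fin.castSucc_lt_last _).ne

lemma sum_eq_free_add {M : Type*} [AddCommMonoid M] (c : S.A → M) :
    ∑ a, c a = ∑ l, ∑ i, c (S.free l i) + ∑ a ∈ S.nonfree, c a := by
  rw [sum_nonfree, Fintype.sum_prod_type, ← Finset.sum_add_distrib]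
  refine Finset.sum_congr rfl fun l _ => ?_
  rw [Fin.sum_univ_castSucc, Fin.sum_univ_castSucc, add_assoc]
  rfl

variable [IsOrderedAddMonoid G]

lemma g_pos (a : S.A) : 0 < S.g a := by
  obtain ⟨l, i⟩ := a
  refine Fin.lastCases ?_ (fun i => ?_) i
  · rw [g_last, sub_pos]
    refine lt_of_lt_of_le ?_ (S.x_le l)
    exact nsmul_lt_nsmul_left (S.x_pos l) (by omega)
  · rw [g_castSucc]
    exact S.x_pos l

lemma sparsity_nonfree : sparsity t q • ∑ a ∈ S.nonfree, S.g a ≤ ∑ a, S.g a := by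
  rw [sum_nonfree, Fintype.sum_prod_type, Finset.smul_sum]
  refine Finset.sum_le_sum fun l _ => ?_
  rw [sum_g, g_last, g_castSucc]
  convert S.sparse l using 2
  rw [add_smul, one_smul]
  abel

end Stage

namespace SimpleRieszGroup

variable [IsOrderedAddMonoid G]

lemma exists_stage (hG : SimpleRieszGroup G) {u : G} (hu : 0 < u)
    (hQ : ∀ N : ℕ, ∃ q, N ≤ q ∧ ∃ g : G, q • g = u) {t : ℝ} (ht : 0 ≤ t) {q : ℕ} {Y : Type}
    [Fintype Y] (y : Y → G) (hy : ∀ l, 0 < y l) (hyu : q • ∑ l, y l = u) :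
    ∃ S : Stage u t q, ∃ f : S.Y ≃ Y, ∀ l, S.y l = y (f l) := by
  have hne : Nonempty Y := by
    by_contra h
    rw [not_nonempty_iff] at h
    simp at hyu
    exact hu.ne hyu
  choose x hx using fun l => hG.exists_approx_div (hG.exists_small hu hQ) (y l) (hy l)
    (freeCount t q) (sparsity t q) (two_mul_sparsity_le ht q)
  exact ⟨⟨Y, Classical.choice hne, y, x, fun l => (hx l).1, fun l => (hx l).2.1,
    fun l => (hx l).2.2, hyu⟩, Equiv.refl _, fun _ => rfl⟩

/-- The inductive step of the construction. -/
lemma exists_next_stage (hG : SimpleRieszGroup G) {u : G} (hu : 0 < u)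
    (hQ : ∀ N : ℕ, ∃ q, N ≤ q ∧ ∃ g : G, q • g = u) {t : ℝ} (ht : 0 ≤ t) {q : ℕ} (hq : 0 < q)
    (S : Stage u t q) (p : G) (hp : 0 ≤ p) (n : ℕ) :
    ∃ r, 2 ≤ r ∧ ∃ (S' : Stage u t (q * r)) (σ : S'.A → ℕ → S.A),
      (∀ b, ∃ M : S.A → ℕ, (∀ a, 1 ≤ M a) ∧ IsMarkedWord S.s S.e M r (σ b)) ∧
      Function.Injective σ ∧
      (∀ c : S.A → ℤ, ∑ a, c a • S.g a =
        ∑ b, (∑ i ∈ Finset.range r, c (σ b i)) • S'.g b) ∧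
      (∀ c : S.A → ℤ, ∑ a, c a • S.g a = 0 → ∀ b, ∑ i ∈ Finset.range r, c (σ b i) = 0) ∧
      (∃ N : S'.A → ℕ, p = ∑ b, N b • S'.g b) ∧
      ((∃ w : G, (n + 1) • w = u) → n + 1 ∣ q * r) ∧
      (Fintype.card S'.A : ℝ) ≤ Real.exp ((t + 1 / (n + 1)) * (q * r : ℕ)) := by
  classical
  have hSu : q • ∑ a, S.g a = u := by
    rw [Fintype.sum_prod_type, Finset.sum_congr rfl fun l _ => S.sum_g l, S.sum_eq]
  obtain ⟨r, hr2, Y, _, y, M, N, hy, hyu, hM1, hMr, hMK, hMg, hMkill, hN, hdvd, hcard⟩ :=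
    hG.exists_refined_family hu hQ S.g S.g_pos q hq hSu S.nonfree (sparsity t q)
      S.sparsity_nonfree p hp n (Real.exp 4)
  obtain ⟨S', f, hf⟩ := hG.exists_stage hu hQ ht (q := q * r) y hy hyu
  have hcardY : Fintype.card S'.Y = Fintype.card Y := Fintype.card_congr f
  have hcard' : (Fintype.card S'.A : ℝ) ≤ Real.exp (r / (n + 1)) * Real.exp (t * (q * r : ℕ)) := by
    rw [S'.card_A, hcardY]
    push_cast
    have := freeCount_add_two_le ht (q * r)
    push_cast at this
    calc (Fintype.card Y : ℝ) * (freeCount t (q * r) + 2)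
        ≤ Fintype.card Y * (Real.exp 4 * Real.exp (t * (q * r))) := by gcongr
      _ = Fintype.card Y * Real.exp 4 * Real.exp (t * (q * r)) := by ring
      _ ≤ _ := by gcongr
  have hconst : ∀ l τ i j, M l (τ, Fin.castSucc i) = M l (τ, Fin.castSucc j) := by
    intro l τ i j
    have := hMkill (Pi.single (τ, Fin.castSucc i) 1 - Pi.single (τ, Fin.castSucc j) 1) (by
      simp [sub_smul, Pi.single_apply, ite_smul, S.g_castSucc]) l
    simp only [Pi.sub_apply, mul_sub, Finset.sum_sub_distrib, Pi.single_apply, mul_ite, mul_one,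
      mul_zero, Finset.sum_ite_eq', Finset.mem_univ, if_true] at this
    exact_mod_cast sub_eq_zero.1 this
  have hwords : ∀ b : S'.A, ∃ T : Finset (ℕ → S.A), Fintype.card S'.A ≤ T.card ∧
      ∀ w ∈ T, IsMarkedWord S.s S.e (M (f b.1)) r w := by
    intro b
    obtain ⟨T, hT, hTw⟩ := exists_marked_words S.free
      (fun l i l' i' h => by simpa [Stage.free] using h) S.s S.e
      (fun h => (Fin.castSucc_lt_last _).ne' (congrArg Prod.snd h))
      (fun l i h => (Fin.castSucc_lt_last _).ne (congrArg Prod.snd h))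
      (fun l i h => (Fin.castSucc_lt_last i).ne
        (Fin.castSucc_injective _ (congrArg Prod.snd h)))
      (M (f b.1)) (hM1 _) (fun τ => M (f b.1) (τ, (Fin.last _).castSucc))
      (fun τ i => hconst _ _ _ _) r (hMr _)
    refine ⟨T, ?_, hTw⟩
    have h1 : freeCount t q * (∑ τ, M (f b.1) (τ, (Fin.last _).castSucc)) +
        ∑ a ∈ S.nonfree, M (f b.1) a = r := by
      refine Eq.trans ?_ (hMr (f b.1))
      rw [S.sum_eq_free_add, Finset.mul_sum]
      congr 1
      refine Finset.sum_congr rfl fun τ _ => ?_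
      rw [Finset.sum_congr rfl fun i _ => hconst (f b.1) τ i.castSucc (Fin.last _)]
      simp
    have h2 := exp_le_factorial_pow ht q r _ _ h1 (hMK _)
    have h3 : (Fintype.card S'.A : ℝ) ≤ T.card := by
      rw [hT]
      push_cast
      refine hcard'.trans (le_trans ?_ h2)
      rw [← Real.exp_add]
      refine Real.exp_le_exp.2 ?_
      have : (r : ℝ) / (n + 1) ≤ r := div_le_self (by positivity) (by
        have : (0 : ℝ) ≤ n := by positivity
        linarith)
      push_cast
      linarith
    exact_mod_cast h3
  choose T hTcard hTw using hwords
  obtain ⟨σ, hσinj, hσ⟩ := exists_injective_choice T hTcard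
  have hσw := fun b => hTw b (σ b) (hσ b)
  have hfib : ∀ c : Y → ℤ, ∑ b : S'.A, c (f b.1) • S'.g b = ∑ l, c l • y l := by
    intro c
    rw [Fintype.sum_prod_type]
    simp_rw [← Finset.smul_sum, S'.sum_g, hf]
    exact Equiv.sum_comp f fun l => c l • y l
  refine ⟨r, hr2, S', σ, fun b => ⟨_, hM1 _, hσw b⟩, hσinj, fun c => ?_, fun c hc b => ?_,
    ⟨fun b => N (f b.1), ?_⟩, hdvd, hcard'.trans ?_⟩
  · simp_rw [(hσw _).count]
    rw [hfib fun l => ∑ a, (M l a : ℤ) * c a]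
    simp_rw [Finset.sum_smul]
    rw [Finset.sum_comm]
    refine Finset.sum_congr rfl fun a _ => ?_
    rw [hMg a, Finset.smul_sum]
    exact Finset.sum_congr rfl fun l _ => by rw [mul_comm, mul_smul, natCast_zsmul]
  · rw [(hσw b).count]
    exact hMkill c hc _
  · have := hfib fun l => N l
    simp only [natCast_zsmul] at this
    rw [this, hN]
  · rw [← Real.exp_add]
    refine Real.exp_le_exp.2 ?_
    have h1 : (r : ℝ) ≤ q * r := by
      exact_mod_cast Nat.le_mul_of_pos_left r hq
    have h2 : (r : ℝ) / (n + 1) ≤ q * r / (n + 1) := by gcongr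
    push_cast
    have h3 : (t + 1 / ((n : ℝ) + 1)) * (q * r) = q * r / (n + 1) + t * (q * r) := by ring
    rw [h3]
    linarith

/-- The order-theoretic part of the construction: every simple dimension group whose unit is
infinitely divisible is the dimension group of a word system of given exponential growth. -/
theorem exists_wordSystem (hG : SimpleRieszGroup G) [Countable G] {u : G} (hu : 0 < u)
    (hQ : ∀ N : ℕ, ∃ q, N ≤ q ∧ ∃ g : G, q • g = u) {t : ℝ} (ht : 0 ≤ t) :
    ∃ (W : WordSystem) (g : ∀ n, W.A n → G), W.IsDimensionData u g ∧
      (∀ n, Real.exp (t * W.q n) ≤ Fintype.card (W.A n)) ∧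
      ∀ n : ℕ, (Fintype.card (W.A (n + 1)) : ℝ) ≤ Real.exp ((t + 1 / (n + 1)) * W.q (n + 1)) := by
  classical
  obtain ⟨enum, henum⟩ := exists_surjective_nat G
  let State := Σ q : {q : ℕ // 0 < q}, Stage u t q
  obtain ⟨S₀, -⟩ := hG.exists_stage hu hQ ht (q := 1) (Y := Unit) (fun _ => u) (fun _ => hu)
    (by simp)
  have step : ∀ (n : ℕ) (S : State), ∃ r, 2 ≤ r ∧ ∃ (S' : Stage u t (S.1 * r))
      (σ : S'.A → ℕ → S.2.A),
      (∀ b, ∃ M : S.2.A → ℕ, (∀ a, 1 ≤ M a) ∧ IsMarkedWord S.2.s S.2.e M r (σ b)) ∧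
      Function.Injective σ ∧
      (∀ c : S.2.A → ℤ, ∑ a, c a • S.2.g a =
        ∑ b, (∑ i ∈ Finset.range r, c (σ b i)) • S'.g b) ∧
      (∀ c : S.2.A → ℤ, ∑ a, c a • S.2.g a = 0 → ∀ b, ∑ i ∈ Finset.range r, c (σ b i) = 0) ∧
      (0 ≤ enum n → ∃ N : S'.A → ℕ, enum n = ∑ b, N b • S'.g b) ∧
      ((∃ w : G, (n + 1) • w = u) → n + 1 ∣ S.1 * r) ∧
      (Fintype.card S'.A : ℝ) ≤ Real.exp ((t + 1 / (n + 1)) * (S.1 * r : ℕ)) := by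
    rintro n ⟨⟨q, hq⟩, S⟩
    obtain ⟨r, hr, S', σ, h1, h2, h3, h4, h5, h6, h7⟩ := hG.exists_next_stage hu hQ ht hq S
      (if 0 ≤ enum n then enum n else 0) (by split_ifs with h; exacts [h, le_rfl]) n
    exact ⟨r, hr, S', σ, h1, h2, h3, h4, fun h => by rwa [if_pos h] at h5, h6, h7⟩
  choose r hr2 S' σ hword hinj hcompat hkill hcomb hdvd hcard using step
  let St : ℕ → State := Nat.rec ⟨⟨1, one_pos⟩, S₀⟩ fun n S =>
    ⟨⟨S.1 * r n S, Nat.mul_pos S.1.2 (by have := hr2 n S; omega)⟩, S' n S⟩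
  choose M hM1 hMw using hword
  let W : WordSystem :=
    { A := fun n => (St n).2.A
      r := fun n => r n (St n)
      two_le := fun n => hr2 n (St n)
      σ := fun n => σ n (St n)
      s := fun n => (St n).2.s
      e := fun n => (St n).2.e
      s_ne_e := fun n h => (Fin.castSucc_lt_last _).ne' (congrArg Prod.snd h)
      σ_first := fun n b => (hMw n (St n) b).first
      σ_last := fun n b => (hMw n (St n) b).last
      σ_run := fun n b => (hMw n (St n) b).run
      σ_inj := fun n b b' h => hinj n (St n) (funext fun i => by
        rcases lt_or_ge i (r n (St n)) with hi | hi
        · exact h i hi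
        · rw [(hMw n (St n) b).tail i hi, (hMw n (St n) b').tail i hi])
      σ_surj := fun n b a => by
        by_contra! hcon
        have h1 := (hMw n (St n) b).count fun x => if x = a then 1 else 0
        rw [Finset.sum_eq_zero fun i hi => if_neg (hcon i (Finset.mem_range.1 hi))] at h1
        have h2 := hM1 n (St n) b a
        simp at h1
        omega }
  have hWq : ∀ n, W.q n = (St n).1 := by
    intro n
    induction n with
    | zero => exact Finset.prod_range_zero _
    | succ n ih => rw [WordSystem.q, Finset.prod_range_succ, ← WordSystem.q, ih]
  refine ⟨W, fun n => (St n).2.g, ⟨fun n a => ((St n).2.g_pos a).le, ?_, fun n => hcompat n (St n),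
    fun n => hkill n (St n), fun p hp => ?_, fun p hp hpu => ?_⟩, fun n => ?_, fun n => ?_⟩
  · have h1 : ∑ a, S₀.g a = u := by
      rw [Fintype.sum_prod_type, Finset.sum_congr rfl fun l _ => S₀.sum_g l]
      simpa using S₀.sum_eq
    exact h1
  · obtain ⟨n, rfl⟩ := henum p
    exact ⟨n + 1, hcomb n (St n) hp⟩
  · obtain ⟨n, rfl⟩ := Nat.exists_eq_succ_of_ne_zero hp.ne'
    refine ⟨n + 1, ?_⟩
    rw [hWq]
    exact hdvd n (St n) hpu
  · rw [hWq]
    have h1 : (Fintype.card (St n).2.A : ℝ) = Fintype.card (St n).2.Y * (freeCount t (St n).1 + 2) := by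
      rw [(St n).2.card_A]
      push_cast
      rfl
    change _ ≤ (Fintype.card (St n).2.A : ℝ)
    rw [h1]
    have h2 : (1 : ℝ) ≤ Fintype.card (St n).2.Y := by
      exact_mod_cast Fintype.card_pos_iff.2 ⟨(St n).2.y₀⟩
    have h3 := exp_le_freeCount t (St n).1
    have h4 : Real.exp (t * (St n).1) ≤ Real.exp (t * (St n).1 + 3) :=
      Real.exp_le_exp.2 (by linarith)
    nlinarith
  · rw [hWq]
    exact hcard n (St n)

end SimpleRieszGroup

end Stage

namespace WordSystem

variable (W : WordSystem)

lemma r_pos (n : ℕ) : 0 < W.r n := lt_of_lt_of_le two_pos (W.two_le n)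

lemma q_zero : W.q 0 = 1 := Finset.prod_range_zero _

lemma q_succ (n : ℕ) : W.q (n + 1) = W.q n * W.r n := Finset.prod_range_succ _ _

lemma q_pos (n : ℕ) : 0 < W.q n := Finset.prod_pos fun i _ => W.r_pos i

lemma lt_q (n : ℕ) : n < W.q n := by
  induction n with
  | zero => exact W.q_pos 0
  | succ n ih =>
    rw [q_succ]
    have := Nat.mul_le_mul_left (W.q n) (W.two_le n)
    omega

/-- Finite stages of the two-sided limit of the substitutions around the origin. -/
def approx : ℕ → ∀ n, ℤ → W.A n
  | 0, n, j => if 0 ≤ j then W.s n else W.e n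
  | N + 1, n, j => W.σ n (approx N (n + 1) (j / W.r n)) (j % W.r n).toNat

lemma ediv_bounds {r : ℤ} (hr : 2 ≤ r) {j N : ℤ} (hN : 0 ≤ N) (h1 : -(N + 2) ≤ j)
    (h2 : j ≤ N + 1) : -(N + 1) ≤ j / r ∧ j / r ≤ N := by
  constructor
  · rw [Int.le_ediv_iff_mul_le (by omega)]
    nlinarith
  · rw [← Int.lt_add_one_iff, Int.ediv_lt_iff_lt_mul (by omega)]
    nlinarith

lemma approx_succ (N n : ℕ) (j : ℤ) (h1 : -(N + 1 : ℤ) ≤ j) (h2 : j ≤ N) :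
    W.approx (N + 1) n j = W.approx N n j := by
  have hr := W.two_le n
  induction N generalizing n j with
  | zero =>
    obtain rfl | rfl : j = 0 ∨ j = -1 := by push_cast at h1 h2; omega
    · simp [approx, W.σ_first]
    · have h3 : (-1 : ℤ) / W.r n = -1 := by
        rw [Int.ediv_eq_iff_of_pos (by omega)]; omega
      have h4 : ((-1 : ℤ) % W.r n).toNat = W.r n - 1 := by
        have := Int.emod_add_mul_ediv (-1) (W.r n)
        rw [h3] at this
        omega
      change W.σ n (W.approx 0 (n + 1) (-1 / W.r n)) (-1 % (W.r n : ℤ)).toNat = _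
      rw [h3, h4, W.σ_last]
      simp [approx]
  | succ N ih =>
    rw [approx]
    conv_rhs => rw [approx]
    push_cast at h1 h2
    have := ediv_bounds (r := W.r n) (by omega) (N := N) (j := j) (by omega) (by omega) (by omega)
    rw [ih (n + 1) _ (by omega) this.2 (W.two_le _)]

lemma approx_of_natAbs_le (N n : ℕ) (j : ℤ) (h : j.natAbs ≤ N) :
    W.approx N n j = W.approx j.natAbs n j := by
  induction N, h using Nat.le_induction with
  | base => rfl
  | succ N hN ih => rw [approx_succ _ _ _ _ (by omega) (by omega), ih]

/-- The two-sided limit sequence of level `n`. -/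
def η (n : ℕ) (j : ℤ) : W.A n := W.approx j.natAbs n j

lemma η_eq (n : ℕ) (j : ℤ) :
    W.η n j = W.σ n (W.η (n + 1) (j / W.r n)) (j % W.r n).toNat := by
  have hr := W.two_le n
  rw [η, ← approx_of_natAbs_le W (j.natAbs + 1) n j (by omega), approx, η,
    approx_of_natAbs_le]
  rcases eq_or_ne j 0 with rfl | hj
  · simp
  have := ediv_bounds (r := W.r n) (by omega) (N := j.natAbs - 1) (j := j) (by omega) (by omega)
    (by omega)
  omega

lemma η_mul_add (n : ℕ) (k : ℤ) (i : ℕ) (hi : i < W.r n) :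
    W.η n (W.r n * k + i) = W.σ n (W.η (n + 1) k) i := by
  have hr := W.r_pos n
  have h1 : (W.r n * k + i : ℤ) / W.r n = k := by
    rw [Int.ediv_eq_iff_of_pos (by omega)]
    constructor <;> nlinarith
  have h2 : (W.r n * k + i : ℤ) % W.r n = i := by
    have := Int.emod_add_mul_ediv (W.r n * k + i) (W.r n)
    rw [h1] at this
    linarith
  rw [η_eq, h1, h2, Int.toNat_natCast]

lemma η_mul (n : ℕ) (k : ℤ) : W.η n (W.r n * k) = W.s n := by
  have := W.η_mul_add n k 0 (W.r_pos n)
  rw [W.σ_first] at this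
  simpa using this

lemma η_mul_sub_one (n : ℕ) (k : ℤ) : W.η n (W.r n * k - 1) = W.e n := by
  have hr := W.r_pos n
  have := W.η_mul_add n (k - 1) (W.r n - 1) (by omega)
  rw [W.σ_last] at this
  rw [← this]
  congr 1
  push_cast [hr]
  ring

lemma exists_η_eq (n : ℕ) (a : W.A n) : ∃ k, W.η n k = a := by
  obtain ⟨i, hi, h⟩ := W.σ_surj n (W.η (n + 1) 0) a
  exact ⟨W.r n * 0 + i, by rw [W.η_mul_add n 0 i hi, h]⟩

/-- The word of level `0` coded by a letter of level `n`. -/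
def word : ∀ n, W.A n → ℕ → W.A 0
  | 0, a, _ => a
  | n + 1, b, i => word n (W.σ n b (i / W.q n)) (i % W.q n)

lemma η_zero_eq_word (n : ℕ) (k : ℤ) (i : ℕ) (hi : i < W.q n) :
    W.η 0 (W.q n * k + i) = W.word n (W.η n k) i := by
  induction n generalizing k i with
  | zero =>
    rw [q_zero] at hi ⊢
    obtain rfl : i = 0 := by omega
    simp [word]
  | succ n ih =>
    rw [q_succ] at hi
    have hq := W.q_pos n
    have h1 : i / W.q n < W.r n := Nat.div_lt_of_lt_mul hi
    rw [word, ← W.η_mul_add n k _ h1, ← ih _ _ (Nat.mod_lt _ hq)]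
    congr 1
    have := Nat.div_add_mod i (W.q n)
    rw [q_succ]
    zify at this
    push_cast
    linear_combination -this

lemma word_injective (n : ℕ) (a b : W.A n) (h : ∀ i < W.q n, W.word n a i = W.word n b i) :
    a = b := by
  induction n with
  | zero => exact h 0 (W.q_pos 0)
  | succ n ih =>
    have hq := W.q_pos n
    refine W.σ_inj n a b fun i hi => ih _ _ fun j hj => ?_
    have h1 : W.q n * i + j < W.q (n + 1) := by
      rw [q_succ]; nlinarith
    have := h _ h1
    rwa [word, word, Nat.mul_add_div hq, Nat.div_eq_of_lt hj, Nat.mul_add_mod,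
      Nat.mod_eq_of_lt hj, add_zero] at this

/-- The positions `k` and `k'` see the same letters of level `0` in the window `[-N, N]`. -/
def Agree (N : ℕ) (k k' : ℤ) : Prop := ∀ i : ℤ, |i| ≤ N → W.η 0 (k + i) = W.η 0 (k' + i)

variable {W}

lemma Agree.shift {N M : ℕ} {k k' : ℤ} (h : W.Agree (N + M) k k') {j : ℤ} (hj : |j| ≤ M) :
    W.Agree N (k + j) (k' + j) := fun i hi => by
  rw [add_assoc, add_assoc]
  refine h _ ((abs_add_le _ _).trans ?_)
  push_cast
  linarith

lemma Agree.mono {N M : ℕ} (hNM : N ≤ M) {k k' : ℤ} (h : W.Agree M k k') : W.Agree N k k' :=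
  fun i hi => h i (hi.trans (by exact_mod_cast hNM))

variable (W)

/-- The positions `k` and `k'` lie at the same place of the same word of level `n`. -/
def SamePlace (n : ℕ) (k k' : ℤ) : Prop :=
  W.η n (k / W.q n) = W.η n (k' / W.q n) ∧ k % W.q n = k' % W.q n

lemma ediv_q_succ (n : ℕ) (k : ℤ) : k / W.q (n + 1) = k / W.q n / W.r n := by
  rw [q_succ, Nat.cast_mul, Int.ediv_ediv_of_nonneg (by positivity)]

lemma emod_q_succ (n : ℕ) (k : ℤ) :
    k % W.q (n + 1) = W.q n * (k / W.q n % W.r n) + k % W.q n := by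
  have h1 := Int.emod_add_mul_ediv k (W.q (n + 1))
  have h2 := Int.emod_add_mul_ediv k (W.q n)
  have h3 := Int.emod_add_mul_ediv (k / W.q n) (W.r n)
  rw [ediv_q_succ] at h1
  rw [q_succ] at h1 ⊢
  push_cast at h1 ⊢
  linear_combination h1 - h2 - W.q n * h3

lemma add_mul_ediv_q (n : ℕ) (k i : ℤ) : (k + i * W.q n) / W.q n = k / W.q n + i :=
  Int.add_mul_ediv_right _ _ (by have := W.q_pos n; omega)

lemma boundary_iff (n : ℕ) (j : ℤ) :
    j % W.r n = 0 ↔ W.η n j = W.s n ∧ W.η n (j - 1) = W.e n := by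
  have hr := W.r_pos n
  have h0 := Int.emod_add_mul_ediv j (W.r n)
  have h1 := Int.emod_nonneg j (show (W.r n : ℤ) ≠ 0 by omega)
  have h2 := Int.emod_lt_of_pos j (show (0 : ℤ) < W.r n by omega)
  constructor
  · intro h
    rw [h, zero_add] at h0
    rw [← h0]
    exact ⟨W.η_mul n _, W.η_mul_sub_one n _⟩
  · rintro ⟨h3, h4⟩
    by_contra hne
    obtain ⟨i, hi⟩ : ∃ i : ℕ, j % W.r n = i + 1 := ⟨(j % W.r n - 1).toNat, by omega⟩
    have e1 : j = W.r n * (j / W.r n) + (i + 1 : ℕ) := by push_cast; linarith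
    have e2 : j - 1 = W.r n * (j / W.r n) + i := by linarith
    rw [e1, η_mul_add _ _ _ _ (by omega)] at h3
    rw [e2, η_mul_add _ _ _ _ (by omega)] at h4
    have h5 := W.σ_run n _ i (by omega) h3
    exact W.s_ne_e n (h5.symm.trans h4)

/-- Recognizability. -/
lemma exists_samePlace_of_agree (n : ℕ) :
    ∃ N, ∀ k k', W.Agree N k k' → W.SamePlace n k k' := by
  induction n with
  | zero =>
    refine ⟨0, fun k k' h => ?_⟩
    have := h 0 (by simp)
    simpa [SamePlace, q_zero] using this
  | succ n ih =>
    obtain ⟨N, hN⟩ := ih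
    refine ⟨N + W.q n * W.r n, fun k k' h => ?_⟩
    have hr := W.r_pos n
    have hr2 := W.two_le n
    have key : ∀ i : ℤ, |i| ≤ W.r n → W.η n (k / W.q n + i) = W.η n (k' / W.q n + i) := by
      intro i hi
      have := (hN _ _ (h.shift (j := i * W.q n) (by
        rw [abs_mul, Nat.abs_cast, mul_comm]
        push_cast
        gcongr))).1
      rwa [add_mul_ediv_q, add_mul_ediv_q] at this
    have h0 := (hN k k' (h.mono (Nat.le_add_right _ _))).2
    set j := k / W.q n
    set j' := k' / W.q n
    have p0 := Int.emod_nonneg j (show (W.r n : ℤ) ≠ 0 by omega)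
    have p1 := Int.emod_lt_of_pos j (show (0 : ℤ) < W.r n by omega)
    have p0' := Int.emod_nonneg j' (show (W.r n : ℤ) ≠ 0 by omega)
    have p1' := Int.emod_lt_of_pos j' (show (0 : ℤ) < W.r n by omega)
    have hmod : j % W.r n = j' % W.r n := by
      have e1 : (j - j % W.r n) % W.r n = 0 := by
        rw [Int.sub_emod, Int.emod_emod, sub_self, Int.zero_emod]
      have e2 : (j' - j % W.r n) % W.r n = 0 := by
        rw [boundary_iff] at e1 ⊢
        have k1 := key (-(j % W.r n)) (by rw [abs_neg, abs_of_nonneg p0]; omega)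
        have k2 := key (-(j % W.r n) - 1) (by rw [abs_of_nonpos (by omega)]; omega)
        simp only [← sub_eq_add_neg, ← add_sub_assoc] at k1 k2
        exact ⟨k1.symm.trans e1.1, k2.symm.trans e1.2⟩
      rw [← Int.emod_emod_of_dvd j (dvd_refl (W.r n : ℤ))]
      exact (Int.emod_eq_emod_iff_emod_sub_eq_zero.2 e2).symm
    have hd := Int.emod_add_mul_ediv j (W.r n)
    have hd' := Int.emod_add_mul_ediv j' (W.r n)
    refine ⟨?_, ?_⟩
    · rw [ediv_q_succ, ediv_q_succ]
      refine W.σ_inj n _ _ fun i hi => ?_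
      rw [← W.η_mul_add n _ i hi, ← W.η_mul_add n _ i hi]
      have := key (-(j % W.r n) + i) (abs_le.2 ⟨by omega, by omega⟩)
      convert this using 2
      · linarith
      · linarith
    · rw [emod_q_succ, emod_q_succ, hmod, h0]

lemma SamePlace.of_succ {W : WordSystem} {n : ℕ} {k k' : ℤ} (h : W.SamePlace (n + 1) k k') :
    W.SamePlace n k k' := by
  obtain ⟨h1, h2⟩ := h
  have hq := W.q_pos n
  have hr := W.r_pos n
  rw [ediv_q_succ, ediv_q_succ] at h1
  have h3 : k % W.q n = k' % W.q n := by
    have hd : (W.q n : ℤ) ∣ W.q (n + 1) := by rw [q_succ]; exact_mod_cast Dvd.intro _ rfl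
    rw [← Int.emod_emod_of_dvd k hd, h2, Int.emod_emod_of_dvd k' hd]
  have h4 : k / W.q n % W.r n = k' / W.q n % W.r n := by
    rw [emod_q_succ, emod_q_succ, h3] at h2
    have : (W.q n : ℤ) * (k / W.q n % W.r n) = W.q n * (k' / W.q n % W.r n) := by linarith
    exact Int.eq_of_mul_eq_mul_left (by omega) this
  exact ⟨by rw [η_eq, h1, h4, ← η_eq], h3⟩

lemma SamePlace.of_le {W : WordSystem} {n m : ℕ} (hnm : n ≤ m) {k k' : ℤ}
    (h : W.SamePlace m k k') : W.SamePlace n k k' := by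
  induction m, hnm using Nat.le_induction with
  | base => exact h
  | succ m _ ih => exact ih h.of_succ

lemma η_zero_eq_of_η_eq (n : ℕ) {k k' : ℤ} (h : W.SamePlace n k k') : W.η 0 k = W.η 0 k' := by
  simpa [SamePlace, q_zero] using (h.of_le (Nat.zero_le n)).1

/-- Words of level `n + 1` determine the sequence up to distance `q n` beyond their ends. -/
lemma SamePlace.agree {W : WordSystem} {n N : ℕ} (hN : N < W.q n) {k k' : ℤ}
    (h : W.SamePlace (n + 1) k k') : W.Agree N k k' := by
  intro i hi
  refine W.η_zero_eq_of_η_eq n ?_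
  have hq := W.q_pos n
  have hr := W.r_pos n
  obtain ⟨h1, h2⟩ := h
  have hk := Int.emod_add_mul_ediv k (W.q (n + 1))
  have hk' := Int.emod_add_mul_ediv k' (W.q (n + 1))
  have l0 := Int.emod_nonneg k' (show (W.q (n + 1) : ℤ) ≠ 0 by have := W.q_pos (n + 1); omega)
  have l1 := Int.emod_lt_of_pos k' (show (0 : ℤ) < W.q (n + 1) by have := W.q_pos (n + 1); omega)
  rw [h2] at hk
  set l := k' % W.q (n + 1)
  set m := k / W.q (n + 1)
  set m' := k' / W.q (n + 1)
  have hqs : (W.q (n + 1) : ℤ) = W.q n * W.r n := by rw [q_succ]; push_cast; rfl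
  obtain ⟨i0, i1⟩ := abs_le.1 hi
  have e1 : k + i = (l + i) + (W.r n * m) * W.q n := by rw [← hk, hqs]; ring
  have e2 : k' + i = (l + i) + (W.r n * m') * W.q n := by rw [← hk', hqs]; ring
  refine ⟨?_, ?_⟩
  · rw [e1, e2, add_mul_ediv_q, add_mul_ediv_q]
    have d0 : -1 ≤ (l + i) / W.q n := by
      rw [Int.le_ediv_iff_mul_le (by omega)]; omega
    have d1 : (l + i) / W.q n ≤ W.r n := by
      rw [← Int.lt_add_one_iff, Int.ediv_lt_iff_lt_mul (by omega)]
      nlinarith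
    generalize (l + i) / W.q n = d at d0 d1
    rcases eq_or_ne d (-1) with rfl | hd1
    · rw [neg_add_eq_sub, neg_add_eq_sub, η_mul_sub_one, η_mul_sub_one]
    rcases eq_or_ne d (W.r n) with rfl | hd2
    · rw [show ∀ m : ℤ, (W.r n : ℤ) + W.r n * m = W.r n * (m + 1) by intro m; ring, η_mul,
        show ∀ m : ℤ, (W.r n : ℤ) + W.r n * m = W.r n * (m + 1) by intro m; ring, η_mul]
    lift d to ℕ using by omega
    rw [add_comm, add_comm (d : ℤ), η_mul_add _ _ _ _ (by omega), η_mul_add _ _ _ _ (by omega), h1]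
  · rw [e1, e2, Int.add_mul_emod_self_right, Int.add_mul_emod_self_right]

/-- Far from the boundary of words the sequence is periodic. -/
lemma agree_zero_mul {n N : ℕ} (hN : N < W.q n) (m : ℤ) : W.Agree N (m * W.q (n + 1)) 0 := by
  intro i hi
  refine W.η_zero_eq_of_η_eq n ?_
  have hq := W.q_pos n
  have hqs : (W.q (n + 1) : ℤ) = W.q n * W.r n := by rw [q_succ]; push_cast; rfl
  have e1 : m * W.q (n + 1) + i = i + (W.r n * m) * W.q n := by rw [hqs]; ring
  obtain ⟨i0, i1⟩ := abs_le.1 hi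
  refine ⟨?_, ?_⟩
  · rw [e1, add_mul_ediv_q, zero_add]
    have d0 : -1 ≤ i / W.q n := by
      rw [Int.le_ediv_iff_mul_le (by omega)]; omega
    have d1 : i / W.q n < 1 := by
      rw [Int.ediv_lt_iff_lt_mul (by omega)]; omega
    obtain hd | hd : i / W.q n = -1 ∨ i / W.q n = 0 := by omega
    · have := W.η_mul_sub_one n 0
      rw [mul_zero, zero_sub] at this
      rw [hd, neg_add_eq_sub, η_mul_sub_one, this]
    · have := W.η_mul n 0
      rw [mul_zero] at this
      rw [hd, zero_add, η_mul, this]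
  · rw [e1, Int.add_mul_emod_self_right, zero_add]

end WordSystem

namespace WordSystem

variable (W : WordSystem)

lemma η_isToeplitz : IsToeplitz (W.η 0) := by
  intro k
  have h := W.lt_q k.natAbs
  refine ⟨W.q (k.natAbs + 1), by have := W.q_pos (k.natAbs + 1); omega, fun m => ?_⟩
  have := W.agree_zero_mul h m k (Int.natCast_natAbs k).ge
  rwa [zero_add, add_comm] at this

lemma η_isNonperiodic : IsNonperiodic (W.η 0) := by
  rintro ⟨p, hp, h⟩
  obtain ⟨N, hN⟩ := W.exists_samePlace_of_agree p.natAbs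
  have h1 := (hN p 0 fun i _ => by rw [add_comm, h, zero_add]).2
  have h2 := W.lt_q p.natAbs
  rw [Int.zero_emod, Int.emod_eq_of_lt (by omega) (by omega)] at h1
  omega

/-- The Toeplitz flow of a word system. -/
noncomputable def flow : ToeplitzFlow :=
  haveI : Nonempty (W.A 0) := ⟨W.s 0⟩
  { Λ := W.A 0
    η := W.η 0
    toeplitz := W.η_isToeplitz
    nonperiodic := W.η_isNonperiodic }

/-- The orbit of the Toeplitz sequence. -/
noncomputable def orb (k : ℤ) : W.flow.X :=
  ⟨fun i => W.η 0 (i + k), subset_closure ⟨k, rfl⟩⟩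

/-- Evaluation of a point of the flow at a coordinate. -/
def coord (x : W.flow.X) (i : ℤ) : W.A 0 := x.1 i

lemma coord_orb (k i : ℤ) : W.coord (W.orb k) i = W.η 0 (i + k) := rfl

lemma coord_T (x : W.flow.X) (i : ℤ) : W.coord (W.flow.T x) i = W.coord x (i + 1) := rfl

lemma ext_coord {x y : W.flow.X} (h : ∀ i, W.coord x i = W.coord y i) : x = y :=
  Subtype.ext (funext h)

lemma T_orb (k : ℤ) : W.flow.T (W.orb k) = W.orb (k + 1) :=
  W.ext_coord fun i => by rw [coord_T, coord_orb, coord_orb]; congr 1; ring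

lemma T_symm_orb (k : ℤ) : W.flow.T.symm (W.orb k) = W.orb (k - 1) := by
  rw [Homeomorph.symm_apply_eq, T_orb, sub_add_cancel]

/-- The set of points with the same coordinates as `x` in the window `[-N, N]`. -/
def cylinder (N : ℕ) (x : W.flow.X) : Set W.flow.X :=
  {y | ∀ i : ℤ, |i| ≤ N → W.coord y i = W.coord x i}

lemma orb_mem_cylinder_orb {N : ℕ} {k k' : ℤ} :
    W.orb k ∈ W.cylinder N (W.orb k') ↔ W.Agree N k k' := by
  simp only [cylinder, Set.mem_ofPred_eq, coord_orb, Agree, add_comm]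

lemma isOpen_cylinder (N : ℕ) (x : W.flow.X) : IsOpen (W.cylinder N x) := by
  have : W.cylinder N x = ⋂ i ∈ Finset.Icc (-N : ℤ) N,
      (fun y : W.flow.X => y.1 i) ⁻¹' {x.1 i} := by
    ext y
    simp only [cylinder, Set.mem_ofPred_eq, abs_le, Finset.mem_Icc, Set.mem_iInter]
    rfl
  rw [this]
  refine isOpen_biInter_finset fun i _ => ?_
  exact (isOpen_discrete {x.1 i}).preimage ((continuous_apply i).comp continuous_subtype_val)

lemma self_mem_cylinder (N : ℕ) (x : W.flow.X) : x ∈ W.cylinder N x := fun _ _ => rfl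

lemma exists_cylinder_subset {x : W.flow.X} {U : Set W.flow.X} (hU : U ∈ nhds x) :
    ∃ N, W.cylinder N x ⊆ U := by
  obtain ⟨V, hV, hVU⟩ := mem_nhds_subtype _ _ _ |>.1 hU
  obtain ⟨V', hV'V, hV'o, hxV'⟩ := mem_nhds_iff.1 hV
  obtain ⟨I, u, hu, hI⟩ := isOpen_pi_iff.1 hV'o x.1 hxV'
  refine ⟨∑ i ∈ I, i.natAbs, fun y hy => hVU (hV'V (hI fun i hi => ?_))⟩
  have h1 : i.natAbs ≤ ∑ i ∈ I, i.natAbs :=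
    Finset.single_le_sum (f := fun i : ℤ => i.natAbs) (fun _ _ => Nat.zero_le _) hi
  have h2 : y.1 i = x.1 i := hy i (by rw [← Int.natCast_natAbs]; exact_mod_cast h1)
  rw [h2]
  exact (hu i hi).2

instance : CompactSpace W.flow.X :=
  isCompact_iff_compactSpace.1 isClosed_closure.isCompact

lemma exists_orb_mem_cylinder (N : ℕ) (x : W.flow.X) : ∃ k, W.orb k ∈ W.cylinder N x := by
  obtain ⟨V, hVo, hV⟩ := isOpen_induced_iff.1 (W.isOpen_cylinder N x)
  have hx : x.1 ∈ V := by
    have : x ∈ Subtype.val ⁻¹' V := by rw [hV]; exact W.self_mem_cylinder N x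
    exact this
  obtain ⟨y, hyV, k, rfl⟩ := mem_closure_iff.1 x.2 V hVo hx
  refine ⟨k, ?_⟩
  rw [← hV]
  exact hyV

lemma denseRange_orb : DenseRange W.orb := by
  intro x
  rw [mem_closure_iff_nhds]
  intro U hU
  obtain ⟨N, hN⟩ := W.exists_cylinder_subset hU
  obtain ⟨k, hk⟩ := W.exists_orb_mem_cylinder N x
  exact ⟨_, hN hk, k, rfl⟩

variable {W} in
lemma cylinder_subset_of_mem {N M : ℕ} (hNM : N ≤ M) {x y : W.flow.X}
    (h : x ∈ W.cylinder N y) : W.cylinder M x ⊆ W.cylinder N y := fun z hz i hi => by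
  rw [hz i (hi.trans (by exact_mod_cast hNM)), h i hi]

/-- Cylinders of some fixed window refine any open cover. -/
lemma exists_cylinder_subset_cover {U : W.flow.X → Set W.flow.X} (hU : ∀ x, U x ∈ nhds x) :
    ∃ N, ∀ y, ∃ x, W.cylinder N y ⊆ U x := by
  choose N hN using fun x => W.exists_cylinder_subset (hU x)
  obtain ⟨t, ht⟩ := isCompact_univ.elim_finite_subcover (fun x => W.cylinder (N x) x)
    (fun x => W.isOpen_cylinder _ x) fun x _ => Set.mem_iUnion.2 ⟨x, W.self_mem_cylinder _ x⟩
  refine ⟨∑ x ∈ t, N x, fun y => ?_⟩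
  obtain ⟨x, hx⟩ := Set.mem_iUnion.1 (ht (Set.mem_univ y))
  obtain ⟨hxt, hyx⟩ := Set.mem_iUnion.1 hx
  exact ⟨x, (cylinder_subset_of_mem
    (Finset.single_le_sum (f := N) (fun _ _ => Nat.zero_le _) hxt) hyx).trans (hN x)⟩

lemma exists_dist_lt {M : Type*} [PseudoMetricSpace M] (f : C(W.flow.X, M)) {ε : ℝ} (hε : 0 < ε) :
    ∃ N, ∀ k k', W.Agree N k k' → dist (f (W.orb k)) (f (W.orb k')) < ε := by
  obtain ⟨N, hN⟩ := W.exists_cylinder_subset_cover (U := fun x => f ⁻¹' Metric.ball (f x) (ε / 2))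
    fun x => f.continuous.continuousAt.preimage_mem_nhds (Metric.ball_mem_nhds _ (half_pos hε))
  refine ⟨N, fun k k' h => ?_⟩
  obtain ⟨x, hx⟩ := hN (W.orb k')
  have h1 := hx (W.orb_mem_cylinder_orb.2 h)
  have h2 := hx (W.self_mem_cylinder N _)
  simp only [Set.mem_preimage, Metric.mem_ball] at h1 h2
  rw [dist_comm] at h2
  have := dist_triangle (f (W.orb k)) (f x) (f (W.orb k'))
  linarith

/-- A function on `ℤ` which only depends on the place in the words of level `n`. -/
def Adapted {β : Type*} (n : ℕ) (h : ℤ → β) : Prop := ∀ k k', W.SamePlace n k k' → h k = h k'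

variable {W} in
lemma Adapted.mono {β : Type*} {n m : ℕ} (hnm : n ≤ m) {h : ℤ → β} (hh : W.Adapted n h) :
    W.Adapted m h := fun k k' hk => hh k k' (hk.of_le hnm)

lemma exists_adapted (f : C(W.flow.X, ℤ)) : ∃ n, W.Adapted n fun k => f (W.orb k) := by
  obtain ⟨N, hN⟩ := W.exists_dist_lt f one_pos
  refine ⟨N + 1, fun k k' h => ?_⟩
  have h1 := hN k k' (h.agree (W.lt_q N))
  rw [Int.dist_eq'] at h1
  have h2 : |f (W.orb k) - f (W.orb k')| < 1 := by exact_mod_cast h1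
  rw [Int.abs_lt_one_iff] at h2
  exact sub_eq_zero.1 h2

/-- Functions depending on a bounded window extend continuously from the orbit. -/
lemma exists_extension_of_agree {β : Type*} [TopologicalSpace β] (h : ℤ → β) (N : ℕ)
    (hh : ∀ k k', W.Agree N k k' → h k = h k') :
    ∃ f : C(W.flow.X, β), (∀ k, f (W.orb k) = h k) ∧ ∀ x, ∃ k, f x = h k := by
  choose κ hκ using W.exists_orb_mem_cylinder N
  have hloc : ∀ x y, y ∈ W.cylinder N x → h (κ y) = h (κ x) := fun x y hy =>
    hh _ _ fun i hi => by
      have h1 := hκ x i hi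
      have h2 := hκ y i hi
      rw [coord_orb] at h1 h2
      rw [add_comm, h2, hy i hi, ← h1, add_comm]
  refine ⟨⟨fun x => h (κ x), continuous_iff_continuousAt.2 fun x => ?_⟩, fun k => ?_,
    fun x => ⟨_, rfl⟩⟩
  · refine continuousAt_const.congr (f := fun _ => h (κ x)) ?_
    filter_upwards [(W.isOpen_cylinder N x).mem_nhds (W.self_mem_cylinder N x)] with y hy
    exact (hloc x y hy).symm
  · exact hh _ _ (W.orb_mem_cylinder_orb.1 (hκ _))

variable {W} in
lemma Adapted.exists_extension {β : Type*} [TopologicalSpace β] {n : ℕ} {h : ℤ → β}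
    (hh : W.Adapted n h) :
    ∃ f : C(W.flow.X, β), (∀ k, f (W.orb k) = h k) ∧ ∀ x, ∃ k, f x = h k := by
  obtain ⟨N, hN⟩ := W.exists_samePlace_of_agree n
  exact W.exists_extension_of_agree h N fun k k' hk => hh k k' (hN k k' hk)

lemma eq_of_forall_orb {β : Type*} [TopologicalSpace β] [T2Space β] {f g : C(W.flow.X, β)}
    (h : ∀ k, f (W.orb k) = g (W.orb k)) : f = g :=
  DFunLike.coe_injective (W.denseRange_orb.equalizer f.continuous g.continuous (funext h))

end WordSystem

namespace WordSystem

open Finset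

lemma sum_range_mul_eq {M : Type*} [AddCommMonoid M] (f : ℕ → M) (a b : ℕ) :
    ∑ j ∈ range (a * b), f j = ∑ i ∈ range b, ∑ j ∈ range a, f (a * i + j) := by
  induction b with
  | zero => simp
  | succ b ih => rw [Nat.mul_succ, sum_range_add, ih, sum_range_succ]

variable (W : WordSystem)

lemma samePlace_mul_add {n : ℕ} {m m' : ℤ} (h : W.η n m = W.η n m') (i : ℤ) (h0 : 0 ≤ i)
    (hi : i < W.q n) : W.SamePlace n (W.q n * m + i) (W.q n * m' + i) := by
  have hq := W.q_pos n
  have h1 : ∀ m : ℤ, (W.q n * m + i) / W.q n = m := fun m => by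
    rw [Int.mul_add_ediv_left _ _ (by omega), Int.ediv_eq_zero_of_lt h0 hi, add_zero]
  refine ⟨by rw [h1, h1, h], ?_⟩
  rw [Int.mul_add_emod_self_left, Int.mul_add_emod_self_left]

/-- The sum of a function on `ℤ` over an occurrence of the word of a letter. -/
noncomputable def blockSum (n : ℕ) (h : ℤ → ℤ) (a : W.A n) : ℤ :=
  ∑ j ∈ range (W.q n), h (W.q n * (W.exists_η_eq n a).choose + j)

lemma blockSum_add (n : ℕ) (h h' : ℤ → ℤ) (a : W.A n) :
    W.blockSum n (h + h') a = W.blockSum n h a + W.blockSum n h' a := by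
  simp [blockSum, sum_add_distrib]

variable {W}

lemma Adapted.add {n : ℕ} {h h' : ℤ → ℤ} (hh : W.Adapted n h) (hh' : W.Adapted n h') :
    W.Adapted n (h + h') := fun k k' hk => by simp [hh k k' hk, hh' k k' hk]

lemma Adapted.blockSum_η {n : ℕ} {h : ℤ → ℤ} (hh : W.Adapted n h) (m : ℤ) :
    W.blockSum n h (W.η n m) = ∑ j ∈ range (W.q n), h (W.q n * m + j) := by
  refine sum_congr rfl fun j hj => hh _ _ (W.samePlace_mul_add ?_ _ (by omega) ?_)
  · exact (W.exists_η_eq n _).choose_spec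
  · exact_mod_cast mem_range.1 hj

lemma Adapted.blockSum_succ {n : ℕ} {h : ℤ → ℤ} (hh : W.Adapted n h) (b : W.A (n + 1)) :
    W.blockSum (n + 1) h b = ∑ i ∈ range (W.r n), W.blockSum n h (W.σ n b i) := by
  obtain ⟨m, rfl⟩ := W.exists_η_eq (n + 1) b
  rw [(hh.mono (Nat.le_succ n)).blockSum_η, q_succ, sum_range_mul_eq]
  refine sum_congr rfl fun i hi => ?_
  rw [← W.η_mul_add n m i (mem_range.1 hi), hh.blockSum_η]
  refine sum_congr rfl fun j _ => congr_arg h ?_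
  push_cast
  ring

section Total

variable {G : Type*} [AddCommGroup G] [PartialOrder G] {u : G} {g : ∀ n, W.A n → G}

/-- The value in `G` of an adapted function. -/
noncomputable def total (g : ∀ n, W.A n → G) (n : ℕ) (h : ℤ → ℤ) : G :=
  ∑ a, W.blockSum n h a • g n a

lemma Adapted.total_eq (hg : W.IsDimensionData u g) {n m : ℕ} (hnm : n ≤ m) {h : ℤ → ℤ}
    (hh : W.Adapted n h) : total g m h = total g n h := by
  induction m, hnm using Nat.le_induction with
  | base => rfl
  | succ m hnm ih =>
    rw [← ih, total, total, hg.compat m]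
    exact sum_congr rfl fun b _ => by rw [(hh.mono hnm).blockSum_succ]

lemma Adapted.total_eq_total (hg : W.IsDimensionData u g) {n m : ℕ} {h : ℤ → ℤ}
    (hn : W.Adapted n h) (hm : W.Adapted m h) : total g n h = total g m h := by
  rw [← hn.total_eq hg (le_max_left n m), hm.total_eq hg (le_max_right n m)]

/-- The homomorphism from continuous functions to the dimension group. -/
noncomputable def toGroup (hg : W.IsDimensionData u g) : C(W.flow.X, ℤ) →+ G :=
  AddMonoidHom.mk' (fun f => total g (W.exists_adapted f).choose fun k => f (W.orb k))
    fun f f' => by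
      have h1 := (W.exists_adapted f).choose_spec
      have h2 := (W.exists_adapted f').choose_spec
      have h3 := (h1.mono (le_max_left _ (W.exists_adapted f').choose)).add
        (h2.mono (le_max_right (W.exists_adapted f).choose _))
      rw [(W.exists_adapted (f + f')).choose_spec.total_eq_total hg h3,
        ← h1.total_eq hg (le_max_left _ _), ← h2.total_eq hg (le_max_right _ _), total, total,
        total, ← sum_add_distrib]
      refine sum_congr rfl fun a _ => ?_
      rw [← add_smul, ← blockSum_add]
      rfl

lemma toGroup_eq (hg : W.IsDimensionData u g) {n : ℕ} {h : ℤ → ℤ} (hh : W.Adapted n h)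
    {f : C(W.flow.X, ℤ)} (hf : ∀ k, f (W.orb k) = h k) : toGroup hg f = total g n h := by
  obtain rfl : (fun k => f (W.orb k)) = h := funext hf
  exact (W.exists_adapted f).choose_spec.total_eq_total hg hh

lemma toGroup_one (hg : W.IsDimensionData u g) : toGroup hg 1 = u := by
  rw [toGroup_eq hg (n := 0) (h := fun _ => 1) (fun _ _ _ => rfl) fun _ => rfl, total, ← hg.unit]
  simp [blockSum, q_zero]

lemma toGroup_nonneg [IsOrderedAddMonoid G] (hg : W.IsDimensionData u g) {f : C(W.flow.X, ℤ)}
    (hf : ∀ x, 0 ≤ f x) : 0 ≤ toGroup hg f := by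
  obtain ⟨n, hn⟩ := W.exists_adapted f
  rw [toGroup_eq hg hn fun _ => rfl]
  refine sum_nonneg fun a _ => ?_
  exact zsmul_nonneg (hg.nonneg n a) (sum_nonneg fun _ _ => hf _)

lemma exists_toGroup_eq (hg : W.IsDimensionData u g) {p : G} (hp : 0 ≤ p) :
    ∃ f : C(W.flow.X, ℤ), (∀ x, 0 ≤ f x) ∧ toGroup hg f = p := by
  obtain ⟨n, N, rfl⟩ := hg.exists_combination p hp
  let h : ℤ → ℤ := fun k => if k % W.q n = 0 then N (W.η n (k / W.q n)) else 0
  have hh : W.Adapted n h := fun k k' hk => by simp only [h, hk.1, hk.2]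
  obtain ⟨f, hf, hf'⟩ := hh.exists_extension
  refine ⟨f, fun x => ?_, ?_⟩
  · obtain ⟨k, hk⟩ := hf' x
    rw [hk]
    simp only [h]
    split_ifs <;> omega
  rw [toGroup_eq hg hh hf]
  refine sum_congr rfl fun a _ => ?_
  obtain ⟨m, rfl⟩ := W.exists_η_eq n a
  rw [hh.blockSum_η, sum_eq_single_of_mem 0 (mem_range.2 (W.q_pos n)) fun j hj hj0 => ?_]
  · have := W.q_pos n
    simp only [h]
    rw [Nat.cast_zero, add_zero, if_pos (Int.mul_emod_right _ _),
      Int.mul_ediv_cancel_left _ (by omega), natCast_zsmul]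
  · simp only [h]
    rw [if_neg]
    rw [Int.mul_add_emod_self_left, Int.emod_eq_of_lt (by omega) (by exact_mod_cast mem_range.1 hj)]
    omega

lemma toGroup_surjective (hg : W.IsDimensionData u g)
    (hG : ∀ x : G, ∃ a b, 0 ≤ a ∧ 0 ≤ b ∧ x = a - b) : Function.Surjective (toGroup hg) := by
  intro x
  obtain ⟨a, b, ha, hb, rfl⟩ := hG x
  obtain ⟨f, -, rfl⟩ := exists_toGroup_eq hg ha
  obtain ⟨f', -, rfl⟩ := exists_toGroup_eq hg hb
  exact ⟨f - f', map_sub _ _ _⟩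

/-- Adapted functions with vanishing block sums are coboundaries. -/
lemma Adapted.exists_primitive {n : ℕ} {h : ℤ → ℤ} (hh : W.Adapted n h)
    (h0 : ∀ a, W.blockSum n h a = 0) :
    ∃ H : ℤ → ℤ, W.Adapted n H ∧ ∀ k, h k = H (k + 1) - H k := by
  have hq := W.q_pos n
  have hq' : (0 : ℤ) < W.q n := by omega
  let H : ℤ → ℤ := fun k => ∑ j ∈ range (k % W.q n).toNat, h (W.q n * (k / W.q n) + j)
  refine ⟨H, fun k k' hk => ?_, fun k => ?_⟩
  · simp only [H, hk.2]
    refine sum_congr rfl fun j hj => hh _ _ (W.samePlace_mul_add hk.1 _ (by omega) ?_)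
    have := mem_range.1 hj
    have := Int.emod_lt_of_pos k' hq'
    omega
  · obtain ⟨m, j, hj, rfl⟩ : ∃ (m : ℤ) (j : ℕ), j < W.q n ∧ k = W.q n * m + j := by
      have h1 := Int.emod_lt_of_pos k hq'
      have h2 := Int.emod_nonneg k hq'.ne'
      have h3 := Int.mul_ediv_add_emod k (W.q n)
      refine ⟨k / W.q n, (k % W.q n).toNat, by omega, by omega⟩
    have hH : ∀ (m : ℤ) (j : ℕ), j < W.q n →
        H (W.q n * m + j) = ∑ i ∈ range j, h (W.q n * m + i) := fun m j hj => by
      simp only [H]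
      rw [Int.mul_add_ediv_left _ _ hq'.ne', Int.mul_add_emod_self_left,
        Int.ediv_eq_zero_of_lt (by omega) (by omega), Int.emod_eq_of_lt (by omega) (by omega),
        add_zero, Int.toNat_natCast]
    have hs := sum_range_succ (fun i : ℕ => h (W.q n * m + i)) j
    rw [hH m j hj]
    rcases (Nat.succ_le_of_lt hj).lt_or_eq with hj' | hj'
    · have := hH m (j + 1) hj'
      push_cast at this
      rw [add_assoc, this, hs]
      ring
    · have h1 := hH (m + 1) 0 hq
      have h2 : (W.q n : ℤ) * m + j + 1 = W.q n * (m + 1) + (0 : ℕ) := by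
        rw [← hj']; push_cast; ring
      rw [h2, h1, range_zero, sum_empty]
      rw [Nat.succ_eq_add_one] at hj'
      rw [hj', ← hh.blockSum_η, h0] at hs
      linarith

lemma Adapted.comp_add_one {n : ℕ} {h : ℤ → ℤ} (hh : W.Adapted n h) :
    ∃ m, W.Adapted m fun k => h (k + 1) := by
  obtain ⟨f, hf, -⟩ := hh.exists_extension
  obtain ⟨m, hm⟩ := W.exists_adapted (f.comp (W.flow.T : C(W.flow.X, W.flow.X)))
  refine ⟨m, fun k k' hk => ?_⟩
  have := hm k k' hk
  simp only [ContinuousMap.comp_apply, ContinuousMap.coe_coe, T_orb, hf] at this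
  exact this

lemma toGroup_eq_zero_iff (hg : W.IsDimensionData u g) (f : C(W.flow.X, ℤ)) :
    toGroup hg f = 0 ↔ f ∈ coboundaries W.flow.T := by
  constructor
  · intro h0
    obtain ⟨n, hn⟩ := W.exists_adapted f
    rw [toGroup_eq hg hn fun _ => rfl, total] at h0
    have h1 := hg.kill n _ h0
    obtain ⟨H, hH, hH'⟩ := (hn.mono (Nat.le_succ n)).exists_primitive fun b => by
      rw [hn.blockSum_succ, h1]
    obtain ⟨m, hm⟩ := hH.comp_add_one
    obtain ⟨γ, hγ, -⟩ := hm.exists_extension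
    refine ⟨γ, W.eq_of_forall_orb fun k => ?_⟩
    change γ (W.orb k) - γ (W.flow.T.symm (W.orb k)) = f (W.orb k)
    rw [T_symm_orb, hγ, hγ, hH' k, sub_add_cancel]
  · rintro ⟨γ, rfl⟩
    obtain ⟨n, hn⟩ := W.exists_adapted γ
    obtain ⟨m, hm⟩ := W.exists_adapted (coboundaryHom W.flow.T γ)
    have hm' := hm.mono (le_max_right (n + 1) m)
    rw [toGroup_eq hg hm' fun _ => rfl, total]
    refine sum_eq_zero fun b _ => ?_
    obtain ⟨k, rfl⟩ := W.exists_η_eq _ b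
    set M := max (n + 1) m
    have hq := W.q_pos M
    have h1 : ∀ k : ℤ, coboundaryHom W.flow.T γ (W.orb k) =
        γ (W.orb k) - γ (W.orb (k - 1)) := fun k => by rw [← T_symm_orb]; rfl
    have h2 := sum_range_sub (fun j : ℕ => γ (W.orb (W.q M * k + j - 1))) (W.q M)
    rw [hm'.blockSum_η]
    simp only [h1]
    convert zero_smul ℤ _
    refine Eq.trans (sum_congr rfl fun j _ => ?_) (h2.trans ?_)
    · congr 3
      push_cast
      ring
    · obtain ⟨l, hl⟩ : ∃ l, M = l + 1 := ⟨M - 1, by omega⟩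
      have hn' := hn.mono (show n ≤ l by omega)
      have hql := W.q_pos l
      rw [sub_eq_zero]
      have := hn' _ _ (W.samePlace_mul_add (n := l) (m := W.r l * (k + 1) - 1)
        (m' := W.r l * k - 1) (by rw [η_mul_sub_one, η_mul_sub_one]) (W.q l - 1) (by omega)
        (by omega))
      rw [hl, q_succ]
      push_cast
      convert this using 3 <;> ring

end Total

end WordSystem

namespace WordSystem

open Finset

/-- A complex number all of whose powers are close to `1` is equal to `1`. -/
lemma eq_one_of_forall_norm_pow_sub_one_lt {z : ℂ} (h : ∀ m : ℕ, ‖z ^ m - 1‖ < 1 / 2) : z = 1 := by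
  by_contra hz
  have hd : 0 < ‖z - 1‖ := norm_pos_iff.2 (sub_ne_zero.2 hz)
  have key : ∀ m : ℕ, (3 / 2 : ℝ) ^ m * ‖z - 1‖ ≤ ‖z ^ 2 ^ m - 1‖ := fun m => by
    induction m with
    | zero => simp
    | succ m ih =>
      have h1 : z ^ 2 ^ (m + 1) - 1 = (z ^ 2 ^ m - 1) * (2 + (z ^ 2 ^ m - 1)) := by ring
      have h2 : (3 / 2 : ℝ) ≤ ‖2 + (z ^ 2 ^ m - 1)‖ := by
        have := norm_sub_le_norm_add (2 : ℂ) (z ^ 2 ^ m - 1)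
        rw [Complex.norm_ofNat] at this
        linarith [h (2 ^ m)]
      rw [h1, norm_mul, pow_succ]
      nlinarith [norm_nonneg (z ^ 2 ^ m - 1)]
  obtain ⟨m, hm⟩ := pow_unbounded_of_one_lt (1 / ‖z - 1‖) (show (1 : ℝ) < 3 / 2 by norm_num)
  rw [div_lt_iff₀ hd] at hm
  linarith [key m, h (2 ^ m)]

variable (W : WordSystem)

lemma exists_pow_q_eq_one {lam : ℂ} {f : C(W.flow.X, ℂ)} (hf : f ≠ 0)
    (h : ∀ x, f (W.flow.T x) = lam * f x) : ∃ n, lam ^ W.q n = 1 := by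
  have hpow : ∀ (m : ℕ) k, f (W.orb (k + m)) = lam ^ m * f (W.orb k) := fun m k => by
    induction m with
    | zero => simp
    | succ m ih => rw [Nat.cast_succ, ← add_assoc, ← T_orb, h, ih, pow_succ]; ring
  have hf0 : f (W.orb 0) ≠ 0 := fun h0 => hf <| W.eq_of_forall_orb fun k => by
    rcases le_total 0 k with hk | hk
    · obtain ⟨m, rfl⟩ := Int.eq_ofNat_of_zero_le hk
      have := hpow m 0
      rw [zero_add] at this
      rw [this, h0, mul_zero]
      rfl
    · obtain ⟨m, hm⟩ := Int.eq_ofNat_of_zero_le (neg_nonneg.2 hk)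
      have hlam : lam ≠ 0 := by
        rintro rfl
        refine hf (W.eq_of_forall_orb fun k => ?_)
        rw [← sub_add_cancel k 1, ← T_orb, h, zero_mul]
        rfl
      have := hpow m k
      rw [← hm, add_neg_cancel, h0, zero_eq_mul] at this
      exact this.resolve_left (pow_ne_zero _ hlam)
  obtain ⟨N, hN⟩ := W.exists_dist_lt f (half_pos (norm_pos_iff.2 hf0))
  refine ⟨N + 1, eq_one_of_forall_norm_pow_sub_one_lt fun m => ?_⟩
  have h1 := hN _ _ (W.agree_zero_mul (W.lt_q N) m)
  have h2 := hpow (W.q (N + 1) * m) 0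
  rw [zero_add, Nat.cast_mul, mul_comm (W.q (N + 1) : ℤ)] at h2
  rw [h2, dist_eq_norm, ← sub_one_mul, norm_mul, pow_mul] at h1
  have := norm_pos_iff.2 hf0
  nlinarith

variable {G : Type*} [AddCommGroup G] [PartialOrder G] {u : G} {g : ∀ n, W.A n → G}

variable {W} in
lemma IsDimensionData.q_smul_sum (hg : W.IsDimensionData u g) (n : ℕ) :
    W.q n • ∑ a, g n a = u := by
  induction n with
  | zero => rw [q_zero, one_smul, hg.unit]
  | succ n ih =>
    have := hg.compat n fun _ => 1
    simp only [one_smul, sum_const, card_range, nsmul_one] at this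
    rw [← ih, this, q_succ, mul_smul, smul_sum]
    simp

lemma exists_eigenfunction {p n : ℕ} (hp : p ∣ W.q n) {z : ℂ} (hz : z ^ p = 1) :
    ∃ f : C(W.flow.X, ℂ), f ≠ 0 ∧ ∀ x, f (W.flow.T x) = z * f x := by
  have hq := W.q_pos n
  have hzq : z ^ W.q n = 1 := by
    obtain ⟨c, hc⟩ := hp
    rw [hc, pow_mul, hz, one_pow]
  have hz0 : z ≠ 0 := by
    rintro rfl
    rw [zero_pow hq.ne'] at hzq
    exact zero_ne_one hzq
  have hh : W.Adapted n fun k => z ^ k := fun k k' hk => by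
    have h1 : ∀ k : ℤ, z ^ k = z ^ (k % W.q n) := fun k => by
      conv_lhs => rw [← Int.mul_ediv_add_emod k (W.q n)]
      rw [zpow_add₀ hz0, zpow_mul, zpow_natCast, hzq, one_zpow, one_mul]
    exact (h1 k).trans (by rw [hk.2, ← h1])
  obtain ⟨f, hf, -⟩ := hh.exists_extension
  refine ⟨f, fun h0 => ?_, fun x => ?_⟩
  · have := hf 0
    rw [h0, zpow_zero] at this
    exact zero_ne_one this
  · have := W.eq_of_forall_orb (f := f.comp (W.flow.T : C(W.flow.X, W.flow.X)))
      (g := ContinuousMap.const _ z * f) fun k => by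
        simp only [ContinuousMap.comp_apply, ContinuousMap.coe_coe, T_orb, hf,
          ContinuousMap.mul_apply, ContinuousMap.const_apply]
        rw [zpow_add_one₀ hz0, mul_comm]
    exact DFunLike.congr_fun this x

variable {W} in
lemma exists_eigenfunction_iff (hg : W.IsDimensionData u g) {p : ℤ} (hp : 2 ≤ p) :
    (∃ f : C(W.flow.X, ℂ), f ≠ 0 ∧
      ∀ x, f (W.flow.T x) = Complex.exp (2 * Real.pi * Complex.I / p) * f x) ↔
    ∃ w : G, p • w = u := by
  lift p to ℕ using by omega
  have hroot := Complex.isPrimitiveRoot_exp p (by omega)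
  simp only [natCast_zsmul, Int.cast_natCast]
  constructor
  · rintro ⟨f, hf, h⟩
    obtain ⟨n, hn⟩ := W.exists_pow_q_eq_one hf h
    obtain ⟨c, hc⟩ := hroot.dvd_of_pow_eq_one _ hn
    refine ⟨c • ∑ a, g n a, ?_⟩
    rw [← mul_smul, ← hc, hg.q_smul_sum]
  · intro hw
    obtain ⟨n, hn⟩ := hg.dvd p (by omega) hw
    exact W.exists_eigenfunction hn hroot.pow_eq_one

end WordSystem

namespace WordSystem

open Dynamics Filter Topology Uniformity ExpGrowth

variable (W : WordSystem)

/-- The pairs of points with the same coordinates in the window `[-N, N]`. -/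
def windowRel (N : ℕ) : SetRel W.flow.X W.flow.X :=
  {p | ∀ i : ℤ, |i| ≤ N → W.coord p.1 i = W.coord p.2 i}

lemma windowRel_mem_uniformity (N : ℕ) : W.windowRel N ∈ 𝓤 W.flow.X := by
  rw [compactSpace_uniformity]
  refine mem_iSup.2 fun x => ?_
  have h := (W.isOpen_cylinder N x).mem_nhds (W.self_mem_cylinder N x)
  filter_upwards [prod_mem_nhds h h] with p hp i hi
  exact (hp.1 i hi).trans (hp.2 i hi).symm

lemma hasBasis_windowRel : (𝓤 W.flow.X).HasBasis (fun _ : ℕ => True) W.windowRel := by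
  refine ⟨fun V => ⟨fun hV => ?_, fun ⟨N, _, hN⟩ => mem_of_superset
    (W.windowRel_mem_uniformity N) hN⟩⟩
  obtain ⟨V', hV', hsymm, hcomp⟩ := comp_symm_mem_uniformity_sets hV
  obtain ⟨N, hN⟩ := W.exists_cylinder_subset_cover fun x => UniformSpace.ball_mem_nhds x hV'
  refine ⟨N, trivial, fun p hp => ?_⟩
  obtain ⟨x, hx⟩ := hN p.1
  have h1 : (x, p.1) ∈ V' := hx (W.self_mem_cylinder N p.1)
  have h2 : (x, p.2) ∈ V' := hx fun i hi => (hp i hi).symm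
  exact hcomp ⟨x, hsymm.symm _ _ h1, h2⟩

lemma coord_T_iterate (x : W.flow.X) (i : ℤ) (j : ℕ) :
    W.coord (W.flow.T^[j] x) i = W.coord x (i + j) := by
  induction j generalizing x with
  | zero => simp
  | succ j ih => rw [Function.iterate_succ_apply, ih, coord_T]; congr 1; push_cast; ring

/-- The code at level `m` of the `c` words which follow the place `k`. -/
noncomputable def code (m c : ℕ) (k : ℤ) : Fin (W.q m) × (Fin c → W.A m) :=
  (⟨(k % W.q m).toNat, by
    have hq := W.q_pos m
    have := Int.emod_lt_of_pos k (show (0 : ℤ) < W.q m by omega)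
    omega⟩, fun i => W.η m (k / W.q m + i))

lemma η_eq_of_code_eq {m c : ℕ} {k k' : ℤ} (h : W.code m c k = W.code m c k') {i : ℕ}
    (hi : i + W.q m ≤ W.q m * c) : W.η 0 (k + i) = W.η 0 (k' + i) := by
  have hq := W.q_pos m
  have hq' : (0 : ℤ) < W.q m := by omega
  obtain ⟨h1, h2⟩ := Prod.mk.inj h
  have p0 := Int.emod_nonneg k hq'.ne'
  have p1 := Int.emod_nonneg k' hq'.ne'
  have p2 := Int.emod_lt_of_pos k hq'
  have h1' : k % W.q m = k' % W.q m := by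
    have := Fin.mk.inj h1
    omega
  have key : ∀ k : ℤ, (k + i) / W.q m = k / W.q m + (k % W.q m + i) / W.q m := fun k => by
    conv_lhs => rw [← Int.mul_ediv_add_emod k (W.q m), add_assoc]
    rw [Int.mul_add_ediv_left _ _ hq'.ne']
  refine W.η_zero_eq_of_η_eq m ⟨?_, ?_⟩
  · rw [key k, key k', ← h1']
    have d0 : 0 ≤ (k % W.q m + i) / (W.q m : ℤ) := Int.ediv_nonneg (by omega) hq'.le
    have d1 : (k % W.q m + i) / (W.q m : ℤ) < c := by
      rw [Int.ediv_lt_iff_lt_mul hq', mul_comm]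
      have : ((i + W.q m : ℕ) : ℤ) ≤ (W.q m * c : ℕ) := by exact_mod_cast hi
      push_cast at this
      omega
    obtain ⟨d, hd⟩ := Int.eq_ofNat_of_zero_le d0
    rw [hd] at d1 ⊢
    exact congr_fun h2 ⟨d, by omega⟩
  · rw [Int.add_emod, h1', ← Int.add_emod]

lemma exists_dynCover (m N n c : ℕ) (hc : n + 2 * N + W.q m ≤ W.q m * c) :
    ∃ s : Finset W.flow.X, IsDynCoverOf W.flow.T Set.univ (W.windowRel N) n s ∧
      s.card ≤ W.q m * Fintype.card (W.A m) ^ c := by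
  classical
  let κ := Function.invFun (W.code m c)
  have hκ : ∀ k, W.code m c (κ (W.code m c k)) = W.code m c k := fun k =>
    Function.invFun_eq ⟨k, rfl⟩
  refine ⟨Finset.univ.image fun v => W.orb (κ v + N), fun x _ => ?_, ?_⟩
  · obtain ⟨k, hk⟩ := W.exists_orb_mem_cylinder (N + n) x
    refine ⟨W.orb (κ (W.code m c (k - N)) + N), by simp, ?_⟩
    rw [mem_dynEntourage]
    intro j hj i hi
    change W.coord (W.flow.T^[j] x) i = W.coord (W.flow.T^[j] _) i
    rw [abs_le] at hi
    rw [coord_T_iterate, coord_T_iterate, ← hk (i + j) (by rw [abs_le]; push_cast; omega),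
      coord_orb, coord_orb]
    have := W.η_eq_of_code_eq (hκ (k - N)) (i := (i + j + N).toNat) (by omega)
    rw [Int.toNat_of_nonneg (by omega)] at this
    convert this.symm using 2 <;> ring
  · refine Finset.card_image_le.trans ?_
    simp

lemma coverEntropyEntourage_windowRel_le {m : ℕ} {a : ℝ} (ha : 0 ≤ a)
    (h : (Fintype.card (W.A m) : ℝ) ≤ Real.exp (a * W.q m)) (N : ℕ) :
    coverEntropyEntourage W.flow.T Set.univ (W.windowRel N) ≤ a := by
  have hq := W.q_pos m
  set K := 2 * N + 2 * W.q m
  rw [← expGrowthSup_exp (a := (a : EReal))]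
  refine expGrowthSup_le_of_eventually_le
    (b := ENNReal.ofReal (W.q m * Real.exp (a * K))) ENNReal.ofReal_ne_top
    (Eventually.of_forall fun n => ?_)
  set c := (n + 2 * N) / W.q m + 2
  have hc1 := Nat.div_add_mod (n + 2 * N) (W.q m)
  have hc2 := Nat.mod_lt (n + 2 * N) hq
  have hc : W.q m * c = W.q m * ((n + 2 * N) / W.q m) + 2 * W.q m := by ring
  obtain ⟨s, hs, hcard⟩ := W.exists_dynCover m N n c (by omega)
  have h1 : (s.card : ℝ) ≤ W.q m * Real.exp (a * K) * Real.exp (a * n) := by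
    have h2 : (s.card : ℝ) ≤ W.q m * (Fintype.card (W.A m) : ℝ) ^ c := by exact_mod_cast hcard
    refine h2.trans ?_
    rw [mul_assoc, ← Real.exp_add]
    refine mul_le_mul_of_nonneg_left ?_ (Nat.cast_nonneg _)
    refine (pow_le_pow_left₀ (Nat.cast_nonneg _) h c).trans ?_
    rw [← Real.exp_nat_mul, Real.exp_le_exp]
    have h3 : ((W.q m * c : ℕ) : ℝ) ≤ (K + n : ℕ) := by exact_mod_cast (by omega)
    push_cast at h3 ⊢
    nlinarith
  have h4 : ((coverMincard W.flow.T Set.univ (W.windowRel N) n : ℕ∞) : ENNReal) ≤ s.card := by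
    exact_mod_cast hs.coverMincard_le_card
  refine h4.trans ?_
  rw [show ((a : EReal) * (n : EReal)) = ((a * n : ℝ) : EReal) by push_cast; rfl, EReal.exp_coe,
    ← ENNReal.ofReal_mul (by positivity), ← ENNReal.ofReal_natCast]
  exact ENNReal.ofReal_le_ofReal h1

lemma exists_dynNet (n : ℕ) : ∃ s : Finset W.flow.X,
    IsDynNetIn W.flow.T Set.univ (W.windowRel 0) (W.q n) s ∧
      s.card = Fintype.card (W.A n) := by
  classical
  choose κ hκ using W.exists_η_eq n
  have key : ∀ a b, (∀ j < W.q n, W.coord (W.orb (W.q n * κ a)) j =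
      W.coord (W.orb (W.q n * κ b)) j) → a = b := fun a b h => by
    refine W.word_injective n a b fun i hi => ?_
    have := h i hi
    rw [coord_orb, coord_orb, add_comm, add_comm (i : ℤ), W.η_zero_eq_word n _ i hi,
      W.η_zero_eq_word n _ i hi, hκ, hκ] at this
    exact this
  have hinj : Function.Injective fun a => W.orb (W.q n * κ a) := fun a b h =>
    key a b fun j _ => by rw [show W.orb (W.q n * κ a) = W.orb (W.q n * κ b) from h]
  refine ⟨Finset.univ.image fun a => W.orb (W.q n * κ a), ⟨Set.subset_univ _, ?_⟩,
    Finset.card_image_of_injective _ hinj⟩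
  intro x hx y hy hxy
  simp only [Finset.coe_image, Finset.coe_univ, Set.image_univ, Set.mem_range] at hx hy
  obtain ⟨a, rfl⟩ := hx
  obtain ⟨b, rfl⟩ := hy
  refine Set.disjoint_left.2 fun z hza hzb => hxy ?_
  rw [key a b fun j hj => ?_]
  have h1 := mem_dynEntourage.1 hza j hj 0 (by simp)
  have h2 := mem_dynEntourage.1 hzb j hj 0 (by simp)
  simp only [coord_T_iterate, zero_add] at h1 h2
  exact h1.trans h2.symm

theorem entropy_flow {t : ℝ} (ht : 0 ≤ t)
    (hlow : ∀ n, Real.exp (t * W.q n) ≤ Fintype.card (W.A n))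
    (hupp : ∀ n : ℕ, (Fintype.card (W.A (n + 1)) : ℝ) ≤
      Real.exp ((t + 1 / (n + 1)) * W.q (n + 1))) : W.flow.entropy = t := by
  refine le_antisymm ?_ ?_
  · rw [ToeplitzFlow.entropy, coverEntropy_eq_iSup_basis W.hasBasis_windowRel]
    refine iSup₂_le fun N _ => ?_
    have hlim : Tendsto (fun n : ℕ => ((t + 1 / (n + 1) : ℝ) : EReal)) atTop (𝓝 (t : EReal)) := by
      refine (continuous_coe_real_ereal.tendsto t).comp ?_
      simpa using tendsto_one_div_add_atTop_nhds_zero_nat.const_add t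
    exact ge_of_tendsto' hlim fun n =>
      W.coverEntropyEntourage_windowRel_le (by positivity) (hupp n) N
  · refine le_trans ?_ (netEntropyEntourage_le_coverEntropy _ _ (W.windowRel_mem_uniformity 0))
    refine Frequently.le_expGrowthSup (frequently_atTop.2 fun n => ⟨W.q n, (W.lt_q n).le, ?_⟩)
    obtain ⟨s, hs, hcard⟩ := W.exists_dynNet n
    have h1 : (s.card : ENNReal) ≤
        ((netMaxcard W.flow.T Set.univ (W.windowRel 0) (W.q n) : ℕ∞) : ENNReal) := by
      exact_mod_cast hs.card_le_netMaxcard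
    refine le_trans ?_ h1
    rw [show ((t : EReal) * (W.q n : EReal)) = ((t * W.q n : ℝ) : EReal) by push_cast; rfl,
      EReal.exp_coe, hcard, ← ENNReal.ofReal_natCast]
    exact ENNReal.ofReal_le_ofReal (hlow n)

end WordSystem

/-- The rational multiples of `u` have unbounded denominators if they form a noncyclic group. -/
lemma exists_large_nsmul_eq {G : Type*} [AddCommGroup G] {u : G}
    (hinj : ∀ (n : ℕ) (a b : G), 0 < n → n • a = n • b → a = b)
    (hQ : ¬ ∃ g ∈ rationalSubgroup G u, ∀ x ∈ rationalSubgroup G u, ∃ n : ℤ, x = n • g) (N : ℕ) :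
    ∃ q, N ≤ q ∧ ∃ g : G, q • g = u := by
  by_contra! hb
  let p : ℕ → Prop := fun q => ∃ g : G, q • g = u
  classical
  have hlt : ∀ q, p q → q ≤ N := fun q ⟨g, hg⟩ => by
    by_contra! h
    exact hb q h.le g hg
  have h1 : p 1 := ⟨u, one_smul _ _⟩
  obtain ⟨g, hg⟩ : p (Nat.findGreatest p N) := Nat.findGreatest_spec (hlt 1 h1) h1
  have hmax : ∀ q, p q → q ≤ Nat.findGreatest p N := fun q hq => Nat.le_findGreatest (hlt q hq) hq
  set q := Nat.findGreatest p N
  have hq : 0 < q := hmax 1 h1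
  refine hQ ⟨g, ⟨q, by omega, 1, by rw [natCast_zsmul, hg, one_smul]⟩, ?_⟩
  rintro x ⟨n, hn, m, hnm⟩
  lift n to ℕ using by omega
  obtain ⟨d, n', m', hd, hcop, rfl, rfl⟩ : ∃ (d n' : ℕ) (m' : ℤ), 0 < d ∧
      IsCoprime m' (n' : ℤ) ∧ n = d * n' ∧ m = d * m' := by
    have hd := Int.gcd_pos_of_ne_zero_right m (show (n : ℤ) ≠ 0 by omega)
    obtain ⟨m', n', hcop, hm, hn'⟩ := Int.exists_gcd_one hd
    have hn0 : 0 ≤ n' := by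
      by_contra! h
      nlinarith [show (0 : ℤ) < Int.gcd m n by exact_mod_cast hd]
    lift n' to ℕ using hn0
    refine ⟨Int.gcd m n, n', m', hd, Int.isCoprime_iff_gcd_eq_one.2 hcop, ?_, ?_⟩
    · zify
      rw [mul_comm]
      exact hn'
    · rw [mul_comm]
      exact hm
  have hn' : 0 < n' := Nat.pos_of_ne_zero (by rintro rfl; simp at hn)
  have hx : n' • x = m' • u := hinj d _ _ hd (by
    rw [← mul_smul, ← natCast_zsmul, hnm, mul_smul, natCast_zsmul])
  obtain ⟨a, b, hab⟩ := hcop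
  have hw : n' • (a • x + b • u) = u := by
    rw [smul_add, smul_comm, hx, ← natCast_zsmul, ← mul_smul, ← mul_smul, ← add_smul,
      mul_comm (n' : ℤ), hab, one_smul]
  obtain ⟨k, hk⟩ : n' ∣ q := by
    have h2 := hmax _ (exists_lcm_nsmul ⟨_, hw⟩ ⟨_, hg⟩)
    have h3 := Nat.le_of_dvd (Nat.lcm_pos hn' hq) (Nat.dvd_lcm_right n' q)
    rw [← le_antisymm h2 h3]
    exact Nat.dvd_lcm_left n' q
  refine ⟨m' * k, hinj n' _ _ hn' ?_⟩
  rw [hx, ← hg, hk, mul_smul n', mul_smul m', natCast_zsmul, smul_comm]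

namespace IsSimpleDimensionGroup

variable {G : Type*} [AddCommGroup G] {P : Set G}

/-- The order of a simple dimension group. -/
abbrev partialOrder (hG : IsSimpleDimensionGroup G P) : PartialOrder G where
  le a b := b - a ∈ P
  le_refl a := by rw [sub_self]; exact hG.zero_mem
  le_trans a b c hab hbc := by
    have := hG.add_mem _ _ hbc hab
    rwa [sub_add_sub_cancel] at this
  le_antisymm a b hab hba :=
    (sub_eq_zero.1 (hG.pos_neg_eq_zero _ hab (by rwa [neg_sub]))).symm

lemma isOrderedAddMonoid (hG : IsSimpleDimensionGroup G P) :
    @IsOrderedAddMonoid G _ hG.partialOrder.toPreorder :=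
  letI := hG.partialOrder
  { add_le_add_left := fun a b hab c => by
      change b + c - (a + c) ∈ P
      rw [add_sub_add_right_eq_sub]
      exact hab }

lemma simpleRieszGroup (hG : IsSimpleDimensionGroup G P) :
    @SimpleRieszGroup G _ hG.partialOrder := by
  let := hG.partialOrder
  have := hG.isOrderedAddMonoid
  have hP : ∀ a : G, 0 ≤ a ↔ a ∈ P := fun a => by
    change a - 0 ∈ P ↔ _
    rw [sub_zero]
  refine ⟨fun a₁ a₂ b₁ b₂ => hG.riesz a₁ a₂ b₁ b₂, fun n a hn h => ?_, fun a ha b => ?_⟩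
  · rw [hP] at h ⊢
    exact hG.unperforated n a (by omega) (by rwa [natCast_zsmul])
  · obtain ⟨n, hn, h⟩ := (hG.simple a ((hP a).1 ha.le) ha.ne').2 b
    lift n to ℕ using by omega
    exact ⟨n, by rwa [natCast_zsmul] at h⟩

end IsSimpleDimensionGroup

/-- every countable simple dimension group `(G, G⁺, u)` with
noncyclic rational subgroup `ℚ(G, u)` is realized as `(K⁰(X,T), K⁰(X,T)⁺, 𝟙)`
of a Toeplitz flow with prescribed entropy `t`, whose continuous eigenvalues
of modulus-one root-of-unity type are governed by divisibility of `u` in `G`. -/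
theorem simple_dimension_group_realized_by_toeplitz_flow
    (G : Type) [AddCommGroup G] (P : Set G) (u : G)
    (hG : IsSimpleDimensionGroup G P)
    (hu : IsOrderUnitFor P u)
    (hQ : ¬ ∃ g ∈ rationalSubgroup G u, ∀ x ∈ rationalSubgroup G u, ∃ n : ℤ, x = n • g)
    (t : ℝ) (ht : 0 ≤ t) :
    ∃ F : ToeplitzFlow, ∃ φ : C(F.X, ℤ) →+ G,
      Function.Surjective φ ∧
      φ.ker = coboundaries F.T ∧
      ⇑φ '' {f : C(F.X, ℤ) | ∀ x : F.X, 0 ≤ f x} = P ∧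
      φ 1 = u ∧
      F.entropy = (t : EReal) ∧
      (∀ p : ℤ, 2 ≤ p →
        ((∃ Fc : C(F.X, ℂ), Fc ≠ 0 ∧
            ∀ x : F.X, Fc (F.T x) = Complex.exp (2 * Real.pi * Complex.I / p) * Fc x)
          ↔ ∃ g : G, p • g = u)) ∧
      (∀ lam : ℂ,
        (∃ Fc : C(F.X, ℂ), Fc ≠ 0 ∧ ∀ x : F.X, Fc (F.T x) = lam * Fc x) →
        ∃ n : ℕ, 1 ≤ n ∧ lam ^ n = 1) := by
  have := hG.countable
  let : PartialOrder G := hG.partialOrder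
  have : IsOrderedAddMonoid G := hG.isOrderedAddMonoid
  have hR := hG.simpleRieszGroup
  have hP : ∀ a : G, 0 ≤ a ↔ a ∈ P := fun a => by
    change a - 0 ∈ P ↔ _
    rw [sub_zero]
  have hu0 : 0 < u := by
    refine lt_of_le_of_ne ((hP u).2 hu.1) fun h0 => hQ ?_
    refine ⟨0, zero_mem _, fun x hx => ⟨0, ?_⟩⟩
    obtain ⟨n, hn, m, h⟩ := hx
    lift n to ℕ using by omega
    rw [← h0, smul_zero, natCast_zsmul, ← smul_zero n] at h
    rw [hR.eq_of_nsmul_eq (by omega) h, zero_smul]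
  obtain ⟨W, g, hg, hlow, hupp⟩ := hR.exists_wordSystem hu0 (exists_large_nsmul_eq (u := u)
    (fun n a b hn h => hR.eq_of_nsmul_eq hn h) hQ) ht
  refine ⟨W.flow, WordSystem.toGroup hg, WordSystem.toGroup_surjective hg fun x => ?_, ?_, ?_,
    WordSystem.toGroup_one hg, W.entropy_flow ht hlow hupp, fun p hp =>
    WordSystem.exists_eigenfunction_iff hg hp, fun lam ⟨f, hf, h⟩ => ?_⟩
  · obtain ⟨a, ha, b, hb, h⟩ := hG.directed x
    exact ⟨a, b, (hP a).2 ha, (hP b).2 hb, h⟩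
  · ext f
    exact WordSystem.toGroup_eq_zero_iff hg f
  · ext p
    rw [← hP]
    constructor
    · rintro ⟨f, hf, rfl⟩
      exact WordSystem.toGroup_nonneg hg hf
    · exact fun hp => WordSystem.exists_toGroup_eq hg hp
  · obtain ⟨n, hn⟩ := W.exists_pow_q_eq_one hf h
    exact ⟨_, W.q_pos n, hn⟩
end

section
/- Let η be a nonperiodic Toeplitz sequence over a finite alphabet Λ and (X, T) its associated Toeplitz flow. Then (K⁰(X,T), K⁰(X,T)⁺) is a simple dimension group — it is countable, directed, unperforated, satisfies Riesz interpolation, every nonzero element of K⁰(X,T)⁺ is an order unit, and it is not cyclic — and there exists a subgroup H of K⁰(X,T) with 𝟙 ∈ H such that H is not cyclic, H has rank one (for all a, b ∈ H there exist integers m, n, not both zero, with m·a = n·b), and H ∩ K⁰(X,T)⁺ ≠ {0}. -/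
/-- `K⁰(X, T) = C(X, ℤ) / B_T`. -/
def K0 (X : Type*) [TopologicalSpace X] (T : X ≃ₜ X) : Type _ :=
  C(X, ℤ) ⧸ coboundaries T

instance (X : Type*) [TopologicalSpace X] (T : X ≃ₜ X) : AddCommGroup (K0 X T) :=
  inferInstanceAs (AddCommGroup (C(X, ℤ) ⧸ coboundaries T))

/-- The positive cone `K⁰(X,T)⁺`: the image of the nonnegative functions. -/
def K0Pos (X : Type*) [TopologicalSpace X] (T : X ≃ₜ X) : Set (K0 X T) :=
  (QuotientAddGroup.mk (s := coboundaries T)) '' {f : C(X, ℤ) | ∀ x : X, 0 ≤ f x}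

/-- The distinguished order unit `𝟙`: the class of the constant function `1`. -/
def K0One (X : Type*) [TopologicalSpace X] (T : X ≃ₜ X) : K0 X T :=
  QuotientAddGroup.mk (s := coboundaries T) 1

section Cohomology

variable {X : Type*} [TopologicalSpace X] {T : X ≃ₜ X}

/-- The quotient homomorphism `C(X, ℤ) → K⁰(X, T)`. -/
def K0.mk (T : X ≃ₜ X) : C(X, ℤ) →+ K0 X T :=
  QuotientAddGroup.mk' (coboundaries T)

lemma K0.mk_surjective : Function.Surjective (K0.mk T) :=
  QuotientAddGroup.mk'_surjective _

lemma K0.mk_one : K0.mk T 1 = K0One X T := rfl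

lemma K0.mk_eq_zero_iff {f : C(X, ℤ)} :
    K0.mk T f = 0 ↔ ∃ g : C(X, ℤ), ∀ x, f (T x) = g (T x) - g x := by
  refine (QuotientAddGroup.eq_zero_iff (N := coboundaries T) f).trans ?_
  constructor
  · rintro ⟨g, rfl⟩
    exact ⟨g, fun x => by simp [coboundaryHom]⟩
  · rintro ⟨g, hg⟩
    refine ⟨g, ?_⟩
    ext x
    have := hg (T.symm x)
    simp only [Homeomorph.apply_symm_apply] at this
    simp [coboundaryHom, this]

lemma K0.mk_mem_pos {f : C(X, ℤ)} (hf : ∀ x, 0 ≤ f x) : K0.mk T f ∈ K0Pos X T :=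
  ⟨f, hf, rfl⟩

lemma K0.exists_of_mem_pos {f : C(X, ℤ)} (hf : K0.mk T f ∈ K0Pos X T) :
    ∃ p : C(X, ℤ), (∀ x, 0 ≤ p x) ∧ K0.mk T (f - p) = 0 := by
  obtain ⟨p, hp, h⟩ := hf
  exact ⟨p, hp, by rw [map_sub, sub_eq_zero]; exact h.symm⟩

lemma K0.add_mem_pos {a b : K0 X T} (ha : a ∈ K0Pos X T) (hb : b ∈ K0Pos X T) :
    a + b ∈ K0Pos X T := by
  obtain ⟨p, hp, rfl⟩ := ha
  obtain ⟨q, hq, rfl⟩ := hb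
  exact ⟨p + q, fun x => add_nonneg (hp x) (hq x), rfl⟩

lemma ContinuousMap.exists_forall_le_natCast [CompactSpace X] (f : C(X, ℤ)) :
    ∃ M : ℕ, 1 ≤ M ∧ ∀ x, f x ≤ M := by
  refine ⟨⌈‖f‖⌉₊ + 1, by omega, fun x => ?_⟩
  have h1 := f.norm_coe_le_norm x
  have h2 := Nat.le_ceil ‖f‖
  rw [Int.norm_eq_abs] at h1
  have h3 : ((f x : ℤ) : ℝ) ≤ (⌈‖f‖⌉₊ : ℝ) := (le_abs_self _).trans (h1.trans h2)
  have h4 : f x ≤ (⌈‖f‖⌉₊ : ℤ) := by exact_mod_cast h3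
  push_cast
  linarith

/-- Precomposition of `f` with the `n`-th iterate of `T`. -/
def ContinuousMap.compIterate (T : X ≃ₜ X) (n : ℕ) (f : C(X, ℤ)) : C(X, ℤ) :=
  f.comp ⟨T^[n], T.continuous.iterate n⟩

@[simp]
lemma ContinuousMap.compIterate_apply (n : ℕ) (f : C(X, ℤ)) (x : X) :
    f.compIterate T n x = f (T^[n] x) := rfl

lemma K0.mk_compIterate (n : ℕ) (f : C(X, ℤ)) :
    K0.mk T (f.compIterate T n) = K0.mk T f := by
  induction n with
  | zero => rfl
  | succ n ih =>
    rw [← ih, ← sub_eq_zero, ← map_sub, K0.mk_eq_zero_iff]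
    refine ⟨f.compIterate T (n + 1), fun x => ?_⟩
    simp [Function.iterate_succ_apply]

/-- The indicator `e` of the base of a clopen tower of height `d` exhausting `X`, whose base
contains `x₀`. -/
structure IsTower (T : X ≃ₜ X) (x₀ : X) (d : ℕ) (e : C(X, ℤ)) : Prop where
  nonneg : ∀ x, 0 ≤ e x
  base : e x₀ = 1
  sum_eq_one : ∀ x, ∑ i ∈ Finset.range d, e (T^[i] x) = 1

namespace IsTower

variable {x₀ : X} {d : ℕ} {e : C(X, ℤ)}

lemma pos (h : IsTower T x₀ d e) : 0 < d := by
  rcases Nat.eq_zero_or_pos d with rfl | hd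
  · simpa using h.sum_eq_one x₀
  · exact hd

lemma le_one (h : IsTower T x₀ d e) (x : X) : e x ≤ 1 := by
  rw [← h.sum_eq_one x]
  exact Finset.single_le_sum (f := fun i => e (T^[i] x)) (fun i _ => h.nonneg _)
    (Finset.mem_range.2 h.pos)

lemma iterate_height (h : IsTower T x₀ d e) (x : X) : e (T^[d] x) = e x := by
  have h1 := h.sum_eq_one (T x)
  have h2 := Finset.sum_range_sub (fun i => e (T^[i] x)) d
  simp only [← Function.iterate_succ_apply] at h1
  rw [Finset.sum_sub_distrib, h1, h.sum_eq_one x] at h2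
  simp only [Function.iterate_zero, id] at h2
  linarith

lemma nsmul_mk (h : IsTower T x₀ d e) : d • K0.mk T e = K0One X T := by
  have : (1 : C(X, ℤ)) = ∑ i ∈ Finset.range d, e.compIterate T i := by
    ext x
    simp [ContinuousMap.sum_apply, h.sum_eq_one x]
  rw [← K0.mk_one, this, map_sum]
  simp [K0.mk_compIterate]

end IsTower

/-- The function supported on the base `e` of a tower of height `d` whose value at `x` is the sum
of `f` along the orbit of `x` through the tower. -/
def towerSum (T : X ≃ₜ X) (d : ℕ) (e f : C(X, ℤ)) : C(X, ℤ) :=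
  ∑ i ∈ Finset.range d, e * f.compIterate T (i + 1)

lemma towerSum_apply (d : ℕ) (e f : C(X, ℤ)) (x : X) :
    towerSum T d e f x = e x * ∑ i ∈ Finset.range d, f (T^[i + 1] x) := by
  simp [towerSum, ContinuousMap.sum_apply, Finset.mul_sum]

lemma towerSum_sub (d : ℕ) (e f g : C(X, ℤ)) :
    towerSum T d e (f - g) = towerSum T d e f - towerSum T d e g := by
  ext x
  simp [towerSum_apply, Finset.sum_sub_distrib, mul_sub]

lemma towerSum_nonneg {d : ℕ} {e f : C(X, ℤ)} (he : ∀ x, 0 ≤ e x) (hf : ∀ x, 0 ≤ f x) (x : X) :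
    0 ≤ towerSum T d e f x := by
  rw [towerSum_apply]
  exact mul_nonneg (he x) (Finset.sum_nonneg fun i _ => hf _)

lemma IsTower.mk_towerSum {x₀ : X} {d : ℕ} {e : C(X, ℤ)} (h : IsTower T x₀ d e) (f : C(X, ℤ)) :
    K0.mk T (towerSum T d e f) = K0.mk T f := by
  have key : ∀ i ∈ Finset.range d, K0.mk T (e * f.compIterate T (i + 1)) =
      K0.mk T (f * e.compIterate T (d - 1 - i)) := by
    intro i hi
    rw [← K0.mk_compIterate (i + 1) (f * e.compIterate T (d - 1 - i))]
    congr 1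
    ext x
    have hd : d - 1 - i + (i + 1) = d := by
      have := Finset.mem_range.1 hi
      omega
    simp only [ContinuousMap.mul_apply, ContinuousMap.compIterate_apply]
    rw [← Function.iterate_add_apply, hd, h.iterate_height, mul_comm]
  rw [towerSum, map_sum, Finset.sum_congr rfl key, ← map_sum, ← Finset.mul_sum,
    Finset.sum_range_reflect (fun j => e.compIterate T j) d]
  congr 1
  ext x
  simp [ContinuousMap.sum_apply, h.sum_eq_one x]

lemma IsTower.towerSum_eq_zero {x₀ : X} {d : ℕ} {e f g : C(X, ℤ)} (h : IsTower T x₀ d e)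
    (hfg : ∀ x, f (T x) = g (T x) - g x) (hg : ∀ x, e x * g x = e x * g x₀) :
    towerSum T d e f = 0 := by
  ext x
  have h1 : ∀ i, f (T^[i + 1] x) = g (T^[i + 1] x) - g (T^[i] x) := fun i => by
    rw [Function.iterate_succ_apply', hfg]
  have h2 := hg (T^[d] x)
  rw [h.iterate_height] at h2
  simp only [towerSum_apply, h1, Finset.sum_range_sub (fun i => g (T^[i] x)) d, mul_sub, h2,
    Function.iterate_zero, id, hg x, sub_self, ContinuousMap.zero_apply]

/-- A homeomorphism has shrinking towers at `x₀` if there are towers of arbitrarily large height on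
whose bases any given finitely many functions are constant. -/
def HasShrinkingTowers (T : X ≃ₜ X) (x₀ : X) : Prop :=
  ∀ (s : Set C(X, ℤ)) (D : ℕ), s.Finite → ∃ d > D, ∃ e : C(X, ℤ), IsTower T x₀ d e ∧
    ∀ g ∈ s, ∀ x, e x * g x = e x * g x₀

namespace HasShrinkingTowers

variable {x₀ : X}

lemma exists_towerSum_eq_zero (h : HasShrinkingTowers T x₀) {s : Set C(X, ℤ)} (hs : s.Finite)
    (h0 : ∀ f ∈ s, K0.mk T f = 0) :
    ∃ d e, IsTower T x₀ d e ∧ ∀ f ∈ s, towerSum T d e f = 0 := by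
  choose! g hg using fun f hf => K0.mk_eq_zero_iff.1 (h0 f hf)
  obtain ⟨d, -, e, he, hc⟩ := h (g '' s) 0 (hs.image g)
  exact ⟨d, e, he, fun f hf => he.towerSum_eq_zero (hg f hf) (hc _ (Set.mem_image_of_mem g hf))⟩

lemma K0One_ne_zero (h : HasShrinkingTowers T x₀) : K0One X T ≠ 0 := by
  intro h1
  obtain ⟨d, e, he, h0⟩ := h.exists_towerSum_eq_zero (Set.finite_singleton (1 : C(X, ℤ)))
    (by rintro f rfl; exact h1)
  have := congrArg (fun f : C(X, ℤ) => f x₀) (h0 1 rfl)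
  have hd := he.pos
  simp [towerSum_apply, he.base] at this
  omega

lemma eq_zero_of_mem_pos_of_neg_mem_pos (h : HasShrinkingTowers T x₀) {a : K0 X T}
    (ha : a ∈ K0Pos X T) (hna : -a ∈ K0Pos X T) : a = 0 := by
  obtain ⟨p, hp, rfl⟩ := ha
  obtain ⟨q, hq, hpq⟩ := hna
  change K0.mk T q = -K0.mk T p at hpq
  change K0.mk T p = 0
  obtain ⟨d, e, he, h0⟩ := h.exists_towerSum_eq_zero (Set.finite_singleton (q - (-p)))
    (by rintro f rfl; rw [map_sub, map_neg, hpq, sub_self])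
  have h1 := h0 _ rfl
  rw [← he.mk_towerSum p]
  convert map_zero (K0.mk T)
  ext x
  have h2 := congrArg (fun f : C(X, ℤ) => f x) h1
  have h3 : towerSum T d e (q - (-p)) x = towerSum T d e q x + towerSum T d e p x := by
    simp [towerSum_apply, Finset.sum_add_distrib, mul_add]
  have h4 := towerSum_nonneg (T := T) (d := d) he.nonneg hp x
  have h5 := towerSum_nonneg (T := T) (d := d) he.nonneg hq x
  simp only [h3, ContinuousMap.zero_apply] at h2 ⊢
  linarith

lemma mem_pos_of_zsmul_mem_pos (h : HasShrinkingTowers T x₀) {n : ℤ} (hn : 1 ≤ n) {a : K0 X T}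
    (ha : n • a ∈ K0Pos X T) : a ∈ K0Pos X T := by
  obtain ⟨f, rfl⟩ := K0.mk_surjective a
  rw [← map_zsmul] at ha
  obtain ⟨p, hp, hfp⟩ := K0.exists_of_mem_pos ha
  obtain ⟨d, e, he, h0⟩ := h.exists_towerSum_eq_zero (Set.finite_singleton (n • f - p))
    (by rintro f rfl; exact hfp)
  have h1 := h0 _ rfl
  rw [towerSum_sub, sub_eq_zero] at h1
  rw [← he.mk_towerSum f]
  refine K0.mk_mem_pos fun x => ?_
  have h2 := towerSum_nonneg (T := T) (d := d) he.nonneg hp x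
  rw [← h1] at h2
  have h3 : towerSum T d e (n • f) x = n * towerSum T d e f x := by
    simp only [towerSum_apply, ContinuousMap.smul_apply, smul_eq_mul, ← Finset.mul_sum]
    ring
  rw [h3] at h2
  exact nonneg_of_mul_nonneg_right h2 (by omega)

lemma eq_zero_of_zsmul_eq_zero (h : HasShrinkingTowers T x₀) {n : ℤ} (hn : n ≠ 0) {a : K0 X T}
    (ha : n • a = 0) : a = 0 := by
  have h0 : (0 : K0 X T) ∈ K0Pos X T := by
    rw [← map_zero (K0.mk T)]
    exact K0.mk_mem_pos fun _ => le_rfl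
  have ha' : |n| • a = 0 := by
    rcases abs_choice n with hn' | hn' <;> simp [hn', ha]
  have hn' : 1 ≤ |n| := Int.one_le_abs hn
  refine h.eq_zero_of_mem_pos_of_neg_mem_pos (h.mem_pos_of_zsmul_mem_pos hn' (ha' ▸ h0))
    (h.mem_pos_of_zsmul_mem_pos hn' ?_)
  rw [smul_neg, ha', neg_zero]
  exact h0

lemma riesz (h : HasShrinkingTowers T x₀) (a₁ a₂ b₁ b₂ : K0 X T) (h₁₁ : b₁ - a₁ ∈ K0Pos X T)
    (h₂₁ : b₂ - a₁ ∈ K0Pos X T) (h₁₂ : b₁ - a₂ ∈ K0Pos X T) (h₂₂ : b₂ - a₂ ∈ K0Pos X T) :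
    ∃ c, c - a₁ ∈ K0Pos X T ∧ c - a₂ ∈ K0Pos X T ∧ b₁ - c ∈ K0Pos X T ∧ b₂ - c ∈ K0Pos X T := by
  obtain ⟨a₁, rfl⟩ := K0.mk_surjective a₁
  obtain ⟨a₂, rfl⟩ := K0.mk_surjective a₂
  obtain ⟨b₁, rfl⟩ := K0.mk_surjective b₁
  obtain ⟨b₂, rfl⟩ := K0.mk_surjective b₂
  simp only [← map_sub] at h₁₁ h₂₁ h₁₂ h₂₂
  obtain ⟨p₁₁, hp₁₁, h₁₁⟩ := K0.exists_of_mem_pos h₁₁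
  obtain ⟨p₂₁, hp₂₁, h₂₁⟩ := K0.exists_of_mem_pos h₂₁
  obtain ⟨p₁₂, hp₁₂, h₁₂⟩ := K0.exists_of_mem_pos h₁₂
  obtain ⟨p₂₂, hp₂₂, h₂₂⟩ := K0.exists_of_mem_pos h₂₂
  obtain ⟨d, e, he, h0⟩ := h.exists_towerSum_eq_zero
    (s := {b₁ - a₁ - p₁₁, b₂ - a₁ - p₂₁, b₁ - a₂ - p₁₂, b₂ - a₂ - p₂₂}) (Set.toFinite _)
    (by rintro f (rfl | rfl | rfl | rfl) <;> assumption)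
  have le_of : ∀ {a b p : C(X, ℤ)}, (∀ x, 0 ≤ p x) → towerSum T d e (b - a - p) = 0 →
      ∀ x, towerSum T d e a x ≤ towerSum T d e b x := by
    intro a b p hp hz x
    rw [towerSum_sub, sub_eq_zero, towerSum_sub] at hz
    have := towerSum_nonneg (T := T) (d := d) he.nonneg hp x
    rw [← hz, ContinuousMap.sub_apply] at this
    linarith
  have l₁₁ := le_of hp₁₁ (h0 (b₁ - a₁ - p₁₁) (by simp))
  have l₂₁ := le_of hp₂₁ (h0 (b₂ - a₁ - p₂₁) (by simp))
  have l₁₂ := le_of hp₁₂ (h0 (b₁ - a₂ - p₁₂) (by simp))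
  have l₂₂ := le_of hp₂₂ (h0 (b₂ - a₂ - p₂₂) (by simp))
  rw [← he.mk_towerSum a₁, ← he.mk_towerSum a₂, ← he.mk_towerSum b₁, ← he.mk_towerSum b₂]
  refine ⟨K0.mk T (towerSum T d e a₁ ⊔ towerSum T d e a₂), ?_⟩
  simp only [← map_sub]
  refine ⟨K0.mk_mem_pos fun x => ?_, K0.mk_mem_pos fun x => ?_, K0.mk_mem_pos fun x => ?_,
    K0.mk_mem_pos fun x => ?_⟩ <;>
  simp only [ContinuousMap.sub_apply, ContinuousMap.sup_apply, sub_nonneg]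
  · exact le_sup_left
  · exact le_sup_right
  · exact sup_le (l₁₁ x) (l₁₂ x)
  · exact sup_le (l₂₁ x) (l₂₂ x)

lemma isOrderUnitFor [CompactSpace X] (h : HasShrinkingTowers T x₀)
    (hd : ∀ f : C(X, ℤ), f ≠ 0 → ∃ n : ℕ, f (T^[n] x₀) ≠ 0) {a : K0 X T}
    (ha : a ∈ K0Pos X T) (ha0 : a ≠ 0) : IsOrderUnitFor (K0Pos X T) a := by
  refine ⟨ha, fun b => ?_⟩
  obtain ⟨p, hp, rfl⟩ := ha
  change K0.mk T p ≠ 0 at ha0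
  change ∃ n : ℤ, 1 ≤ n ∧ n • K0.mk T p - b ∈ K0Pos X T
  obtain ⟨n, hn⟩ := hd p (by rintro rfl; exact ha0 (map_zero _))
  obtain ⟨d, -, e, he, hc⟩ := h {p.compIterate T n} 0 (Set.finite_singleton _)
  have hle : ∀ x, 0 ≤ (p.compIterate T n - e) x := by
    intro x
    have h1 := hc _ rfl x
    have h2 := he.nonneg x
    have h3 := he.le_one x
    have h4 : 0 < p (T^[n] x₀) := lt_of_le_of_ne (hp _) hn.symm
    have h5 := hp (T^[n] x)
    simp only [ContinuousMap.compIterate_apply, ContinuousMap.sub_apply] at h1 ⊢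
    rcases (show e x = 0 ∨ e x = 1 by omega) with h6 | h6 <;> rw [h6] at h1 ⊢ <;> linarith
  obtain ⟨f, rfl⟩ := K0.mk_surjective b
  obtain ⟨M, hM, hf⟩ := f.exists_forall_le_natCast
  refine ⟨(M : ℤ) * d, ?_, ?_⟩
  · exact_mod_cast Nat.mul_pos hM he.pos
  · have hsplit : ((M : ℤ) * d) • K0.mk T p - K0.mk T f =
        K0.mk T (((M : ℤ) * d) • (p.compIterate T n - e)) + K0.mk T ((M : ℤ) • 1 - f) := by
      rw [map_zsmul, map_sub, map_sub, map_zsmul, K0.mk_compIterate, K0.mk_one, ← he.nsmul_mk,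
        smul_sub, ← natCast_zsmul, smul_smul]
      abel
    rw [hsplit]
    refine K0.add_mem_pos (K0.mk_mem_pos fun x => ?_) (K0.mk_mem_pos fun x => ?_)
    · rw [ContinuousMap.smul_apply, smul_eq_mul]
      exact mul_nonneg (by positivity) (hle x)
    · have := hf x
      simp only [ContinuousMap.sub_apply, ContinuousMap.smul_apply, ContinuousMap.one_apply,
        smul_eq_mul]
      linarith

/-- The subgroup of elements of `K⁰(X, T)` with a nonzero multiple in `ℤ 𝟙`. -/
def divisorSubgroup (T : X ≃ₜ X) : AddSubgroup (K0 X T) where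
  carrier := {a | ∃ n m : ℤ, n ≠ 0 ∧ n • a = m • K0One X T}
  zero_mem' := ⟨1, 0, one_ne_zero, by simp⟩
  neg_mem' := by
    rintro a ⟨n, m, hn, h⟩
    exact ⟨n, -m, hn, by rw [smul_neg, h, neg_smul]⟩
  add_mem' := by
    rintro a b ⟨n, m, hn, h⟩ ⟨n', m', hn', h'⟩
    refine ⟨n * n', n' * m + n * m', mul_ne_zero hn hn', ?_⟩
    rw [smul_add, mul_comm n n', mul_smul, h, mul_comm n' n, mul_smul n n', h', add_smul,
      mul_smul, mul_smul]

lemma not_forall_divisorSubgroup_eq_zsmul (h : HasShrinkingTowers T x₀) (g : K0 X T) :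
    ¬ ∀ x ∈ divisorSubgroup T, ∃ n : ℤ, x = n • g := by
  intro hg
  obtain ⟨k, hk⟩ := hg (K0One X T) ⟨1, 1, one_ne_zero, rfl⟩
  obtain ⟨d, hd, e, he, -⟩ := h ∅ k.natAbs Set.finite_empty
  obtain ⟨j, hj⟩ := hg (K0.mk T e)
    ⟨d, 1, by exact_mod_cast he.pos.ne', by rw [natCast_zsmul, he.nsmul_mk, one_smul]⟩
  have h1 : ((d : ℤ) * j - k) • g = 0 := by
    rw [sub_smul, mul_smul, ← hj, ← hk, natCast_zsmul, he.nsmul_mk, sub_self]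
  have hk0 : k ≠ 0 := by
    rintro rfl
    exact h.K0One_ne_zero (by rw [hk, zero_smul])
  by_cases h2 : (d : ℤ) * j - k = 0
  · have h3 : (d : ℤ) ∣ k := ⟨j, by linarith⟩
    have := Nat.le_of_dvd (Int.natAbs_pos.2 hk0) (Int.natCast_dvd.1 h3)
    omega
  · exact h.K0One_ne_zero (by rw [hk, h.eq_zero_of_zsmul_eq_zero h2 h1, smul_zero])

lemma exists_zsmul_eq_zsmul {a b : K0 X T} (ha : a ∈ divisorSubgroup T)
    (hb : b ∈ divisorSubgroup T) : ∃ m n : ℤ, ¬ (m = 0 ∧ n = 0) ∧ m • a = n • b := by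
  obtain ⟨n, m, hn, h⟩ := ha
  obtain ⟨n', m', hn', h'⟩ := hb
  by_cases hm : m = 0
  · exact ⟨n, 0, by simp [hn], by rw [h, hm, zero_smul, zero_smul]⟩
  · refine ⟨m' * n, m * n', fun h0 => mul_ne_zero hm hn' h0.2, ?_⟩
    rw [mul_smul, h, mul_smul, h', smul_smul, smul_smul, mul_comm]

theorem isSimpleDimensionGroup [CompactSpace X] [Countable C(X, ℤ)] (h : HasShrinkingTowers T x₀)
    (hd : ∀ f : C(X, ℤ), f ≠ 0 → ∃ n : ℕ, f (T^[n] x₀) ≠ 0) :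
    IsSimpleDimensionGroup (K0 X T) (K0Pos X T) where
  countable := (K0.mk_surjective (T := T)).countable
  zero_mem := ⟨0, fun _ => le_rfl, rfl⟩
  add_mem _ _ := K0.add_mem_pos
  pos_neg_eq_zero _ := h.eq_zero_of_mem_pos_of_neg_mem_pos
  directed g := by
    obtain ⟨f, rfl⟩ := K0.mk_surjective g
    refine ⟨K0.mk T (f ⊔ 0), K0.mk_mem_pos fun x => ?_, K0.mk T (f ⊔ 0 - f),
      K0.mk_mem_pos fun x => ?_, by rw [map_sub, sub_sub_cancel]⟩
    · simp
    · simp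
  unperforated _ _ hn := h.mem_pos_of_zsmul_mem_pos hn
  riesz := h.riesz
  simple _ := h.isOrderUnitFor hd
  noncyclic := fun ⟨g, hg⟩ => h.not_forall_divisorSubgroup_eq_zsmul g fun x _ => hg x

end HasShrinkingTowers

instance ContinuousMap.countable_int [CompactSpace X] [T2Space X] [SecondCountableTopology X] :
    Countable C(X, ℤ) := by
  have : DiscreteTopology C(X, ℤ) := by
    refine DiscreteTopology.of_forall_le_dist one_pos fun f g hfg => ?_
    by_contra! hlt
    refine hfg (ContinuousMap.ext fun x => ?_)
    have h1 := (ContinuousMap.dist_apply_le_dist (f := f) (g := g) x).trans_lt hlt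
    rw [Int.dist_eq] at h1
    have h2 : |f x - g x| < 1 := by exact_mod_cast h1
    rw [Int.abs_lt_one_iff] at h2
    linarith
  exact countable_of_Lindelof_of_discrete

end Cohomology

section Toeplitz

variable {Λ : Type*}

lemma IsToeplitz.exists_common_period {η : ℤ → Λ} (h : IsToeplitz η) (F : Finset ℤ) :
    ∃ p : ℤ, 1 ≤ p ∧ ∀ k ∈ F, ∀ m : ℤ, η (k + m * p) = η k := by
  classical
  induction F using Finset.induction_on with
  | empty => exact ⟨1, le_rfl, by simp⟩
  | insert a F _ ih =>
    obtain ⟨p, hp, hF⟩ := ih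
    obtain ⟨q, hq, ha⟩ := h a
    refine ⟨p * q, one_le_mul_of_one_le_of_one_le hp hq, fun k hk m => ?_⟩
    rcases Finset.mem_insert.1 hk with rfl | hk
    · rw [← mul_assoc]
      exact ha _
    · rw [mul_comm p q, ← mul_assoc]
      exact hF k hk _

variable [TopologicalSpace Λ] {η : ℤ → Λ} {p : ℤ}

/-- The point `η` of the Toeplitz flow of `η`. -/
def toeplitzPoint (η : ℤ → Λ) : toeplitzX η :=
  ⟨η, subset_closure ⟨0, by simp⟩⟩

lemma toeplitzT_iterate_apply (n : ℕ) (x : toeplitzX η) :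
    ((toeplitzT η)^[n] x).1 = fun k => x.1 (k + n) := by
  induction n generalizing x with
  | zero => simp
  | succ n ih =>
    rw [Function.iterate_succ_apply, ih]
    funext k
    change x.1 (k + n + 1) = _
    push_cast
    rw [add_assoc]

lemma exists_finset_of_isOpen {V : Set (toeplitzX η)} (hV : IsOpen V) {x : toeplitzX η}
    (hx : x ∈ V) : ∃ F : Finset ℤ, ∀ y : toeplitzX η, (∀ k ∈ F, y.1 k = x.1 k) → y ∈ V := by
  obtain ⟨W, hW, rfl⟩ := isOpen_induced_iff.1 hV
  obtain ⟨F, u, hu, hsub⟩ := isOpen_pi_iff.1 hW x.1 hx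
  refine ⟨F, fun y hy => hsub fun k hk => ?_⟩
  rw [hy k hk]
  exact (hu k hk).2

variable [DiscreteTopology Λ]

lemma mem_closure_iff_forall_finset {ι : Type*} {s : Set (ι → Λ)} {x : ι → Λ} :
    x ∈ closure s ↔ ∀ F : Finset ι, ∃ y ∈ s, ∀ k ∈ F, y k = x k := by
  rw [mem_closure_iff]
  constructor
  · intro h F
    obtain ⟨y, hy, hys⟩ := h ((F : Set ι).pi fun k => {x k})
      (isOpen_set_pi F.finite_toSet fun _ _ => isOpen_discrete _) (fun k _ => rfl)
    exact ⟨y, hys, fun k hk => hy k hk⟩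
  · intro h o ho hx
    obtain ⟨F, u, hu, hsub⟩ := isOpen_pi_iff.1 ho x hx
    obtain ⟨y, hys, hy⟩ := h F
    refine ⟨y, hsub fun k hk => ?_, hys⟩
    rw [hy k hk]
    exact (hu k hk).2

/-- The closure of the shifts of `η` by the elements of `j + pℤ`. -/
def residueClosure (η : ℤ → Λ) (p j : ℤ) : Set (ℤ → Λ) :=
  closure (Set.range fun n : ℤ => fun k => η (k + (j + n * p)))

lemma mem_residueClosure_iff {j : ℤ} {x : ℤ → Λ} :
    x ∈ residueClosure η p j ↔ ∀ F : Finset ℤ, ∃ n : ℤ, ∀ k ∈ F, η (k + (j + n * p)) = x k := by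
  simp [residueClosure, mem_closure_iff_forall_finset]

lemma mem_toeplitzX_iff {x : ℤ → Λ} :
    x ∈ toeplitzX η ↔ ∀ F : Finset ℤ, ∃ n : ℤ, ∀ k ∈ F, η (k + n) = x k := by
  simp [toeplitzX, shiftOrbit, mem_closure_iff_forall_finset]

lemma shift_mem_residueClosure_add_iff {i j : ℤ} {x : ℤ → Λ} :
    (fun k => x (k + i)) ∈ residueClosure η p (j + i) ↔ x ∈ residueClosure η p j := by
  simp only [mem_residueClosure_iff]
  constructor
  · intro h F
    obtain ⟨n, hn⟩ := h (F.map (Equiv.subRight i).toEmbedding)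
    refine ⟨n, fun k hk => ?_⟩
    have := hn (k - i) (Finset.mem_map.2 ⟨k, hk, rfl⟩)
    rw [sub_add_cancel] at this
    rw [← this]
    congr 1
    ring
  · intro h F
    obtain ⟨n, hn⟩ := h (F.map (Equiv.addRight i).toEmbedding)
    refine ⟨n, fun k hk => ?_⟩
    rw [← hn (k + i) (Finset.mem_map.2 ⟨k, hk, rfl⟩)]
    congr 1
    ring

lemma shift_mem_residueClosure (i : ℤ) : (fun k => η (k + i)) ∈ residueClosure η p i :=
  mem_residueClosure_iff.2 fun _ => ⟨0, fun k _ => by simp⟩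

lemma residueClosure_subset {i j : ℤ} (h : (fun k => η (k + i)) ∈ residueClosure η p j) :
    residueClosure η p i ⊆ residueClosure η p j := by
  refine closure_minimal ?_ isClosed_closure
  rintro _ ⟨n, rfl⟩
  have h1 := shift_mem_residueClosure_add_iff (i := n * p) |>.2 h
  rw [mem_residueClosure_iff] at h1 ⊢
  intro F
  obtain ⟨m, hm⟩ := h1 F
  refine ⟨m + n, fun k hk => ?_⟩
  have := hm k hk
  convert this using 2 <;> ring

/-- Each `residueClosure η p i` is a minimal set of the `p`-th power of the shift. -/
lemma IsToeplitz.shift_mem_residueClosure_of_mem (h : IsToeplitz η) {i j : ℤ} {x : ℤ → Λ}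
    (hi : x ∈ residueClosure η p i) (hj : x ∈ residueClosure η p j) :
    (fun k => η (k + i)) ∈ residueClosure η p j := by
  classical
  rw [mem_residueClosure_iff] at hi hj ⊢
  intro F
  obtain ⟨q, hq, hF⟩ := h.exists_common_period (F.image (· + i))
  have hF' : ∀ k ∈ F, ∀ m : ℤ, η (k + i + m * q) = η (k + i) := fun k hk =>
    hF _ (Finset.mem_image_of_mem _ hk)
  obtain ⟨n, hn⟩ := hi
    ((Finset.Ico 0 q).biUnion fun r => F.image (· - r * p))
  obtain ⟨m, hm⟩ := hj
    ((Finset.Ico 0 q).biUnion fun r => F.image (· - r * p))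
  have hr : n % q ∈ Finset.Ico 0 q :=
    Finset.mem_Ico.2 ⟨Int.emod_nonneg _ (by omega), Int.emod_lt_of_pos _ (by omega)⟩
  refine ⟨m - n % q, fun k hk => ?_⟩
  have hmem : k - n % q * p ∈ (Finset.Ico 0 q).biUnion fun r => F.image (· - r * p) :=
    Finset.mem_biUnion.2 ⟨_, hr, Finset.mem_image_of_mem _ hk⟩
  have h1 := hm _ hmem
  rw [← hn _ hmem] at h1
  rw [← hF' k hk (n / q * p)]
  have h2 : n - n % q = n / q * q := by
    have := Int.emod_add_mul_ediv n q
    linarith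
  convert h1 using 2
  · ring
  · linear_combination (-p) * h2

lemma IsToeplitz.residueClosure_eq_of_mem (h : IsToeplitz η) {i j : ℤ} {x : ℤ → Λ}
    (hi : x ∈ residueClosure η p i) (hj : x ∈ residueClosure η p j) :
    residueClosure η p i = residueClosure η p j :=
  (residueClosure_subset (h.shift_mem_residueClosure_of_mem hi hj)).antisymm
    (residueClosure_subset (h.shift_mem_residueClosure_of_mem hj hi))

lemma residueClosure_self : residueClosure η p p = residueClosure η p 0 := by
  ext x
  simp only [mem_residueClosure_iff]
  refine forall_congr' fun F => ⟨fun ⟨n, hn⟩ => ⟨n + 1, fun k hk => ?_⟩,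
    fun ⟨n, hn⟩ => ⟨n - 1, fun k hk => ?_⟩⟩ <;>
  · rw [← hn k hk]
    congr 1
    ring

/-- The residues `i` for which `residueClosure η p i` is the same set as for the residue `0`. -/
def residueStabilizer (h : IsToeplitz η) (p : ℤ) : AddSubgroup ℤ where
  carrier := {i | (fun k => η (k + i)) ∈ residueClosure η p 0}
  zero_mem' := shift_mem_residueClosure 0
  add_mem' := by
    intro a b ha hb
    have h1 := shift_mem_residueClosure_add_iff (i := b) |>.2 ha
    rw [zero_add] at h1
    have := residueClosure_subset hb h1
    simpa only [Set.mem_ofPred_eq, add_assoc, add_comm b a] using this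
  neg_mem' := by
    intro a ha
    have h1 := h.shift_mem_residueClosure_of_mem ha (shift_mem_residueClosure a)
    have h2 := shift_mem_residueClosure_add_iff (i := -a) |>.2 h1
    simpa only [Set.mem_ofPred_eq, add_neg_cancel, add_zero] using h2

lemma mem_residueStabilizer_iff (h : IsToeplitz η) {i j : ℤ} {x : ℤ → Λ}
    (hx : x ∈ residueClosure η p j) :
    j - i ∈ residueStabilizer h p ↔ x ∈ residueClosure η p i := by
  have h1 : j - i ∈ residueStabilizer h p ↔ (fun k => η (k + j)) ∈ residueClosure η p i := by
    rw [← zero_add i, ← shift_mem_residueClosure_add_iff (i := -i)]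
    simp [residueStabilizer, add_assoc, sub_eq_neg_add]
  rw [h1]
  exact ⟨fun h2 => residueClosure_subset h2 hx, h.shift_mem_residueClosure_of_mem hx⟩

lemma exists_mem_residueClosure (hp : 1 ≤ p) {x : ℤ → Λ} (hx : x ∈ toeplitzX η) :
    ∃ j, x ∈ residueClosure η p j := by
  classical
  by_contra! hne
  simp only [mem_residueClosure_iff, not_forall] at hne
  choose F hF using hne
  obtain ⟨n, hn⟩ := mem_toeplitzX_iff.1 hx ((Finset.Ico 0 p).biUnion F)
  refine hF (n % p) ⟨n / p, fun k hk => ?_⟩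
  rw [← hn k (Finset.mem_biUnion.2 ⟨n % p, Finset.mem_Ico.2
    ⟨Int.emod_nonneg _ (by omega), Int.emod_lt_of_pos _ (by omega)⟩, hk⟩),
    mul_comm, Int.emod_add_mul_ediv]

lemma exists_residueStabilizer_eq (h : IsToeplitz η) (hp : 1 ≤ p) :
    ∃ d : ℕ, 0 < d ∧ ∀ i, i ∈ residueStabilizer h p ↔ (d : ℤ) ∣ i := by
  obtain ⟨a, ha⟩ := Int.subgroup_cyclic (residueStabilizer h p)
  have hmem : ∀ i, i ∈ residueStabilizer h p ↔ ((a.natAbs : ℕ) : ℤ) ∣ i := fun i => by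
    rw [ha, AddSubgroup.mem_closure_singleton, Int.natAbs_dvd]
    exact ⟨fun ⟨n, hn⟩ => ⟨n, by rw [← hn, smul_eq_mul, mul_comm]⟩,
      fun ⟨n, hn⟩ => ⟨n, by rw [hn, smul_eq_mul, mul_comm]⟩⟩
  refine ⟨a.natAbs, Nat.pos_of_ne_zero fun h0 => ?_, hmem⟩
  have hpm : p ∈ residueStabilizer h p := by
    change (fun k => η (k + p)) ∈ residueClosure η p 0
    rw [← residueClosure_self]
    exact shift_mem_residueClosure p
  rw [hmem, h0, Nat.cast_zero, zero_dvd_iff] at hpm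
  omega

lemma isClopen_residueClosure (h : IsToeplitz η) (hp : 1 ≤ p) (i : ℤ) :
    IsClopen {x : toeplitzX η | x.1 ∈ residueClosure η p i} := by
  have hclosed : ∀ j, IsClosed {x : toeplitzX η | x.1 ∈ residueClosure η p j} := fun j =>
    isClosed_closure.preimage continuous_subtype_val
  refine ⟨hclosed i, ?_⟩
  obtain ⟨d, hd, hmem⟩ := exists_residueStabilizer_eq h hp
  have hcompl : {x : toeplitzX η | x.1 ∈ residueClosure η p i}ᶜ =
      ⋃ j ∈ {j ∈ Finset.Ico (0 : ℤ) d | ¬ (d : ℤ) ∣ j - i},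
        {x : toeplitzX η | x.1 ∈ residueClosure η p j} := by
    ext x
    simp only [Set.mem_compl_iff, Set.mem_ofPred_eq, Set.mem_iUnion, exists_prop,
      Finset.mem_filter, Finset.mem_Ico]
    constructor
    · intro hx
      obtain ⟨j, hj⟩ := exists_mem_residueClosure hp x.2
      have hj' : x.1 ∈ residueClosure η p (j % d) := by
        rw [← mem_residueStabilizer_iff h hj, hmem]
        exact Int.dvd_self_sub_emod
      refine ⟨j % d, ⟨⟨Int.emod_nonneg _ (by omega), Int.emod_lt_of_pos _ (by omega)⟩, ?_⟩, hj'⟩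
      rwa [← hmem, mem_residueStabilizer_iff h hj']
    · rintro ⟨j, ⟨-, hji⟩, hj⟩ hi
      rw [← hmem, mem_residueStabilizer_iff h hj] at hji
      exact hji hi
  rw [← isClosed_compl_iff, hcompl]
  exact Set.Finite.isClosed_biUnion (Finset.finite_toSet _) fun j _ => hclosed j

lemma hasShrinkingTowers_toeplitzT (h : IsToeplitz η) (hnp : IsNonperiodic η) :
    HasShrinkingTowers (toeplitzT η) (toeplitzPoint η) := by
  classical
  intro s D hs
  have hopen : IsOpen (⋂ g ∈ s, {x : toeplitzX η | g x = g (toeplitzPoint η)}) :=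
    hs.isOpen_biInter fun g _ => (isOpen_discrete {g (toeplitzPoint η)}).preimage g.continuous
  obtain ⟨F, hF⟩ := exists_finset_of_isOpen hopen (x := toeplitzPoint η) (by simp)
  have hshift : ∀ t : ℤ, 1 ≤ t → ∃ k, η (k + t) ≠ η k := by
    intro t ht
    by_contra! hk
    exact hnp ⟨t, ht, hk⟩
  choose! w hw using hshift
  obtain ⟨p, hp, hper⟩ := h.exists_common_period (F ∪ (Finset.Icc (1 : ℤ) D).image w)
  have hcyl : ∀ x ∈ residueClosure η p 0, ∀ k ∈ F ∪ (Finset.Icc (1 : ℤ) D).image w,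
      x k = η k := by
    intro x hx k hk
    obtain ⟨n, hn⟩ := mem_residueClosure_iff.1 hx {k}
    rw [← hn k (Finset.mem_singleton_self k), zero_add, hper k hk]
  obtain ⟨d, hd, hmem⟩ := exists_residueStabilizer_eq h hp
  have hclopen := isClopen_residueClosure h hp 0
  let e : C(toeplitzX η, ℤ) := (LocallyConstant.charFn ℤ hclopen : C(toeplitzX η, ℤ))
  have he_apply : ∀ x, e x = if x.1 ∈ residueClosure η p 0 then 1 else 0 := by
    intro x
    split_ifs with hx
    · exact (LocallyConstant.charFn_eq_one ℤ x hclopen).2 hx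
    · exact (LocallyConstant.charFn_eq_zero ℤ x hclopen).2 hx
  refine ⟨d, ?_, e, ⟨fun x => ?_, ?_, fun x => ?_⟩, fun g hg x => ?_⟩
  · by_contra! hdD
    have hdmem : (d : ℤ) ∈ residueStabilizer h p := (hmem d).2 dvd_rfl
    refine hw d (by omega) (hcyl _ hdmem _ (Finset.mem_union_right _
      (Finset.mem_image_of_mem w (Finset.mem_Icc.2 ⟨by omega, by omega⟩))))
  · rw [he_apply]
    split_ifs <;> norm_num
  · rw [he_apply, if_pos]
    have h0 := shift_mem_residueClosure (η := η) (p := p) 0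
    simp only [add_zero] at h0
    exact h0
  · obtain ⟨j, hj⟩ := exists_mem_residueClosure hp x.2
    have hi : ∀ i : ℕ, e ((toeplitzT η)^[i] x) = if (d : ℤ) ∣ j + i then 1 else 0 := by
      intro i
      have h1 := shift_mem_residueClosure_add_iff (i := (i : ℤ)) |>.2 hj
      rw [he_apply, toeplitzT_iterate_apply]
      exact if_congr (by rw [← mem_residueStabilizer_iff h h1, hmem, sub_zero]) rfl rfl
    simp only [hi]
    have h2 : ((-j) % d).toNat ∈ Finset.range d := by
      have := Int.emod_lt_of_pos (-j) (by omega : (0 : ℤ) < d)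
      rw [Finset.mem_range]
      omega
    have h3 : 0 ≤ (-j) % (d : ℤ) := Int.emod_nonneg _ (by omega)
    rw [Finset.sum_eq_single_of_mem _ h2, if_pos]
    · rw [Int.toNat_of_nonneg h3]
      have h4 : j + -j % (d : ℤ) = -(-j - -j % (d : ℤ)) := by ring
      rw [h4, dvd_neg]
      exact Int.dvd_self_sub_emod
    · intro i hid hne
      rw [if_neg]
      intro hdvd
      apply hne
      have h4 : (i : ℤ) % d = (-j) % d :=
        ((Int.modEq_iff_dvd (a := -j) (b := i)).2 (by simpa [add_comm] using hdvd)).symm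
      rw [← h4, Int.emod_eq_of_lt (by omega) (by exact_mod_cast Finset.mem_range.1 hid)]
      simp
  · rw [he_apply]
    split_ifs with hx
    · have := hF x fun k hk => hcyl _ hx k (Finset.mem_union_left _ hk)
      rw [Set.mem_iInter₂.1 this g hg]
    · simp

lemma exists_iterate_toeplitzPoint_ne_zero (h : IsToeplitz η) {f : C(toeplitzX η, ℤ)}
    (hf : f ≠ 0) : ∃ n : ℕ, f ((toeplitzT η)^[n] (toeplitzPoint η)) ≠ 0 := by
  classical
  obtain ⟨z, hz⟩ := DFunLike.ne_iff.1 hf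
  obtain ⟨F, hF⟩ := exists_finset_of_isOpen
    ((isOpen_discrete ({0}ᶜ : Set ℤ)).preimage f.continuous) (x := z) hz
  obtain ⟨n, hn⟩ := mem_toeplitzX_iff.1 z.2 F
  obtain ⟨q, hq, hper⟩ := h.exists_common_period (F.image (· + n))
  have hpos : 0 ≤ n + |n| * q := by
    have h1 := neg_abs_le n
    have h2 := abs_nonneg n
    nlinarith
  refine ⟨(n + |n| * q).toNat, hF _ fun k hk => ?_⟩
  rw [toeplitzT_iterate_apply, Int.toNat_of_nonneg hpos, ← hn k hk,
    ← hper (k + n) (Finset.mem_image_of_mem _ hk) |n|, add_assoc]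
  rfl

end Toeplitz

/-- for a Toeplitz flow `(X, T)`, `(K⁰(X,T), K⁰(X,T)⁺)` is a
simple dimension group, and it contains a noncyclic rank-one subgroup `H`
containing `𝟙` with `H ∩ K⁰(X,T)⁺ ≠ {0}`. -/
theorem toeplitz_K0_simple_dimension_group
    (Λ : Type*) [Fintype Λ] [Nonempty Λ] [TopologicalSpace Λ] [DiscreteTopology Λ]
    (η : ℤ → Λ) (htoe : IsToeplitz η) (hnp : IsNonperiodic η) :
    IsSimpleDimensionGroup (K0 ↥(toeplitzX η) (toeplitzT η))
        (K0Pos ↥(toeplitzX η) (toeplitzT η)) ∧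
    ∃ H : AddSubgroup (K0 ↥(toeplitzX η) (toeplitzT η)),
      K0One ↥(toeplitzX η) (toeplitzT η) ∈ H ∧
      (¬ ∃ g ∈ H, ∀ x ∈ H, ∃ n : ℤ, x = n • g) ∧
      (∀ a ∈ H, ∀ b ∈ H, ∃ m n : ℤ, ¬ (m = 0 ∧ n = 0) ∧ m • a = n • b) ∧
      (H : Set (K0 ↥(toeplitzX η) (toeplitzT η))) ∩
          K0Pos ↥(toeplitzX η) (toeplitzT η) ≠ {0} := by
  have : CompactSpace (toeplitzX η) := isCompact_iff_compactSpace.1 isClosed_closure.isCompact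
  have ht := hasShrinkingTowers_toeplitzT htoe hnp
  refine ⟨ht.isSimpleDimensionGroup fun _ => exists_iterate_toeplitzPoint_ne_zero htoe,
    HasShrinkingTowers.divisorSubgroup _, ⟨1, 1, one_ne_zero, rfl⟩,
    fun ⟨g, _, hg⟩ => ht.not_forall_divisorSubgroup_eq_zsmul g hg,
    fun a ha b hb => HasShrinkingTowers.exists_zsmul_eq_zsmul ha hb, fun h => ?_⟩
  have h1 : K0One (toeplitzX η) (toeplitzT η) ∈
      ({0} : Set (K0 (toeplitzX η) (toeplitzT η))) :=
    h ▸ ⟨⟨1, 1, one_ne_zero, rfl⟩, K0.mk_mem_pos fun _ => zero_le_one⟩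
  exact ht.K0One_ne_zero h1
end
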